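/- Assume the Elliott–Halberstam conjecture, i.e., that the primes have level of distribution ϑ = 1. Then for sufficiently small fixed η > 0, as N → ∞, #{j : N < p_j ≤ 2N, p_{j+2} − p_j ≤ η log N} ≥ (1 − o(1))·e^{c₇ η^{−2} log η}·N/log N, where c₇ = 5 is admissible (note e^{5 η^{−2} log η} = η^{5/η²}). -/

import Mathlib

open Finset

/-- The `n`-th prime number (`nthPrime 0 = 2`). -/
noncomputable def nthPrime (n : ℕ) : ℕ := Nat.nth Nat.Prime n

/-- The prime counting function `π(x)` at a real argument: the number of primes `≤ x`. -/
noncomputable def primePi (x : ℝ) : ℕ := Nat.primeCounting ⌊x⌋₊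

/-- `P_H(n) = ∏_{h ∈ H} (n + h)`. -/
def tuplePoly (H : Finset ℕ) (n : ℕ) : ℕ := ∏ h ∈ H, (n + h)

/-- `ν_p(H)`: the number of distinct residue classes modulo `p` occupied by `H`. -/
def nuP (p : ℕ) (H : Finset ℕ) : ℕ := (H.image (· % p)).card

/-- `H` is admissible: for every prime `p`, the elements of `H` miss a residue class mod `p`. -/
def Admissible (H : Finset ℕ) : Prop := ∀ p : ℕ, p.Prime → nuP p H < p

/-- The singular series `𝔖(H) = ∏_p (1 - 1/p)^{-|H|} (1 - ν_p(H)/p)`. -/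
noncomputable def singularSeries (H : Finset ℕ) : ℝ :=
  ∏' p : Nat.Primes, ((1 - 1/((p : ℕ) : ℝ)) ^ (-(H.card : ℤ)) * (1 - (nuP p H : ℝ)/((p : ℕ) : ℝ)))

/-- `Λ_R(n; H, ℓ) = (1/(|H|+ℓ)!) ∑_{d ∣ P_H(n), d ≤ R} μ(d) (log (R/d))^{|H|+ℓ}`. -/
noncomputable def LambdaR (R : ℝ) (n : ℕ) (H : Finset ℕ) (ℓ : ℕ) : ℝ :=
  (1 / (H.card + ℓ).factorial : ℝ) *
    ∑ d ∈ (tuplePoly H n).divisors.filter (fun d : ℕ => (d : ℝ) ≤ R),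
      (ArithmeticFunction.moebius d : ℝ) * (Real.log (R / d)) ^ (H.card + ℓ)

/-- `𝒫(x)`: the product of all primes `≤ x`. -/
noncomputable def primorialReal (x : ℝ) : ℕ :=
  ∏ p ∈ (Finset.range (⌊x⌋₊ + 1)).filter Nat.Prime, p

/-- `θ(n) = log n` if `n` is prime, and `0` otherwise. -/
noncomputable def theta (n : ℕ) : ℝ := if n.Prime then Real.log n else 0

/-- `∑_{p ≤ N, p prime, p ≡ a (mod q)} log p`. -/
noncomputable def primeSumAP (N q a : ℕ) : ℝ :=
  ∑ p ∈ (Finset.range (N+1)).filter (fun p => p.Prime ∧ p % q = a % q), Real.log p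

/-- The primes have level of distribution `ϑ`: for every `A > 0` and `ε > 0`,
`∑_{q ≤ N^{ϑ-ε}} max_{(a,q)=1} |∑_{p ≤ N, p ≡ a (q)} log p - N/φ(q)| ≪_{A,ε} N (log N)^{-A}`
(the max over `a` is expressed via an arbitrary coprime choice function `a : ℕ → ℕ`). -/
def HasLevelOfDistribution (ϑ : ℝ) : Prop :=
  ∀ A : ℝ, 0 < A → ∀ ε : ℝ, 0 < ε → ∃ C : ℝ, 0 < C ∧
    ∀ N : ℕ, 2 ≤ N → ∀ a : ℕ → ℕ, (∀ q : ℕ, Nat.Coprime (a q) q) →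
      ∑ q ∈ Finset.Icc 1 ⌊(N : ℝ) ^ (ϑ - ε)⌋₊,
        |primeSumAP N q (a q) - (N : ℝ) / (Nat.totient q)| ≤ C * N / (Real.log N) ^ A

/-- The number of `j` with `N < p_j ≤ 2N` and `p_{j+1} - p_j ≤ h`. -/
noncomputable def gapCount (N : ℕ) (h : ℝ) : ℕ :=
  ((Finset.range (2*N+1)).filter (fun j =>
    N < nthPrime j ∧ nthPrime j ≤ 2*N ∧ ((nthPrime (j+1) : ℝ) - nthPrime j) ≤ h)).card

/-- The number of `j` with `N < p_j ≤ 2N` and `p_{j+2} - p_j ≤ h`. -/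
noncomputable def gapCount2 (N : ℕ) (h : ℝ) : ℕ :=
  ((Finset.range (2*N+1)).filter (fun j =>
    N < nthPrime j ∧ nthPrime j ≤ 2*N ∧ ((nthPrime (j+2) : ℝ) - nthPrime j) ≤ h)).card

/-- primes up to `z` -/
def prs (z : ℕ) : Finset ℕ := (Finset.range (z+1)).filter Nat.Prime

lemma mem_prs {z p : ℕ} : p ∈ prs z ↔ p ≤ z ∧ p.Prime := by
  simp [prs]

lemma sum_prs_succ (f : ℕ → ℝ) (n : ℕ) :
    ∑ p ∈ prs (n+1), f p = ∑ p ∈ prs n, f p + if (n+1).Prime then f (n+1) else 0 := by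
  unfold prs
  rw [Finset.range_add_one (n := n+1), Finset.filter_insert]
  split_ifs with h
  · rw [Finset.sum_insert (by simp), add_comm]
  · simp

lemma bdd_of_incr (x y : ℕ → ℝ) (n0 : ℕ)
    (h : ∀ n, n0 ≤ n → |x (n+1) - x n| ≤ y (n+1) - y n) :
    ∀ n, n0 ≤ n → |x n - x n0| ≤ y n - y n0 := by
  intro n hn
  induction n, hn using Nat.le_induction with
  | base => simp
  | succ n hn ih =>
    have := h n hn
    have h3 : |x (n+1) - x n0| ≤ |x (n+1) - x n| + |x n - x n0| := abs_sub_le _ _ _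
    linarith

lemma pnt_of_EH (hEH : HasLevelOfDistribution 1) :
    ∃ C : ℝ, 0 < C ∧ ∀ m : ℕ, 2 ≤ m →
      |∑ p ∈ prs m, Real.log p - m| ≤ C * m / (Real.log m)^2 := by
  obtain ⟨C, hC, h⟩ := hEH 2 (by norm_num) (1/2) (by norm_num)
  refine ⟨C, hC, fun m hm => ?_⟩
  have h1 := h m hm (fun _ => 1) (fun q => by simp)
  have h2 : (1:ℕ) ∈ Finset.Icc 1 ⌊(m : ℝ) ^ ((1:ℝ) - 1/2)⌋₊ := by
    simp only [Finset.mem_Icc, le_refl, true_and]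
    rw [Nat.one_le_floor_iff]
    apply Real.one_le_rpow
    · exact_mod_cast (by omega : 1 ≤ m)
    · norm_num
  have h3 := Finset.single_le_sum (f := fun q => |primeSumAP m q ((fun _ => 1) q) - (m : ℝ) / (Nat.totient q)|)
    (fun i _ => abs_nonneg _) h2
  have h4 := h3.trans h1
  have e : (Real.log m) ^ (2:ℝ) = (Real.log m)^2 := by
    rw [← Real.rpow_natCast]; norm_num
  rw [e] at h4
  simpa [primeSumAP, Nat.mod_one, prs] using h4

lemma mertens1 (hEH : HasLevelOfDistribution 1) :
    ∃ C : ℝ, 0 < C ∧ ∀ n : ℕ, 2 ≤ n →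
      |∑ p ∈ prs n, Real.log p / p - Real.log n| ≤ C := by
  obtain ⟨C, hC, h⟩ := pnt_of_EH hEH
  set th : ℕ → ℝ := fun m => ∑ p ∈ prs m, Real.log p with hth
  set A : ℕ → ℝ := fun m => ∑ p ∈ prs m, Real.log p / p with hA
  set x : ℕ → ℝ := fun n => A n - th n / (n+1) - Real.log n with hx
  set y : ℕ → ℝ := fun n => - 2 * C / Real.log (n+1) - 1/(n:ℝ) - 1/((n:ℝ)+1) with hy
  have key := bdd_of_incr x y 2 (by
    intro n hn
    have hn' : (2:ℝ) ≤ n := by exact_mod_cast hn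
    have hA1 : A (n+1) - A n = (th (n+1) - th n)/(n+1) := by
      simp only [hA, hth, sum_prs_succ]
      split_ifs <;> push_cast <;> ring
    have hxd : x (n+1) - x n = th (n+1) / ((n+1)*(n+2)) - (Real.log (n+1) - Real.log n) := by
      have : A (n+1) = A n + (th (n+1) - th n)/(n+1) := by linarith
      simp only [hx, this]
      push_cast
      have : (n:ℝ)+1+1 = n+2 := by ring
      rw [this]
      field_simp
      ring
    have h1 := h (n+1) (by omega)
    push_cast at h1
    change |th (n+1) - _| ≤ _ at h1
    set m : ℝ := (n:ℝ)+1 with hm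
    have hm3 : 3 ≤ m := by linarith
    have hlog : 0 < Real.log m := Real.log_pos (by linarith)
    have hm2 : (n:ℝ)+2 = m+1 := by rw [hm]; ring
    have hyd : y (n+1) - y n = 2*C*(1/Real.log m - 1/Real.log (m+1)) + (1/(m-1) - 1/(m+1)) := by
      simp only [hy]; push_cast
      rw [show (n:ℝ) = m - 1 by rw [hm]; ring]
      ring_nf
    rw [hxd, hyd, hm2, show (n:ℝ) = m - 1 by rw [hm]; ring]
    have e1 : th (n+1) / (m*(m+1)) = 1/(m+1) + (th (n+1) - m)/(m*(m+1)) := by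
      field_simp; ring
    have e2 : |(th (n+1) - m)/(m*(m+1))| ≤ 2*C*(1/Real.log m - 1/Real.log (m+1)) := by
      rw [abs_div, abs_of_pos (by positivity : 0 < m*(m+1))]
      have l1 : 1/(m+1) ≤ Real.log (m+1) - Real.log m := by
        rw [← Real.log_div (by positivity) (by positivity)]
        have := Real.one_sub_inv_le_log_of_pos (x := (m+1)/m) (by positivity)
        refine le_trans (le_of_eq ?_) this
        field_simp; ring
      have l2 : Real.log (m+1) ≤ 2 * Real.log m := by
        rw [show 2 * Real.log m = Real.log (m^2) by rw [Real.log_pow]; norm_num]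
        apply Real.log_le_log (by positivity); nlinarith
      have hl1 : 0 < Real.log (m+1) := Real.log_pos (by linarith)
      calc |th (n+1) - m| / (m*(m+1)) ≤ (C*m/(Real.log m)^2)/(m*(m+1)) := by gcongr
        _ = C * (1/(m+1)) / (Real.log m)^2 := by field_simp
        _ ≤ C * (Real.log (m+1) - Real.log m) / (Real.log m)^2 := by gcongr
        _ ≤ 2 * (C * (Real.log (m+1) - Real.log m) / (Real.log m * Real.log (m+1))) := by
          have : 0 ≤ C * (Real.log (m+1) - Real.log m) := by
            have : 0 < 1/(m+1) := by positivity
            have : 0 ≤ Real.log (m+1) - Real.log m := by linarith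
            positivity
          rw [← mul_div_assoc, div_le_div_iff₀ (by positivity) (by positivity)]
          have : C * (Real.log (m+1) - Real.log m) * Real.log m * Real.log (m+1) ≤ C * (Real.log (m+1) - Real.log m) * Real.log m * (2 * Real.log m) := by gcongr
          nlinarith
        _ = _ := by field_simp
    have l3 : 1/m ≤ Real.log m - Real.log (m-1) := by
        rw [← Real.log_div (by positivity) (by linarith)]
        have := Real.one_sub_inv_le_log_of_pos (x := m/(m-1)) (div_pos (by linarith) (by linarith))
        refine le_trans (le_of_eq ?_) this
        have : m - 1 ≠ 0 := by linarith
        field_simp; ring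
    have l4 : Real.log m - Real.log (m-1) ≤ 1/(m-1) := by
        rw [← Real.log_div (by positivity) (by linarith)]
        have := Real.log_le_sub_one_of_pos (x := m/(m-1)) (div_pos (by linarith) (by linarith))
        refine le_trans this (le_of_eq ?_)
        have : m - 1 ≠ 0 := by linarith
        field_simp; ring
    have l5 : 1/(m+1) ≤ 1/m := by gcongr; linarith
    rw [e1]
    rw [abs_le] at e2 ⊢
    constructor <;> linarith [e2.1, e2.2])
  refine ⟨|x 2| + (|y 2|) + (1 + C / (Real.log 2)^2) , by positivity, fun n hn => ?_⟩
  have k1 := key n hn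
  have hn' : (2:ℝ) ≤ n := by exact_mod_cast hn
  have k2 : y n ≤ 0 := by
    simp only [hy]
    have : 0 < Real.log ((n:ℝ)+1) := Real.log_pos (by linarith)
    have : 0 ≤ 2 * C / Real.log ((n:ℝ)+1) := by positivity
    have : 0 ≤ 1/(n:ℝ) := by positivity
    have : 0 ≤ 1/((n:ℝ)+1) := by positivity
    have : -2 * C / Real.log ((n:ℝ)+1) = -(2 * C / Real.log ((n:ℝ)+1)) := by ring
    linarith
  have k3 : |th n / (n+1)| ≤ 1 + C/(Real.log 2)^2 := by
    have h1 := h n hn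
    change |th n - _| ≤ _ at h1
    have hl2 : 0 < Real.log 2 := Real.log_pos (by norm_num)
    have hl : Real.log 2 ≤ Real.log n := Real.log_le_log (by norm_num) hn'
    have : C * n / (Real.log n)^2 ≤ C * n/(Real.log 2)^2 := by gcongr
    have h2 : |th n| ≤ n + C * n / (Real.log 2)^2 := by
      have := abs_sub_abs_le_abs_sub (th n) n
      rw [abs_of_pos (by linarith : (0:ℝ) < n)] at this
      linarith
    rw [abs_div, abs_of_pos (by linarith : (0:ℝ) < n+1), div_le_iff₀ (by linarith)]
    have : 0 ≤ C/(Real.log 2)^2 := by positivity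
    have e : C * n / (Real.log 2)^2 = C/(Real.log 2)^2 * n := by ring
    nlinarith
  have e : ∑ p ∈ prs n, Real.log p / p - Real.log n = (x n - x 2) + x 2 + th n / (n+1) := by
    simp only [hx, hA]; ring
  rw [e]
  have t1 := abs_add_le ((x n - x 2) + x 2) (th n / (n+1))
  have t2 := abs_add_le (x n - x 2) (x 2)
  have t3 := neg_abs_le (y 2)
  linarith

lemma mertens2 (hEH : HasLevelOfDistribution 1) :
    ∃ C : ℝ, 0 < C ∧ ∀ n : ℕ, 2 ≤ n →
      |∑ p ∈ prs n, 1 / (p:ℝ) - Real.log (Real.log n)| ≤ C := by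
  obtain ⟨C, hC, h⟩ := mertens1 hEH
  set A : ℕ → ℝ := fun m => ∑ p ∈ prs m, Real.log p / p with hA
  set S : ℕ → ℝ := fun m => ∑ p ∈ prs m, 1 / (p:ℝ) with hS
  set x : ℕ → ℝ := fun n => S n - Real.log (Real.log n) - (A n - Real.log n)/Real.log n with hx
  set y : ℕ → ℝ := fun n => - (1 + C) / Real.log n with hy
  have key := bdd_of_incr x y 2 (by
    intro n hn
    have hn' : (2:ℝ) ≤ n := by exact_mod_cast hn
    have hu : 0 < Real.log n := Real.log_pos (by linarith)
    have huv : Real.log n < Real.log ((n:ℝ)+1) := Real.log_lt_log (by linarith) (by linarith)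
    have hSA : S (n+1) = S n + (A (n+1) - A n) / Real.log ((n:ℝ)+1) := by
      have hne : Real.log ((n:ℝ)+1) ≠ 0 := by linarith
      simp only [hS, hA, sum_prs_succ]
      split_ifs
      · push_cast; field_simp; ring
      · simp
    have hv1 : Real.log ((n:ℝ)+1) - Real.log n ≤ 1 := by
        rw [← Real.log_div (by positivity) (by linarith)]
        have := Real.log_le_sub_one_of_pos (x := ((n:ℝ)+1)/n) (by positivity)
        refine le_trans this ?_
        have : ((n:ℝ)+1)/n ≤ 2 := by rw [div_le_iff₀ (by linarith)]; linarith
        linarith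
    have hr := h n hn
    change |A n - _| ≤ _ at hr
    simp only [hx, hy, hSA]
    push_cast
    set u := Real.log (n:ℝ)
    set v := Real.log ((n:ℝ)+1)
    have hv : 0 < v := by linarith
    have e1 : S n + (A (n+1) - A n)/v - Real.log v - (A (n+1) - v)/v - (S n - Real.log u - (A n - u)/u)
      = ((v-u)/v - Real.log (v/u)) + (A n - u) * (1/u-1/v) := by
      rw [Real.log_div hv.ne' hu.ne']
      field_simp; ring
    rw [e1]
    have hd : 0 ≤ 1/u - 1/v := by
      have : 1/v ≤ 1/u := by gcongr
      linarith
    have b1 : |(A n - u) * (1/u-1/v)| ≤ C * (1/u-1/v) := by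
      rw [abs_mul, abs_of_nonneg hd]; gcongr
    have b2 : |(v-u)/v - Real.log (v/u)| ≤ 1/u-1/v := by
      have l1 := Real.one_sub_inv_le_log_of_pos (x := v/u) (by positivity)
      have l2 := Real.log_le_sub_one_of_pos (x := v/u) (by positivity)
      have e3 : (v-u)/v = 1 - (v/u)⁻¹ := by field_simp
      have e4 : v/u - 1 - (1 - (v/u)⁻¹) = (v-u)*(1/u-1/v) := by field_simp
      have : (v-u)*(1/u-1/v) ≤ 1 * (1/u-1/v) := by gcongr
      rw [e3, abs_le]; constructor <;> linarith
    have t := abs_add_le ((v-u)/v - Real.log (v/u)) ((A n - u) * (1/u-1/v))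
    have e5 : -(1+C)/v - -(1+C)/u = (1+C)*(1/u-1/v) := by ring
    rw [e5]; linarith)
  have hl2 : 0 < Real.log 2 := Real.log_pos (by norm_num)
  refine ⟨|x 2| + |y 2| + C/Real.log 2 , by positivity, fun n hn => ?_⟩
  have k1 := key n hn
  have hn' : (2:ℝ) ≤ n := by exact_mod_cast hn
  have hl : Real.log 2 ≤ Real.log n := Real.log_le_log (by norm_num) hn'
  have k2 : y n ≤ 0 := by
    simp only [hy]
    have : 0 ≤ (1+C)/Real.log n := by positivity
    have e: -(1+C)/Real.log n = -((1+C)/Real.log n) := by ring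
    linarith
  have k3 : |(A n - Real.log n)/Real.log n| ≤ C/Real.log 2 := by
    rw [abs_div, abs_of_pos (by linarith : 0 < Real.log n)]
    have := h n hn
    gcongr
  have e : ∑ p ∈ prs n, 1 / (p:ℝ) - Real.log (Real.log n) = (x n - x 2) + x 2 + (A n - Real.log n)/Real.log n := by
    simp only [hx, hS]; ring
  rw [e]
  have t1 := abs_add_le ((x n - x 2) + x 2) ((A n - Real.log n)/Real.log n)
  have t2 := abs_add_le (x n - x 2) (x 2)
  have t3 := neg_abs_le (y 2)
  linarith

lemma prs_mono {x y : ℕ} (h : x ≤ y) : prs x ⊆ prs y := by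
  intro p hp; rw [mem_prs] at *; exact ⟨hp.1.trans h, hp.2⟩

lemma mertens_block (hEH : HasLevelOfDistribution 1) :
    ∃ C : ℝ, 0 < C ∧ ∀ z : ℕ, ∑ p ∈ prs z \ prs (Nat.sqrt z), 1 / (p:ℝ) ≤ C := by
  obtain ⟨C, hC, h⟩ := mertens2 hEH
  refine ⟨2*C + 2 + 4, by positivity, fun z => ?_⟩
  by_cases hz : z < 4
  · calc ∑ p ∈ prs z \ prs (Nat.sqrt z), 1 / (p:ℝ) ≤ ∑ p ∈ prs z, 1 / (p:ℝ) :=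
        Finset.sum_le_sum_of_subset_of_nonneg Finset.sdiff_subset (fun _ _ _ => by positivity)
      _ ≤ ∑ p ∈ prs z, (1:ℝ) := by
        apply Finset.sum_le_sum
        intro p hp
        have : (1:ℝ) ≤ p := by exact_mod_cast (mem_prs.1 hp).2.one_lt.le
        rw [div_le_one (by linarith)]; exact this
      _ ≤ 4 := by
        simp only [Finset.sum_const, nsmul_eq_mul, mul_one]
        have : (prs z).card ≤ z + 1 := (Finset.card_filter_le _ _).trans (by simp)
        exact_mod_cast (by omega)
      _ ≤ _ := by linarith
  · push Not at hz
    set s := Nat.sqrt z with hs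
    have hs2 : 2 ≤ s := by rw [hs, Nat.le_sqrt]; omega
    have h1 := h z (by omega)
    have h2 := h s hs2
    have hsz : s ≤ z := Nat.sqrt_le_self z
    have e := Finset.sum_sdiff (f := fun p : ℕ => 1/(p:ℝ)) (prs_mono hsz)
    have hs2' : (2:ℝ) ≤ s := by exact_mod_cast hs2
    have l1 : 0 < Real.log s := Real.log_pos (by linarith)
    have l0 : Real.log z ≤ 4 * Real.log s := by
      rw [show 4 * Real.log s = Real.log ((s:ℝ)^4) by rw [Real.log_pow]; norm_num]
      have : z < (s+1)*(s+1) := Nat.lt_succ_sqrt z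
      have : z ≤ s^4 := by nlinarith [Nat.pow_le_pow_left hs2 2, Nat.pow_le_pow_left hs2 3]
      apply Real.log_le_log
      · exact_mod_cast (by omega : 0 < z)
      · exact_mod_cast this
    have l2 : Real.log (Real.log z) ≤ Real.log (Real.log s) + 2 := by
      have hzpos : 0 < Real.log z := Real.log_pos (by exact_mod_cast (by omega : 1 < z))
      have := Real.log_le_log hzpos l0
      rw [Real.log_mul (by norm_num) l1.ne'] at this
      have h4 : Real.log 4 ≤ 2 := by
        rw [show (4:ℝ) = 2^2 by norm_num, Real.log_pow]
        have := Real.log_two_lt_d9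
        push_cast; linarith
      linarith
    rw [abs_le] at h1 h2
    linarith [h1.1, h1.2, h2.1, h2.2]

/-- elementary symmetric sum -/
noncomputable def esum (m : ℕ) (g : ℕ → ℝ) (B : Finset ℕ) : ℝ :=
  ∑ S ∈ B.powersetCard m, ∏ p ∈ S, g p

noncomputable def yv (b : ℕ) (g : ℕ → ℝ) (B : Finset ℕ) : ℝ :=
  ∑ i ∈ range (b+1), (-1)^i * esum i g B

lemma esum_zero (g : ℕ → ℝ) (B : Finset ℕ) : esum 0 g B = 1 := by simp [esum]

lemma esum_succ_empty (m : ℕ) (g : ℕ → ℝ) : esum (m+1) g ∅ = 0 := by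
  unfold esum
  rw [Finset.powersetCard_eq_empty.2 (by simp)]
  simp

lemma esum_insert (m : ℕ) (g : ℕ → ℝ) (B : Finset ℕ) (p : ℕ) (hp : p ∉ B) :
    esum (m+1) g (insert p B) = esum (m+1) g B + g p * esum m g B := by
  unfold esum
  rw [Finset.powersetCard_succ_insert hp, Finset.sum_union, Finset.sum_image, Finset.mul_sum]
  · congr 1
    apply Finset.sum_congr rfl
    intro S hS
    rw [Finset.prod_insert]
    intro h; exact hp ((Finset.mem_powersetCard.1 hS).1 h)
  · intro S hS T hT h
    have h1 : p ∉ S := fun h => hp ((Finset.mem_powersetCard.1 hS).1 h)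
    have h2 : p ∉ T := fun h => hp ((Finset.mem_powersetCard.1 hT).1 h)
    rw [← Finset.erase_insert h1, ← Finset.erase_insert h2, h]
  · rw [Finset.disjoint_left]
    intro S hS hS'
    rw [Finset.mem_image] at hS'
    obtain ⟨T, _, rfl⟩ := hS'
    exact hp ((Finset.mem_powersetCard.1 hS).1 (Finset.mem_insert_self _ _))

lemma esum_nonneg (m : ℕ) (g : ℕ → ℝ) (B : Finset ℕ) (hg : ∀ p ∈ B, 0 ≤ g p) : 0 ≤ esum m g B :=
  Finset.sum_nonneg fun _ hS => Finset.prod_nonneg fun _ hp =>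
    hg _ ((Finset.mem_powersetCard.1 hS).1 hp)

lemma yv_insert (b : ℕ) (g : ℕ → ℝ) (B : Finset ℕ) (p : ℕ) (hp : p ∉ B) :
    yv (b+1) g (insert p B) = yv (b+1) g B - g p * yv b g B := by
  unfold yv
  rw [Finset.sum_range_succ', Finset.sum_range_succ' (n := b+1), Finset.mul_sum]
  simp only [esum_zero, esum_insert _ _ _ _ hp]
  rw [add_sub_right_comm, ← Finset.sum_sub_distrib]
  congr 1
  apply Finset.sum_congr rfl
  intro i _
  ring

lemma yv_bound (g : ℕ → ℝ) (B : Finset ℕ) (hg : ∀ p ∈ B, 0 ≤ g p ∧ g p ≤ 1) :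
    ∀ b : ℕ, 0 ≤ (-1)^b * (yv b g B - ∏ p ∈ B, (1 - g p)) ∧
      (-1)^b * (yv b g B - ∏ p ∈ B, (1 - g p)) ≤ esum (b+1) g B := by
  induction B using Finset.induction_on with
  | empty =>
    intro b
    have : yv b g ∅ = 1 := by
      unfold yv
      rw [Finset.sum_range_succ']
      simp [esum_succ_empty, esum_zero]
    simp [this, esum_succ_empty]
  | insert p B hp ih =>
    have ih := ih (fun q hq => hg q (Finset.mem_insert_of_mem hq))
    have hgp := hg p (Finset.mem_insert_self _ _)
    have hP0 : 0 ≤ ∏ p ∈ B, (1 - g p) :=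
      Finset.prod_nonneg fun q hq => by linarith [(hg q (Finset.mem_insert_of_mem hq)).2]
    have hP1 : ∏ p ∈ B, (1 - g p) ≤ 1 :=
      Finset.prod_le_one (fun q hq => by linarith [(hg q (Finset.mem_insert_of_mem hq)).2])
        (fun q hq => by linarith [(hg q (Finset.mem_insert_of_mem hq)).1])
    intro b
    rw [Finset.prod_insert hp, esum_insert _ _ _ _ hp]
    set PP := ∏ p ∈ B, (1 - g p)
    cases b with
    | zero =>
      have h0 := ih 0
      have e : yv 0 g (insert p B) = yv 0 g B := by simp [yv, esum_zero]
      have e1 : yv 0 g B = 1 := by simp [yv, esum_zero]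
      rw [e, e1]
      rw [e1] at h0
      simp only [pow_zero, one_mul, esum_zero] at h0 ⊢
      constructor <;> nlinarith [h0.1, h0.2, hgp.1, hgp.2]
    | succ b =>
      rw [yv_insert _ _ _ _ hp]
      have h1 := ih (b+1)
      have h2 := ih b
      have e : (-1:ℝ)^(b+1) * (yv (b+1) g B - g p * yv b g B - (1 - g p) * PP)
        = (-1)^(b+1) * (yv (b+1) g B - PP) + g p * ((-1)^b * (yv b g B - PP)) := by
        rw [pow_succ]; ring
      rw [e]
      constructor
      · have := mul_nonneg hgp.1 h2.1
        linarith
      · have := mul_le_mul_of_nonneg_left h2.2 hgp.1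
        linarith

lemma esum_le (g : ℕ → ℝ) (B : Finset ℕ) (hg : ∀ p ∈ B, 0 ≤ g p) :
    ∀ m, esum m g B ≤ (∑ p ∈ B, g p)^m / m.factorial := by
  induction B using Finset.induction_on with
  | empty =>
    intro m
    cases m with
    | zero => simp [esum_zero]
    | succ m => simp [esum_succ_empty]
  | insert p B hp ih =>
    have ih := ih (fun q hq => hg q (Finset.mem_insert_of_mem hq))
    have hgp := hg p (Finset.mem_insert_self _ _)
    intro m
    cases m with
    | zero => simp [esum_zero]
    | succ m =>
      rw [esum_insert _ _ _ _ hp, Finset.sum_insert hp]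
      have hL : 0 ≤ ∑ p ∈ B, g p := Finset.sum_nonneg fun q hq => hg q (Finset.mem_insert_of_mem hq)
      set L := ∑ p ∈ B, g p
      have h1 := ih (m+1)
      have h2 := mul_le_mul_of_nonneg_left (ih m) hgp
      have hf : ((m+1).factorial : ℝ) = (m+1) * m.factorial := by
        rw [Nat.factorial_succ]; push_cast; ring
      have h3 : L^(m+1) + (m+1) * (g p * L^m) ≤ (g p + L)^(m+1) := by
        rw [add_comm (g p) L]
        have hh : ∀ n : ℕ, L^(n+1) + (n+1) * (g p * L^n) ≤ (L + g p)^(n+1) := by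
          intro n
          induction n with
          | zero => simp
          | succ n ihn =>
            have : (L + g p)^(n+1+1) = (L + g p)^(n+1) * (L + g p) := pow_succ _ _
            rw [this]
            have h5 := mul_le_mul_of_nonneg_right ihn (by linarith : 0 ≤ L + g p)
            have h6 : 0 ≤ ((n:ℝ)+1) * (g p * L^n) * g p := by positivity
            push_cast
            refine le_trans ?_ h5
            ring_nf
            ring_nf at h6
            nlinarith
        exact hh m
      calc esum (m+1) g B + g p * esum m g B ≤ L^(m+1)/(m+1).factorial + g p * (L^m/m.factorial) := by linarith
        _ = (L^(m+1) + (m+1) * (g p * L^m))/(m+1).factorial := by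
          rw [hf]; field_simp
        _ ≤ _ := by gcongr

lemma yv_eq_sum (b : ℕ) (g : ℕ → ℝ) (B : Finset ℕ) :
    yv b g B = ∑ S ∈ B.powerset, (if S.card ≤ b then (-1)^S.card else 0) * ∏ p ∈ S, g p := by
  unfold yv esum
  simp_rw [ite_mul, zero_mul]
  rw [← Finset.sum_filter]
  have : B.powerset.filter (fun S => S.card ≤ b) = (range (b+1)).biUnion (fun i => B.powersetCard i) := by
    ext S; simp [Finset.mem_powersetCard]; tauto
  rw [this, Finset.sum_biUnion]
  · apply Finset.sum_congr rfl
    intro i _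
    rw [Finset.mul_sum]
    apply Finset.sum_congr rfl
    intro S hS
    rw [(Finset.mem_powersetCard.1 hS).2]
  · intro i _ j _ hij
    exact Finset.pairwise_disjoint_powersetCard B hij

lemma esum_eq_sum (b : ℕ) (g : ℕ → ℝ) (B : Finset ℕ) :
    esum b g B = ∑ S ∈ B.powerset, (if S.card = b then 1 else 0) * ∏ p ∈ S, g p := by
  unfold esum
  simp_rw [ite_mul, zero_mul, one_mul]
  rw [← Finset.sum_filter, Finset.powersetCard_eq_filter]

lemma sum_powerset_union (U V : Finset ℕ) (h : Disjoint U V) (F G : Finset ℕ → ℝ) (f : Finset ℕ → ℝ)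
    (hf : ∀ S1, S1 ⊆ U → ∀ S2, S2 ⊆ V → f (S1 ∪ S2) = F S1 * G S2) :
    ∑ S ∈ (U ∪ V).powerset, f S = (∑ S ∈ U.powerset, F S) * ∑ S ∈ V.powerset, G S := by
  rw [Finset.sum_mul_sum, ← Finset.sum_product']
  symm
  apply Finset.sum_bij' (i := fun x _ => x.1 ∪ x.2) (j := fun S _ => (S ∩ U, S ∩ V))
  · intro x hx
    simp only [Finset.mem_product, Finset.mem_powerset] at hx ⊢
    exact Finset.union_subset_union hx.1 hx.2
  · intro S hS
    simp
  · rintro ⟨a, b⟩ hx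
    simp only [Finset.mem_product, Finset.mem_powerset] at hx
    rw [Finset.disjoint_left] at h
    ext p
    · simp; constructor
      · rintro ⟨h1 | h1, h2⟩
        · exact h1
        · exact absurd (hx.2 h1) (h h2)
      · intro h1; exact ⟨Or.inl h1, hx.1 h1⟩
    · simp; constructor
      · rintro ⟨h1 | h1, h2⟩
        · exact absurd h2 (h (hx.1 h1))
        · exact h1
      · intro h1; exact ⟨Or.inr h1, hx.2 h1⟩
  · intro S hS
    simp only [Finset.mem_powerset] at hS
    simp only
    rw [← Finset.inter_union_distrib_left]
    exact Finset.inter_eq_left.2 hS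
  · rintro ⟨a, b⟩ hx
    simp only [Finset.mem_product, Finset.mem_powerset] at hx
    exact (hf a hx.1 b hx.2).symm

/-- A pair of upper/lower sieve weights on subsets of a set of primes `P` -/
structure SieveOK (P : Finset ℕ) (L : ℕ) (lp lm : Finset ℕ → ℝ) : Prop where
  abs_p : ∀ S, |lp S| ≤ 1
  abs_m : ∀ S, |lm S| ≤ 1
  supp_p : ∀ S, lp S ≠ 0 → S ⊆ P ∧ ∏ p ∈ S, p ≤ L
  supp_m : ∀ S, lm S ≠ 0 → S ⊆ P ∧ ∏ p ∈ S, p ≤ L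
  upper : ∀ T, T ⊆ P → (if T = ∅ then (1:ℝ) else 0) ≤ ∑ S ∈ T.powerset, lp S
  lower : ∀ T, T ⊆ P → ∑ S ∈ T.powerset, lm S ≤ (if T = ∅ then (1:ℝ) else 0)

noncomputable def yw (b : ℕ) (S : Finset ℕ) : ℝ := if S.card ≤ b then (-1)^S.card else 0
noncomputable def ew (b : ℕ) (S : Finset ℕ) : ℝ := if S.card = b then 1 else 0

lemma block_eps (κ C0 : ℝ) (hκ : 0 ≤ κ) (b : ℕ)
    (hb : (κ*C0)^(b+1)/(b+1).factorial * Real.exp (2*(κ*C0)) ≤ (1/2)^b)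
    (B : Finset ℕ) (hB : ∑ p ∈ B, 1 / (p:ℝ) ≤ C0) (g : ℕ → ℝ)
    (hg : ∀ p ∈ B, 0 ≤ g p ∧ g p ≤ κ / p ∧ g p ≤ 1/2) :
    esum (b+1) g B ≤ (1/2)^b * ∏ p ∈ B, (1 - g p) := by
  have h1 := esum_le g B (fun p hp => (hg p hp).1) (b+1)
  have hs0 : 0 ≤ ∑ p ∈ B, g p := Finset.sum_nonneg fun p hp => (hg p hp).1
  have hs : ∑ p ∈ B, g p ≤ κ * C0 := by
    calc ∑ p ∈ B, g p ≤ ∑ p ∈ B, κ * (1/(p:ℝ)) :=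
          Finset.sum_le_sum fun p hp => by rw [mul_one_div]; exact (hg p hp).2.1
      _ = κ * ∑ p ∈ B, 1/(p:ℝ) := by rw [Finset.mul_sum]
      _ ≤ _ := mul_le_mul_of_nonneg_left hB hκ
  have hV : Real.exp (-(2 * (κ*C0))) ≤ ∏ p ∈ B, (1 - g p) := by
    calc Real.exp (-(2 * (κ*C0))) ≤ Real.exp (∑ p ∈ B, -(2 * g p)) := by
          apply Real.exp_le_exp.2
          rw [Finset.sum_neg_distrib, ← Finset.mul_sum]; linarith
      _ = ∏ p ∈ B, Real.exp (-(2 * g p)) := Real.exp_sum _ _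
      _ ≤ _ := by
        apply Finset.prod_le_prod (fun _ _ => (Real.exp_pos _).le)
        intro p hp
        have h := hg p hp
        have hpos : 0 < 1 + g p + g p^2 := by nlinarith [h.1]
        rw [Real.exp_neg]
        have e1 : 1 + 2 * g p + (2*g p)^2/2 ≤ Real.exp (2 * g p) := Real.quadratic_le_exp_of_nonneg (by linarith [h.1])
        have : (Real.exp (2 * g p))⁻¹ ≤ (1 + 2 * g p + (2*g p)^2/2)⁻¹ := by
          apply inv_anti₀ _ e1
          nlinarith [h.1]
        refine this.trans ?_
        rw [inv_le_iff_one_le_mul₀ (by nlinarith [h.1])]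
        nlinarith [h.1, h.2.2, mul_nonneg h.1 h.1, mul_nonneg (mul_nonneg h.1 h.1) (by linarith [h.2.2] : 0 ≤ 1/2 - g p)]
  have h2 : (∑ p ∈ B, g p)^(b+1) / (b+1).factorial ≤ (κ*C0)^(b+1)/(b+1).factorial := by gcongr
  have hexp : Real.exp (2*(κ*C0)) * Real.exp (-(2 * (κ*C0))) = 1 := by
    rw [← Real.exp_add]; simp
  calc esum (b+1) g B ≤ (κ*C0)^(b+1)/(b+1).factorial * (Real.exp (2*(κ*C0)) * Real.exp (-(2 * (κ*C0)))) := by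
        rw [hexp]; linarith
    _ = (κ*C0)^(b+1)/(b+1).factorial * Real.exp (2*(κ*C0)) * Real.exp (-(2 * (κ*C0))) := by ring
    _ ≤ (1/2)^b * ∏ p ∈ B, (1 - g p) := by
      apply mul_le_mul hb hV (Real.exp_pos _).le (by positivity)

lemma FL_aux (κ C0 : ℝ) (hκ : 0 ≤ κ)
    (hC : ∀ z : ℕ, ∑ p ∈ prs z \ prs (Nat.sqrt z), 1 / (p:ℝ) ≤ C0) (b0 : ℕ)
    (hb : ∀ b, b0 ≤ b → (κ*C0)^(b+1)/(b+1).factorial * Real.exp (2*(κ*C0)) ≤ (1/2)^b) :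
    ∀ z : ℕ, 1 ≤ z → ∀ b, b0 ≤ b → Even b → ∀ P : Finset ℕ, P ⊆ prs z →
      ∃ lp lm, SieveOK P (z^(2*b+6)) lp lm ∧ ∀ g : ℕ → ℝ,
        (∀ p ∈ P, 0 ≤ g p ∧ g p ≤ κ / p ∧ g p ≤ 1/2) →
        ∑ S ∈ P.powerset, lp S * ∏ p ∈ S, g p ≤ (1 + 4 * (1/2)^b) * ∏ p ∈ P, (1 - g p) ∧
        (1 - 4 * (1/2)^b) * ∏ p ∈ P, (1 - g p) ≤ ∑ S ∈ P.powerset, lm S * ∏ p ∈ S, g p := by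
  intro z
  induction z using Nat.strong_induction_on with
  | _ z ih =>
  intro hz1 b hbb heven P hP
  by_cases hz : z < 2
  · have hPe : P = ∅ := by
      rw [Finset.eq_empty_iff_forall_notMem]
      intro p hp
      have := mem_prs.1 (hP hp)
      have := this.2.two_le
      omega
    subst hPe
    refine ⟨fun S => if S = ∅ then 1 else 0, fun S => if S = ∅ then 1 else 0, ⟨?_, ?_, ?_, ?_, ?_, ?_⟩, ?_⟩
    · intro S; split_ifs <;> simp
    · intro S; split_ifs <;> simp
    · intro S hS
      have : S = ∅ := by by_contra h; simp [h] at hS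
      subst this; simp; exact Nat.one_le_pow _ _ (by omega)
    · intro S hS
      have : S = ∅ := by by_contra h; simp [h] at hS
      subst this; simp; exact Nat.one_le_pow _ _ (by omega)
    · intro T hT
      have : T = ∅ := Finset.subset_empty.1 hT
      subst this; simp
    · intro T hT
      have : T = ∅ := Finset.subset_empty.1 hT
      subst this; simp
    · intro g _; simp
  push Not at hz
  set w := Nat.sqrt z with hw
  have hwz : w < z := Nat.sqrt_lt_self (by omega)
  have hw1 : 1 ≤ w := Nat.sqrt_pos.2 (by omega)
  have hww : w * w ≤ z := Nat.sqrt_le z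
  set P0 := P.filter (fun p => p ≤ w) with hP0
  set B := P.filter (fun p => ¬ p ≤ w) with hBdef
  have hPu : P0 ∪ B = P := Finset.filter_union_filter_not_eq _ _
  have hdisj : Disjoint P0 B := Finset.disjoint_filter_filter_not _ _ _
  have hP0w : P0 ⊆ prs w := by
    intro p hp
    rw [hP0, Finset.mem_filter] at hp
    exact mem_prs.2 ⟨hp.2, (mem_prs.1 (hP hp.1)).2⟩
  have hBw : B ⊆ prs z \ prs w := by
    intro p hp
    rw [hBdef, Finset.mem_filter] at hp
    rw [Finset.mem_sdiff]
    exact ⟨hP hp.1, fun h => hp.2 (mem_prs.1 h).1⟩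
  have hBz : ∀ p ∈ B, p ≤ z := fun p hp => (mem_prs.1 (Finset.mem_sdiff.1 (hBw hp)).1).1
  have hBsum : ∑ p ∈ B, 1 / (p:ℝ) ≤ C0 :=
    (Finset.sum_le_sum_of_subset_of_nonneg hBw (fun _ _ _ => by positivity)).trans (hC z)
  obtain ⟨lp0, lm0, hok, hsum⟩ := ih w hwz hw1 (b+2) (by omega) (by simpa [Nat.even_add] using heven) P0 hP0w
  have hcap : ∀ S1 ⊆ P0, ∀ S2 ⊆ B, (S1 ∪ S2) ∩ P0 = S1 ∧ (S1 ∪ S2) ∩ B = S2 ∧ S1 ∪ S2 ⊆ P := by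
    intro S1 h1 S2 h2
    have hd := Finset.disjoint_left.1 hdisj
    refine ⟨?_, ?_, ?_⟩
    · ext p; simp only [Finset.mem_inter, Finset.mem_union]
      constructor
      · rintro ⟨h | h, h'⟩
        · exact h
        · exact absurd (h2 h) (hd h')
      · intro h; exact ⟨Or.inl h, h1 h⟩
    · ext p; simp only [Finset.mem_inter, Finset.mem_union]
      constructor
      · rintro ⟨h | h, h'⟩
        · exact absurd h' (hd (h1 h))
        · exact h
      · intro h; exact ⟨Or.inr h, h2 h⟩
    · rw [← hPu]; exact Finset.union_subset_union h1 h2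
  have hfac : ∀ (F G : Finset ℕ → ℝ) (g : ℕ → ℝ) (T : Finset ℕ), T ⊆ P →
      ∑ S ∈ T.powerset, (if S ⊆ P then F (S ∩ P0) * G (S ∩ B) else 0) * ∏ p ∈ S, g p
       = (∑ S ∈ (T ∩ P0).powerset, F S * ∏ p ∈ S, g p) * ∑ S ∈ (T ∩ B).powerset, G S * ∏ p ∈ S, g p := by
    intro F G g T hT
    have hTu : T = (T ∩ P0) ∪ (T ∩ B) := by
      rw [← Finset.inter_union_distrib_left, hPu, Finset.inter_eq_left.2 hT]
    conv_lhs => rw [hTu]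
    apply sum_powerset_union
    · exact hdisj.mono Finset.inter_subset_right Finset.inter_subset_right
    · intro S1 h1 S2 h2
      have h1' := h1.trans Finset.inter_subset_right
      have h2' := h2.trans Finset.inter_subset_right
      obtain ⟨a1, a2, a3⟩ := hcap S1 h1' S2 h2'
      rw [if_pos a3, a1, a2, Finset.prod_union (hdisj.mono h1' h2')]
      ring
  have hP0P : P ∩ P0 = P0 := Finset.inter_eq_right.2 (Finset.filter_subset _ _)
  have hPB : P ∩ B = B := Finset.inter_eq_right.2 (Finset.filter_subset _ _)
  have hyv : ∀ g U, ∑ S ∈ Finset.powerset U, yw b S * ∏ p ∈ S, g p = yv b g U := fun g U => by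
    rw [yv_eq_sum]; rfl
  have hev : ∀ g U, ∑ S ∈ Finset.powerset U, ew (b+1) S * ∏ p ∈ S, g p = esum (b+1) g U := fun g U => by
    rw [esum_eq_sum]; rfl
  have hprod01 : ∀ U : Finset ℕ, ∏ p ∈ U, (1 - (1:ℝ)) = if U = ∅ then 1 else 0 := by
    intro U
    split_ifs with h
    · simp [h]
    · simp [Finset.card_eq_zero, h]
  have heb : (-1:ℝ)^b = 1 := heven.neg_one_pow
  have hyb : ∀ S ⊆ B, yw b S ≠ 0 → ∏ p ∈ S, p ≤ z^(b+1) := by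
    intro S hS h
    have hc : S.card ≤ b := by by_contra hc; simp [yw, hc] at h
    calc ∏ p ∈ S, p ≤ z^S.card := Finset.prod_le_pow_card _ _ _ (fun p hp => hBz p (hS hp))
      _ ≤ _ := Nat.pow_le_pow_right (by omega) (by omega)
  have hebb : ∀ S ⊆ B, ew (b+1) S ≠ 0 → ∏ p ∈ S, p ≤ z^(b+1) := by
    intro S hS h
    have hc : S.card = b+1 := by by_contra hc; simp [ew, hc] at h
    calc ∏ p ∈ S, p ≤ z^S.card := Finset.prod_le_pow_card _ _ _ (fun p hp => hBz p (hS hp))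
      _ ≤ _ := Nat.pow_le_pow_right (by omega) (by omega)
  have hprodS : ∀ S, S ⊆ P → ∏ p ∈ S ∩ P0, p ≤ w^(2*(b+2)+6) → ∏ p ∈ S ∩ B, p ≤ z^(b+1) →
      ∏ p ∈ S, p ≤ z^(2*b+6) := by
    intro S hS h1 h2
    have hTu : S = (S ∩ P0) ∪ (S ∩ B) := by
      rw [← Finset.inter_union_distrib_left, hPu, Finset.inter_eq_left.2 hS]
    rw [hTu, Finset.prod_union (hdisj.mono Finset.inter_subset_right Finset.inter_subset_right)]
    calc _ ≤ w^(2*(b+2)+6) * z^(b+1) := Nat.mul_le_mul h1 h2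
      _ = (w*w)^(b+5) * z^(b+1) := by rw [← pow_two, ← pow_mul]; ring_nf
      _ ≤ z^(b+5) * z^(b+1) := Nat.mul_le_mul_right _ (Nat.pow_le_pow_left hww _)
      _ = _ := by rw [← pow_add]; ring_nf
  have hyabs : ∀ S, |yw b S| ≤ 1 := by
    intro S; unfold yw; split_ifs
    · simp [abs_pow]
    · simp
  have hlme : ∀ S, |lm0 (S ∩ P0) * yw b (S ∩ B) - lp0 (S ∩ P0) * ew (b+1) (S ∩ B)| ≤ 1 := by
    intro S
    by_cases hc : (S ∩ B).card = b + 1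
    · have : yw b (S ∩ B) = 0 := by simp [yw, hc]
      rw [this]
      simp [ew, hc, hok.abs_p]
    · have : ew (b+1) (S ∩ B) = 0 := by simp [ew, hc]
      rw [this, mul_zero, sub_zero, abs_mul]
      exact mul_le_one₀ (hok.abs_m _) (abs_nonneg _) (hyabs _)
  refine ⟨fun S => if S ⊆ P then lp0 (S ∩ P0) * yw b (S ∩ B) else 0,
    fun S => if S ⊆ P then lm0 (S ∩ P0) * yw b (S ∩ B) - lp0 (S ∩ P0) * ew (b+1) (S ∩ B) else 0,
    ⟨?_, ?_, ?_, ?_, ?_, ?_⟩, ?_⟩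
  · intro S; split_ifs
    · rw [abs_mul]
      exact mul_le_one₀ (hok.abs_p _) (abs_nonneg _) (hyabs _)
    · simp
  · intro S; split_ifs
    · exact hlme S
    · simp
  · intro S hS
    have h : S ⊆ P := by by_contra h; simp [h] at hS
    simp only [h, if_true] at hS
    exact ⟨h, hprodS S h (hok.supp_p _ (left_ne_zero_of_mul hS)).2
      (hyb _ Finset.inter_subset_right (right_ne_zero_of_mul hS))⟩
  · intro S hS
    have h : S ⊆ P := by by_contra h; simp [h] at hS
    simp only [h, if_true] at hS
    refine ⟨h, ?_⟩
    by_cases h0 : lm0 (S ∩ P0) * yw b (S ∩ B) = 0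
    · have h3 : lp0 (S ∩ P0) * ew (b+1) (S ∩ B) ≠ 0 := by
        intro h4; rw [h0, h4] at hS; simp at hS
      exact hprodS S h (hok.supp_p _ (left_ne_zero_of_mul h3)).2
        (hebb _ Finset.inter_subset_right (right_ne_zero_of_mul h3))
    · exact hprodS S h (hok.supp_m _ (left_ne_zero_of_mul h0)).2
        (hyb _ Finset.inter_subset_right (right_ne_zero_of_mul h0))
  · intro T hT
    have h := hfac lp0 (yw b) (fun _ => 1) T hT
    rw [hyv] at h
    simp only [Finset.prod_const_one, mul_one] at h
    rw [h]
    have h1 := hok.upper (T ∩ P0) Finset.inter_subset_right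
    have h2 := (yv_bound (fun _ => (1:ℝ)) (T ∩ B) (fun _ _ => by norm_num) b).1
    rw [heb, one_mul, hprod01] at h2
    have hT0 : T = ∅ → T ∩ P0 = ∅ ∧ T ∩ B = ∅ := fun h => by simp [h]
    by_cases hTe : T = ∅
    · rw [if_pos hTe]
      rw [if_pos (hT0 hTe).1] at h1
      rw [if_pos (hT0 hTe).2] at h2
      nlinarith
    · rw [if_neg hTe]
      apply mul_nonneg
      · refine le_trans ?_ h1; split_ifs <;> norm_num
      · have : (0:ℝ) ≤ if T ∩ B = ∅ then 1 else 0 := by split_ifs <;> norm_num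
        linarith
  · intro T hT
    have h := hfac lm0 (yw b) (fun _ => 1) T hT
    have h' := hfac lp0 (ew (b+1)) (fun _ => 1) T hT
    rw [hyv] at h
    rw [hev] at h'
    simp only [Finset.prod_const_one, mul_one] at h h'
    have hsplit : ∑ S ∈ T.powerset, (if S ⊆ P then lm0 (S ∩ P0) * yw b (S ∩ B) - lp0 (S ∩ P0) * ew (b+1) (S ∩ B) else 0)
      = ∑ S ∈ T.powerset, (if S ⊆ P then lm0 (S ∩ P0) * yw b (S ∩ B) else 0)
        - ∑ S ∈ T.powerset, (if S ⊆ P then lp0 (S ∩ P0) * ew (b+1) (S ∩ B) else 0) := by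
      rw [← Finset.sum_sub_distrib]
      apply Finset.sum_congr rfl
      intro S _
      split_ifs <;> simp
    rw [hsplit, h, h']
    have h1 := hok.upper (T ∩ P0) Finset.inter_subset_right
    have h1' := hok.lower (T ∩ P0) Finset.inter_subset_right
    have h2 := (yv_bound (fun _ => (1:ℝ)) (T ∩ B) (fun _ _ => by norm_num) b)
    have hE := esum_nonneg (b+1) (fun _ => (1:ℝ)) (T ∩ B) (fun _ _ => by norm_num)
    rw [heb, one_mul, hprod01] at h2
    have hT0 : (if T = ∅ then (1:ℝ) else 0) = (if T ∩ P0 = ∅ then (1:ℝ) else 0) * (if T ∩ B = ∅ then (1:ℝ) else 0) := by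
      by_cases hTe : T = ∅
      · simp [hTe]
      · rw [if_neg hTe]
        by_cases h3 : T ∩ P0 = ∅
        · have : T ∩ B ≠ ∅ := by
            intro h4
            apply hTe
            rw [← Finset.inter_eq_left.2 hT, ← hPu, Finset.inter_union_distrib_left, h3, h4]
            simp
          simp [this]
        · simp [h3]
    rw [hT0]
    have ha0 : (0:ℝ) ≤ if T ∩ P0 = ∅ then 1 else 0 := by split_ifs <;> norm_num
    have hu0 : (0:ℝ) ≤ if T ∩ B = ∅ then 1 else 0 := by split_ifs <;> norm_num
    generalize (if T ∩ P0 = ∅ then (1:ℝ) else 0) = a at *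
    generalize (if T ∩ B = ∅ then (1:ℝ) else 0) = u at *
    have e1 := mul_le_mul_of_nonneg_right h1' (by linarith [h2.1] : 0 ≤ yv b (fun _ => 1) (T ∩ B))
    have e2 := mul_le_mul_of_nonneg_right h1 hE
    have e3 := mul_le_mul_of_nonneg_left h2.2 ha0
    linarith
  · intro g hg
    have hg0 : ∀ p ∈ P0, 0 ≤ g p ∧ g p ≤ κ / p ∧ g p ≤ 1/2 := fun p hp => hg p (Finset.filter_subset _ _ hp)
    have hgB : ∀ p ∈ B, 0 ≤ g p ∧ g p ≤ κ / p ∧ g p ≤ 1/2 := fun p hp => hg p (Finset.filter_subset _ _ hp)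
    obtain ⟨hs1, hs2⟩ := hsum g hg0
    have h := hfac lm0 (yw b) g P (subset_refl _)
    have h' := hfac lp0 (ew (b+1)) g P (subset_refl _)
    have h'' := hfac lp0 (yw b) g P (subset_refl _)
    rw [hP0P, hPB, hyv] at h h''
    rw [hP0P, hPB, hev] at h'
    have hsplit : ∑ S ∈ P.powerset, (if S ⊆ P then lm0 (S ∩ P0) * yw b (S ∩ B) - lp0 (S ∩ P0) * ew (b+1) (S ∩ B) else 0) * ∏ p ∈ S, g p
      = ∑ S ∈ P.powerset, (if S ⊆ P then lm0 (S ∩ P0) * yw b (S ∩ B) else 0) * ∏ p ∈ S, g p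
        - ∑ S ∈ P.powerset, (if S ⊆ P then lp0 (S ∩ P0) * ew (b+1) (S ∩ B) else 0) * ∏ p ∈ S, g p := by
      rw [← Finset.sum_sub_distrib]
      apply Finset.sum_congr rfl
      intro S _
      split_ifs <;> ring
    rw [hsplit, h, h', h'']
    have heps := block_eps κ C0 hκ b (hb b hbb) B hBsum g hgB
    have hyB := (yv_bound g B (fun p hp => ⟨(hgB p hp).1, by linarith [(hgB p hp).2.2]⟩) b)
    have hE := esum_nonneg (b+1) g B (fun p hp => (hgB p hp).1)
    rw [heb, one_mul] at hyB
    have hVP : ∏ p ∈ P, (1 - g p) = (∏ p ∈ P0, (1 - g p)) * ∏ p ∈ B, (1 - g p) := by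
      rw [← hPu, Finset.prod_union hdisj]
    rw [hVP]
    have hV0 : 0 ≤ ∏ p ∈ P0, (1 - g p) := Finset.prod_nonneg fun p hp => by linarith [(hg0 p hp).2.2]
    have hVB : 0 ≤ ∏ p ∈ B, (1 - g p) := Finset.prod_nonneg fun p hp => by linarith [(hgB p hp).2.2]
    have hx0 : (0:ℝ) ≤ (1/2)^b := by positivity
    have hx1 : ((1:ℝ)/2)^b ≤ 1 := pow_le_one₀ (by norm_num) (by norm_num)
    have hxx : 4 * ((1:ℝ)/2)^(b+2) = (1/2)^b := by rw [pow_add]; ring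
    rw [hxx] at hs1 hs2
    generalize ((1:ℝ)/2)^b = x at *
    generalize ∏ p ∈ P0, (1 - g p) = V0 at *
    generalize ∏ p ∈ B, (1 - g p) = VB at *
    generalize yv b g B = Y at *
    generalize esum (b+1) g B = E at *
    generalize ∑ S ∈ P0.powerset, lp0 S * ∏ p ∈ S, g p = Ap at *
    generalize ∑ S ∈ P0.powerset, lm0 S * ∏ p ∈ S, g p = Am at *
    have hVV : 0 ≤ V0 * VB := mul_nonneg hV0 hVB
    have hxV : 0 ≤ x * (V0 * VB) := mul_nonneg hx0 hVV
    have hxxV : 0 ≤ x * (1 - x) * (V0 * VB) := mul_nonneg (mul_nonneg hx0 (by linarith)) hVV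
    constructor
    · calc Ap * Y ≤ ((1 + x) * V0) * Y := mul_le_mul_of_nonneg_right hs1 (by linarith [hyB.1])
        _ ≤ ((1 + x) * V0) * (VB + x * VB) := mul_le_mul_of_nonneg_left (by linarith [hyB.2]) (by positivity)
        _ ≤ _ := by nlinarith
    · have e1 := mul_le_mul_of_nonneg_right hs2 (by linarith [hyB.1] : 0 ≤ Y)
      have e2 : ((1 - x) * V0) * VB ≤ ((1 - x) * V0) * Y :=
        mul_le_mul_of_nonneg_left (by linarith [hyB.1]) (mul_nonneg (by linarith) hV0)
      have e3 := mul_le_mul_of_nonneg_right hs1 hE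
      have e4 : ((1 + x) * V0) * E ≤ ((1 + x) * V0) * (x * VB) :=
        mul_le_mul_of_nonneg_left heps (by positivity)
      nlinarith

/-- Fundamental lemma (Brun-Hooley) -/
lemma FL (hEH : HasLevelOfDistribution 1) (κ : ℝ) (hκ : 0 ≤ κ) :
    ∃ s : ℕ, ∀ z : ℕ, 1 ≤ z → ∀ P : Finset ℕ, P ⊆ prs z →
      ∃ lp lm, SieveOK P (z^s) lp lm ∧ ∀ g : ℕ → ℝ,
        (∀ p ∈ P, 0 ≤ g p ∧ g p ≤ κ / p ∧ g p ≤ 1/2) →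
        ∑ S ∈ P.powerset, lp S * ∏ p ∈ S, g p ≤ 2 * ∏ p ∈ P, (1 - g p) ∧
        (1/2) * ∏ p ∈ P, (1 - g p) ≤ ∑ S ∈ P.powerset, lm S * ∏ p ∈ S, g p := by
  obtain ⟨C0, hC0, hC⟩ := mertens_block hEH
  have hlim := FloorSemiring.tendsto_pow_div_factorial_atTop (2 * (κ * C0))
  have hlim2 := (hlim.comp (Filter.tendsto_add_atTop_nat 1)).eventually
    (gt_mem_nhds (show (0:ℝ) < 2 * (Real.exp (2*(κ*C0)))⁻¹ by positivity))
  obtain ⟨b0, hb0⟩ := Filter.eventually_atTop.1 hlim2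
  have hb : ∀ b, b0 ≤ b → (κ*C0)^(b+1)/(b+1).factorial * Real.exp (2*(κ*C0)) ≤ (1/2)^b := by
    intro b h
    have h1 := hb0 b h
    simp only [Function.comp] at h1
    have he := Real.exp_pos (2*(κ*C0))
    rw [← div_eq_mul_inv, lt_div_iff₀ he, mul_pow] at h1
    have h2 : (0:ℝ) < 2^(b+1) := by positivity
    have : (κ*C0)^(b+1)/(b+1).factorial * Real.exp (2*(κ*C0)) * 2^(b+1) < 2 := by
      calc _ = 2 ^ (b + 1) * (κ * C0) ^ (b + 1) / ((b + 1).factorial) * Real.exp (2 * (κ * C0)) := by ring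
        _ < 2 := h1
    rw [one_div, inv_pow, ← one_div, le_div_iff₀ (by positivity)]
    rw [pow_succ (2:ℝ)] at this
    nlinarith
  refine ⟨2*(2*(b0+2))+6, fun z hz P hP => ?_⟩
  obtain ⟨lp, lm, hok, hs⟩ := FL_aux κ C0 hκ hC b0 hb z hz (2*(b0+2)) (by omega) (by simp) P hP
  refine ⟨lp, lm, hok, fun g hg => ?_⟩
  obtain ⟨h1, h2⟩ := hs g hg
  have hV : 0 ≤ ∏ p ∈ P, (1 - g p) := Finset.prod_nonneg fun p hp => by linarith [(hg p hp).2.2]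
  have hx : 4 * ((1:ℝ)/2)^(2*(b0+2)) ≤ 1/2 := by
    have : ((1:ℝ)/2)^(2*(b0+2)) ≤ (1/2)^4 := pow_le_pow_of_le_one (by norm_num) (by norm_num) (by omega)
    norm_num at this ⊢; linarith
  constructor
  · refine h1.trans (mul_le_mul_of_nonneg_right (by linarith) hV)
  · refine le_trans (mul_le_mul_of_nonneg_right (by linarith) hV) h2

/-- Maynard-type weights -/
noncomputable def lamb {k : ℕ} (Q : Finset ℕ) (Y : (Fin k → ℕ) → ℝ) (d : Fin k → ℕ) : ℝ :=
  (∏ i, ((ArithmeticFunction.moebius (d i) : ℤ) : ℝ) * (d i : ℝ)) *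
    ∑ t ∈ Fintype.piFinset (fun _ : Fin k => Q), if ∀ i, d i ∣ t i then Y t else 0

noncomputable def cc (Q : Finset ℕ) (r t : ℕ) : ℝ :=
  ∑ d ∈ Q, if r ∣ d ∧ d ∣ t then ((ArithmeticFunction.moebius d : ℤ) : ℝ) else 0

lemma prod_ite_all {k : ℕ} (p : Fin k → Prop) [∀ i, Decidable (p i)] [Decidable (∀ i, p i)] (f : Fin k → ℝ) :
    (∏ i, if p i then f i else 0) = if ∀ i, p i then ∏ i, f i else 0 := by
  by_cases h : ∀ i, p i
  · rw [if_pos h]; exact Finset.prod_congr rfl fun i _ => if_pos (h i)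
  · rw [if_neg h]
    push Not at h
    obtain ⟨i, hi⟩ := h
    exact Finset.prod_eq_zero (Finset.mem_univ i) (if_neg hi)

lemma diag1 {k : ℕ} (Q : Fin k → Finset ℕ) (hdc : ∀ i, ∀ d ∈ Q i, ∀ r, r ∣ d → r ∈ Q i)
    (hpos : ∀ i, ∀ d ∈ Q i, 0 < d) (lam : (Fin k → ℕ) → ℝ) :
    ∑ d ∈ Fintype.piFinset Q, ∑ e ∈ Fintype.piFinset Q,
      lam d * lam e / ∏ i, (Nat.lcm (d i) (e i) : ℝ)
    = ∑ r ∈ Fintype.piFinset Q, (∏ i, (Nat.totient (r i) : ℝ)) *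
      (∑ d ∈ Fintype.piFinset Q, if ∀ i, r i ∣ d i then lam d / ∏ i, (d i : ℝ) else 0)^2 := by
  have key : ∀ d ∈ Fintype.piFinset Q, ∀ e ∈ Fintype.piFinset Q,
      lam d * lam e / ∏ i, (Nat.lcm (d i) (e i) : ℝ) =
      ∑ r ∈ Fintype.piFinset Q, (∏ i, (Nat.totient (r i) : ℝ)) *
        ((if ∀ i, r i ∣ d i then lam d / ∏ i, (d i : ℝ) else 0) *
         (if ∀ i, r i ∣ e i then lam e / ∏ i, (e i : ℝ) else 0)) := by
    intro d hd e he
    rw [Fintype.mem_piFinset] at hd he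
    have h1 : ∀ i, ((Nat.gcd (d i) (e i) : ℕ) : ℝ) =
        ∑ r ∈ Q i, if r ∣ d i ∧ r ∣ e i then (Nat.totient r : ℝ) else 0 := by
      intro i
      rw [← Nat.sum_totient (Nat.gcd (d i) (e i)), ← Finset.sum_filter]
      push_cast
      apply Finset.sum_congr _ (fun _ _ => rfl)
      ext r
      have hg : Nat.gcd (d i) (e i) ≠ 0 := (Nat.gcd_pos_of_pos_left _ (hpos i _ (hd i))).ne'
      simp only [Nat.mem_divisors, Finset.mem_filter, Nat.dvd_gcd_iff]
      constructor
      · rintro ⟨h, _⟩; exact ⟨hdc i _ (hd i) _ h.1, h⟩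
      · rintro ⟨_, h⟩; exact ⟨h, hg⟩
    have h2 : ∀ i, 1 / (Nat.lcm (d i) (e i) : ℝ) = (Nat.gcd (d i) (e i) : ℝ) / ((d i : ℝ) * e i) := by
      intro i
      have hd0 : (d i : ℝ) ≠ 0 := by exact_mod_cast (hpos i _ (hd i)).ne'
      have he0 : (e i : ℝ) ≠ 0 := by exact_mod_cast (hpos i _ (he i)).ne'
      have hl0 : (Nat.lcm (d i) (e i) : ℝ) ≠ 0 := by
        exact_mod_cast (Nat.lcm_pos (hpos i _ (hd i)) (hpos i _ (he i))).ne'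
      have := Nat.gcd_mul_lcm (d i) (e i)
      have h3 : (Nat.gcd (d i) (e i) : ℝ) * (Nat.lcm (d i) (e i) : ℝ) = d i * e i := by exact_mod_cast this
      rw [div_eq_div_iff hl0 (mul_ne_zero hd0 he0)]
      linarith
    have h3 : (∏ i, ((Nat.gcd (d i) (e i) : ℕ) : ℝ)) =
        ∑ r ∈ Fintype.piFinset Q, if ∀ i, r i ∣ d i ∧ r i ∣ e i then ∏ i, (Nat.totient (r i) : ℝ) else 0 := by
      rw [Finset.prod_congr rfl (fun i _ => h1 i), Finset.prod_univ_sum]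
      apply Finset.sum_congr rfl
      intro r _
      rw [prod_ite_all]
    rw [div_eq_mul_one_div, one_div, ← Finset.prod_inv_distrib]
    rw [Finset.prod_congr rfl (fun i _ => by rw [← one_div, h2 i]), Finset.prod_div_distrib, h3,
      Finset.prod_mul_distrib, Finset.sum_div, Finset.mul_sum]
    apply Finset.sum_congr rfl
    intro r _
    by_cases ha : ∀ i, r i ∣ d i
    · by_cases hb : ∀ i, r i ∣ e i
      · rw [if_pos ha, if_pos hb, if_pos (fun i => ⟨ha i, hb i⟩)]
        ring
      · rw [if_neg hb, if_neg (fun h => hb fun i => (h i).2)]; simp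
    · rw [if_neg ha, if_neg (fun h => ha fun i => (h i).1)]; simp
  rw [Finset.sum_congr rfl fun d hd => Finset.sum_congr rfl fun e he => key d hd e he]
  rw [Finset.sum_congr rfl fun d _ => Finset.sum_comm, Finset.sum_comm]
  apply Finset.sum_congr rfl
  intro r _
  rw [pow_two, Finset.sum_mul_sum, Finset.mul_sum]
  apply Finset.sum_congr rfl
  intro d _
  rw [Finset.mul_sum]

lemma diag2 {k : ℕ} (Q : Finset ℕ) (Q' : Fin k → Finset ℕ)
    (hpos : ∀ i, ∀ d ∈ Q' i, 0 < d) (Y : (Fin k → ℕ) → ℝ) (r : Fin k → ℕ) :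
    (∑ d ∈ Fintype.piFinset Q', if ∀ i, r i ∣ d i then lamb Q Y d / ∏ i, (d i : ℝ) else 0) =
    ∑ t ∈ Fintype.piFinset (fun _ : Fin k => Q), Y t * ∏ i, cc (Q' i) (r i) (t i) := by
  have h1 : ∀ d ∈ Fintype.piFinset Q', (if ∀ i, r i ∣ d i then lamb Q Y d / ∏ i, (d i : ℝ) else 0) =
      ∑ t ∈ Fintype.piFinset (fun _ : Fin k => Q), Y t *
        ∏ i, (if r i ∣ d i ∧ d i ∣ t i then ((ArithmeticFunction.moebius (d i) : ℤ) : ℝ) else 0) := by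
    intro d hd
    rw [Fintype.mem_piFinset] at hd
    have hd0 : ∏ i, (d i : ℝ) ≠ 0 := Finset.prod_ne_zero_iff.2 fun i _ => by
      exact_mod_cast (hpos i _ (hd i)).ne'
    have h2 : lamb Q Y d / ∏ i, (d i : ℝ) =
      ∑ t ∈ Fintype.piFinset (fun _ : Fin k => Q), if ∀ i, d i ∣ t i then Y t * (∏ i, ((ArithmeticFunction.moebius (d i) : ℤ) : ℝ)) else 0 := by
      unfold lamb
      rw [Finset.prod_mul_distrib, mul_assoc, mul_comm (∏ i, (d i : ℝ)), ← mul_assoc, mul_div_assoc, div_self hd0, mul_one,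
        Finset.mul_sum]
      apply Finset.sum_congr rfl
      intro t _
      split_ifs <;> ring
    split_ifs with h
    · rw [h2]
      apply Finset.sum_congr rfl
      intro t _
      rw [prod_ite_all]
      by_cases h3 : ∀ i, d i ∣ t i
      · rw [if_pos h3, if_pos (fun i => ⟨h i, h3 i⟩)]
      · rw [if_neg h3, if_neg (fun h' => h3 fun i => (h' i).2)]; simp
    · symm
      apply Finset.sum_eq_zero
      intro t _
      rw [prod_ite_all, if_neg (fun h' => h fun i => (h' i).1)]; simp
  rw [Finset.sum_congr rfl h1, Finset.sum_comm]
  apply Finset.sum_congr rfl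
  intro t _
  unfold cc
  rw [Finset.prod_univ_sum, Finset.mul_sum]

lemma cc_one (t : ℕ) : cc {1} 1 t = 1 := by simp [cc]

lemma cc_full (Q : Finset ℕ) (hdc : ∀ d ∈ Q, ∀ r, r ∣ d → r ∈ Q) (hsq : ∀ d ∈ Q, Squarefree d)
    (r t : ℕ) (ht : t ∈ Q) :
    cc Q r t = if t = r then ((ArithmeticFunction.moebius r : ℤ) : ℝ) else 0 := by
  have ht0 : t ≠ 0 := (hsq t ht).ne_zero
  by_cases hrt : r ∣ t
  · obtain ⟨s, rfl⟩ := hrt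
    have hr0 : r ≠ 0 := left_ne_zero_of_mul ht0
    have hs0 : s ≠ 0 := right_ne_zero_of_mul ht0
    have hcop : Nat.Coprime r s := Nat.coprime_of_squarefree_mul (hsq _ ht)
    have h1 : cc Q r (r*s) = ∑ e ∈ s.divisors, ((ArithmeticFunction.moebius (r*e) : ℤ) : ℝ) := by
      unfold cc
      rw [← Finset.sum_filter]
      symm
      apply Finset.sum_bij (fun e _ => r * e)
      · intro e he
        rw [Nat.mem_divisors] at he
        rw [Finset.mem_filter]
        have : r * e ∣ r * s := Nat.mul_dvd_mul_left r he.1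
        exact ⟨hdc _ ht _ this, Dvd.intro _ rfl, this⟩
      · intro a _ b _ h
        exact Nat.eq_of_mul_eq_mul_left (Nat.pos_of_ne_zero hr0) h
      · intro d hd
        rw [Finset.mem_filter] at hd
        obtain ⟨hd1, ⟨e, rfl⟩, hd3⟩ := hd
        exact ⟨e, Nat.mem_divisors.2 ⟨Nat.dvd_of_mul_dvd_mul_left (Nat.pos_of_ne_zero hr0) hd3, hs0⟩, rfl⟩
      · intro _ _; rfl
    have h2 : ∑ e ∈ s.divisors, ((ArithmeticFunction.moebius (r*e) : ℤ) : ℝ)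
        = (ArithmeticFunction.moebius r : ℤ) * ∑ e ∈ s.divisors, ((ArithmeticFunction.moebius e : ℤ) : ℝ) := by
      rw [Finset.mul_sum]
      apply Finset.sum_congr rfl
      intro e he
      have : Nat.Coprime r e := hcop.coprime_dvd_right (Nat.dvd_of_mem_divisors he)
      rw [ArithmeticFunction.isMultiplicative_moebius.map_mul_of_coprime this]
      push_cast; ring
    have h3 : ∑ e ∈ s.divisors, ((ArithmeticFunction.moebius e : ℤ) : ℝ) = if s = 1 then 1 else 0 := by
      have := ArithmeticFunction.sum_moebius_mul_log_eq (n := s)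
      have h4 : ∑ e ∈ s.divisors, ArithmeticFunction.moebius e = if s = 1 then 1 else 0 := by
        rw [← ArithmeticFunction.coe_mul_zeta_apply, ArithmeticFunction.moebius_mul_coe_zeta, ArithmeticFunction.one_apply]
      have h5 := congrArg (fun x : ℤ => (x : ℝ)) h4
      push_cast at h5
      exact h5
    rw [h1, h2, h3]
    by_cases hs1 : s = 1
    · simp [hs1]
    · have : ¬ (r * s = r) := by
        intro h; exact hs1 (Nat.eq_of_mul_eq_mul_left (Nat.pos_of_ne_zero hr0) (by simpa using h))
      simp [hs1, this]
  · have h1 : ¬ t = r := fun h => hrt (h ▸ dvd_rfl)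
    rw [if_neg h1]
    unfold cc
    apply Finset.sum_eq_zero
    intro d _
    rw [if_neg]
    rintro ⟨h2, h3⟩
    exact hrt (h2.trans h3)

lemma diagS1 {k : ℕ} (Q : Finset ℕ) (hdc : ∀ d ∈ Q, ∀ r, r ∣ d → r ∈ Q) (hsq : ∀ d ∈ Q, Squarefree d)
    (Y : (Fin k → ℕ) → ℝ) :
    ∑ d ∈ Fintype.piFinset (fun _ : Fin k => Q), ∑ e ∈ Fintype.piFinset (fun _ : Fin k => Q),
      lamb Q Y d * lamb Q Y e / ∏ i, (Nat.lcm (d i) (e i) : ℝ)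
    = ∑ r ∈ Fintype.piFinset (fun _ : Fin k => Q), (∏ i, (Nat.totient (r i) : ℝ)) * (Y r)^2 := by
  have hpos : ∀ d ∈ Q, 0 < d := fun d hd => Nat.pos_of_ne_zero (hsq d hd).ne_zero
  rw [diag1 (fun _ => Q) (fun _ => hdc) (fun _ => hpos)]
  apply Finset.sum_congr rfl
  intro r hr
  congr 1
  rw [diag2 Q (fun _ => Q) (fun _ => hpos)]
  have hr' := Fintype.mem_piFinset.1 hr
  have h1 : ∀ t ∈ Fintype.piFinset (fun _ : Fin k => Q), Y t * ∏ i, cc Q (r i) (t i) =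
      if t = r then Y r * ∏ i, ((ArithmeticFunction.moebius (r i) : ℤ) : ℝ) else 0 := by
    intro t ht
    rw [Fintype.mem_piFinset] at ht
    rw [Finset.prod_congr rfl fun i _ => cc_full Q hdc hsq (r i) (t i) (ht i), prod_ite_all]
    by_cases h : t = r
    · subst h; simp
    · rw [if_neg h, if_neg (fun h' => h (funext h'))]; simp
  rw [Finset.sum_congr rfl h1, Finset.sum_ite_eq' , if_pos hr, mul_pow, ← Finset.prod_pow]
  have : ∀ i, (((ArithmeticFunction.moebius (r i) : ℤ) : ℝ))^2 = 1 := by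
    intro i
    have := ArithmeticFunction.moebius_sq_eq_one_of_squarefree (hsq _ (hr' i))
    exact_mod_cast this
  simp [this]

/-- coordinate sets with the `m`-th one trivial -/
def Qm {k : ℕ} (Q : Finset ℕ) (m : Fin k) (i : Fin k) : Finset ℕ := if i = m then {1} else Q

lemma diagS2 {k : ℕ} (Q : Finset ℕ) (hdc : ∀ d ∈ Q, ∀ r, r ∣ d → r ∈ Q) (hsq : ∀ d ∈ Q, Squarefree d)
    (Y : (Fin k → ℕ) → ℝ) (m : Fin k) :
    ∑ d ∈ Fintype.piFinset (Qm Q m), ∑ e ∈ Fintype.piFinset (Qm Q m),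
      lamb Q Y d * lamb Q Y e / ∏ i, (Nat.lcm (d i) (e i) : ℝ)
    = ∑ r ∈ Fintype.piFinset (Qm Q m), (∏ i, (Nat.totient (r i) : ℝ)) *
        (∑ s ∈ Q, Y (Function.update r m s))^2 := by
  have hpos : ∀ d ∈ Q, 0 < d := fun d hd => Nat.pos_of_ne_zero (hsq d hd).ne_zero
  have hpos' : ∀ i, ∀ d ∈ Qm Q m i, 0 < d := by
    intro i d hd
    unfold Qm at hd
    split_ifs at hd
    · simp at hd; omega
    · exact hpos d hd
  have hdc' : ∀ i, ∀ d ∈ Qm Q m i, ∀ r, r ∣ d → r ∈ Qm Q m i := by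
    intro i d hd r hr
    unfold Qm at hd ⊢
    split_ifs at hd ⊢
    · simp at hd ⊢; subst hd; exact Nat.dvd_one.1 hr
    · exact hdc d hd r hr
  rw [diag1 (Qm Q m) hdc' hpos']
  apply Finset.sum_congr rfl
  intro r hr
  congr 1
  rw [diag2 Q (Qm Q m) hpos']
  have hr' := Fintype.mem_piFinset.1 hr
  have hrm : r m = 1 := by have := hr' m; simpa [Qm] using this
  have hri : ∀ i, i ≠ m → r i ∈ Q := fun i hi => by have := hr' i; simpa [Qm, hi] using this
  set ε : ℝ := ∏ i, ((ArithmeticFunction.moebius (r i) : ℤ) : ℝ) with hε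
  have h1 : ∀ t ∈ Fintype.piFinset (fun _ : Fin k => Q), Y t * ∏ i, cc (Qm Q m i) (r i) (t i) =
      if t = Function.update r m (t m) then Y t * ε else 0 := by
    intro t ht
    rw [Fintype.mem_piFinset] at ht
    have h2 : ∀ i, cc (Qm Q m i) (r i) (t i) =
        if t i = Function.update r m (t m) i then ((ArithmeticFunction.moebius (r i) : ℤ) : ℝ) else 0 := by
      intro i
      by_cases hi : i = m
      · subst hi; simp [Qm, hrm, cc_one]
      · simp only [Qm, hi, if_false, Function.update_of_ne, ne_eq, not_false_eq_true]
        exact cc_full Q hdc hsq (r i) (t i) (ht i)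
    rw [Finset.prod_congr rfl fun i _ => h2 i, prod_ite_all]
    by_cases h : t = Function.update r m (t m)
    · rw [if_pos h, if_pos (fun i => congrFun h i)]
    · rw [if_neg h, if_neg (fun h' => h (funext h'))]; simp
  rw [Finset.sum_congr rfl h1, ← Finset.sum_filter]
  have h3 : ∑ t ∈ (Fintype.piFinset (fun _ : Fin k => Q)).filter (fun t => t = Function.update r m (t m)), Y t * ε
      = ∑ s ∈ Q, Y (Function.update r m s) * ε := by
    symm
    apply Finset.sum_bij (fun s _ => Function.update r m s)
    · intro s hs
      rw [Finset.mem_filter, Fintype.mem_piFinset]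
      refine ⟨fun i => ?_, by simp⟩
      by_cases hi : i = m
      · subst hi; simpa using hs
      · simpa [hi] using hri i hi
    · intro a _ b _ h
      have := congrFun h m
      simpa using this
    · intro t ht
      rw [Finset.mem_filter, Fintype.mem_piFinset] at ht
      exact ⟨t m, ht.1 m, ht.2.symm⟩
    · intro _ _; rfl
  rw [h3, ← Finset.sum_mul, mul_pow]
  have : ∀ i, (((ArithmeticFunction.moebius (r i) : ℤ) : ℝ))^2 = 1 := by
    intro i
    have hs : Squarefree (r i) := by
      by_cases hi : i = m
      · subst hi; rw [hrm]; exact squarefree_one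
      · exact hsq _ (hri i hi)
    have := ArithmeticFunction.moebius_sq_eq_one_of_squarefree hs
    exact_mod_cast this
  rw [hε, ← Finset.prod_pow]
  simp [this]

noncomputable def Yw {k : ℕ} (R : ℕ) (g : ℕ → ℝ) (t : Fin k → ℕ) : ℝ :=
  if ∏ i, t i ≤ R then ∏ i, g (t i) / (Nat.totient (t i) : ℝ) else 0

lemma S1_bound {k : ℕ} (Q : Finset ℕ) (hdc : ∀ d ∈ Q, ∀ r, r ∣ d → r ∈ Q) (hsq : ∀ d ∈ Q, Squarefree d)
    (R : ℕ) (g : ℕ → ℝ) :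
    ∑ d ∈ Fintype.piFinset (fun _ : Fin k => Q), ∑ e ∈ Fintype.piFinset (fun _ : Fin k => Q),
      lamb Q (Yw R g) d * lamb Q (Yw R g) e / ∏ i, (Nat.lcm (d i) (e i) : ℝ)
    ≤ (∑ r ∈ Q, g r ^ 2 / (Nat.totient r : ℝ))^k := by
  rw [diagS1 Q hdc hsq]
  have h2 : (∑ r ∈ Q, g r ^ 2 / (Nat.totient r : ℝ))^k = ∏ i : Fin k, ∑ r ∈ Q, g r ^ 2 / (Nat.totient r : ℝ) := by
    simp
  rw [h2, Finset.prod_univ_sum]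
  apply Finset.sum_le_sum
  intro r hr
  rw [Fintype.mem_piFinset] at hr
  have hφ : ∀ i, (0:ℝ) < Nat.totient (r i) := fun i => by
    exact_mod_cast Nat.totient_pos.2 (Nat.pos_of_ne_zero (hsq _ (hr i)).ne_zero)
  unfold Yw
  split_ifs
  · rw [← Finset.prod_pow, ← Finset.prod_mul_distrib]
    apply le_of_eq
    apply Finset.prod_congr rfl
    intro i _
    have := (hφ i).ne'
    field_simp
  · rw [zero_pow two_ne_zero, mul_zero]
    apply Finset.prod_nonneg
    intro i _
    have := hφ i
    positivity

lemma S2_bound {k : ℕ} (Q : Finset ℕ) (hdc : ∀ d ∈ Q, ∀ r, r ∣ d → r ∈ Q) (hsq : ∀ d ∈ Q, Squarefree d)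
    (R R0 X : ℕ) (hR : R0 * X ≤ R) (g : ℕ → ℝ) (hg0 : ∀ r, 0 ≤ g r) (hgX : ∀ r, g r ≠ 0 → r ≤ X)
    (c : ℝ) (hR0 : 2 ≤ R0) (hc : (k:ℝ) * c ≤ Real.log R0 / 2)
    (hG3 : ∑ r ∈ Q, g r ^ 2 / (Nat.totient r : ℝ) * Real.log r ≤ c * ∑ r ∈ Q, g r ^ 2 / (Nat.totient r : ℝ))
    (hc0 : 0 ≤ c) (m : Fin k) :
    (1/2) * (∑ r ∈ Q, g r / (Nat.totient r : ℝ))^2 * (∑ r ∈ Q, g r ^ 2 / (Nat.totient r : ℝ))^(k-1) ≤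
    ∑ d ∈ Fintype.piFinset (Qm Q m), ∑ e ∈ Fintype.piFinset (Qm Q m),
      lamb Q (Yw R g) d * lamb Q (Yw R g) e / ∏ i, (Nat.lcm (d i) (e i) : ℝ) := by
  rw [diagS2 Q hdc hsq]
  set G1 := ∑ r ∈ Q, g r / (Nat.totient r : ℝ) with hG1
  set G2 := ∑ r ∈ Q, g r ^ 2 / (Nat.totient r : ℝ) with hG2
  have hpos : ∀ d ∈ Q, 0 < d := fun d hd => Nat.pos_of_ne_zero (hsq d hd).ne_zero
  have hφ : ∀ d ∈ Q, (0:ℝ) < Nat.totient d := fun d hd => by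
    exact_mod_cast Nat.totient_pos.2 (hpos d hd)
  have hG20 : 0 ≤ G2 := Finset.sum_nonneg fun d hd => by have := hφ d hd; positivity
  let v : Fin k → ℕ → ℝ := fun i r => if i = m then 1 else g r ^ 2 / (Nat.totient r : ℝ)
  have hv0 : ∀ i, ∀ r ∈ Qm Q m i, 0 ≤ v i r := by
    intro i r hr
    unfold Qm at hr
    simp only [v]
    split_ifs at hr ⊢
    · norm_num
    · have := hφ r hr; positivity
  have hsumv : ∀ i, ∑ r ∈ Qm Q m i, v i r = if i = m then 1 else G2 := by
    intro i
    by_cases hi : i = m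
    · simp [Qm, v, hi]
    · simp [Qm, v, hi, hG2]
  have hcard : ∏ i : Fin k, (if i = m then (1:ℝ) else G2) = G2^(k-1) := by
    rw [Finset.prod_ite]
    simp [Finset.filter_ne']
  -- total mass
  have htot : ∑ r ∈ Fintype.piFinset (Qm Q m), ∏ i, v i (r i) = G2^(k-1) := by
    rw [← Finset.prod_univ_sum, Finset.prod_congr rfl fun i _ => hsumv i, hcard]
  have hlogsum : ∑ r ∈ Fintype.piFinset (Qm Q m), (∑ i, Real.log (r i)) * ∏ j, v j (r j) ≤ k * c * G2^(k-1) := by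
    have h1 : ∀ r : Fin k → ℕ, (∑ i, Real.log (r i)) * ∏ j, v j (r j) =
        ∑ i, ∏ j, (if j = i then v j (r j) * Real.log (r j) else v j (r j)) := by
      intro r
      rw [Finset.sum_mul]
      apply Finset.sum_congr rfl
      intro i _
      have : ∀ j, (if j = i then v j (r j) * Real.log (r j) else v j (r j)) = v j (r j) * (if j = i then Real.log (r j) else 1) := by
        intro j; split_ifs <;> simp
      rw [Finset.prod_congr rfl fun j _ => this j, Finset.prod_mul_distrib, Finset.prod_ite_eq']
      simp [mul_comm]
    rw [Finset.sum_congr rfl fun r _ => h1 r, Finset.sum_comm]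
    have h2 : ∀ i : Fin k, ∑ r ∈ Fintype.piFinset (Qm Q m),
        ∏ j, (if j = i then v j (r j) * Real.log (r j) else v j (r j)) ≤ c * G2^(k-1) := by
      intro i
      rw [← Finset.prod_univ_sum (Qm Q m) (fun j x => if j = i then v j x * Real.log x else v j x)]
      have h3 : ∀ j, ∑ x ∈ Qm Q m j, (if j = i then v j x * Real.log x else v j x) ≤
          (if j = i then c else 1) * (if j = m then 1 else G2) := by
        intro j
        by_cases hj : j = i
        · simp only [hj, if_true]
          by_cases hi : i = m
          · simp [hi, Qm, v, hc0]
          · simpa [hi, Qm, v] using hG3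
        · simp only [hj, if_false, one_mul]
          exact (hsumv j).le
      calc _ ≤ ∏ j, (if j = i then c else 1) * (if j = m then (1:ℝ) else G2) := by
            apply Finset.prod_le_prod _ (fun j _ => h3 j)
            intro j _
            apply Finset.sum_nonneg
            intro x hx
            have := hv0 j x hx
            split_ifs
            · exact mul_nonneg this (Real.log_natCast_nonneg _)
            · exact this
        _ = c * G2^(k-1) := by
          rw [Finset.prod_mul_distrib, hcard, Finset.prod_ite_eq']; simp
    calc _ ≤ ∑ i : Fin k, c * G2^(k-1) := Finset.sum_le_sum fun i _ => h2 i
      _ = _ := by simp; ring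
  have hlR0 : 0 < Real.log R0 := Real.log_pos (by exact_mod_cast hR0)
  -- pointwise lower bound
  have hpt : ∀ r ∈ Fintype.piFinset (Qm Q m),
      G1^2 * (∏ i, v i (r i)) * (1 - (∑ i, Real.log (r i)) / Real.log R0) ≤
      (∏ i, (Nat.totient (r i) : ℝ)) * (∑ s ∈ Q, Yw R g (Function.update r m s))^2 := by
    intro r hr
    have hr' := Fintype.mem_piFinset.1 hr
    have hrm : r m = 1 := by have := hr' m; simpa [Qm] using this
    have hri : ∀ i, i ≠ m → r i ∈ Q := fun i hi => by have := hr' i; simpa [Qm, hi] using this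
    have hrpos : ∀ i, 0 < r i := by
      intro i
      by_cases hi : i = m
      · subst hi; omega
      · exact hpos _ (hri i hi)
    have hvv : 0 ≤ ∏ i, v i (r i) := Finset.prod_nonneg fun i _ => hv0 i _ (hr' i)
    by_cases hle : ∏ i, r i ≤ R0
    · have hY : ∀ s ∈ Q, Yw R g (Function.update r m s) =
          (∏ i, if i = m then 1 else g (r i) / (Nat.totient (r i) : ℝ)) * (g s / (Nat.totient s : ℝ)) := by
        intro s hs
        have hprod : ∏ i, g (Function.update r m s i) / (Nat.totient (Function.update r m s i) : ℝ) =
          (∏ i, if i = m then 1 else g (r i) / (Nat.totient (r i) : ℝ)) * (g s / (Nat.totient s : ℝ)) := by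
          have : ∀ i, g (Function.update r m s i) / (Nat.totient (Function.update r m s i) : ℝ) =
            (if i = m then 1 else g (r i) / (Nat.totient (r i) : ℝ)) * (if i = m then g s / (Nat.totient s : ℝ) else 1) := by
            intro i
            by_cases hi : i = m
            · subst hi; simp
            · simp [hi]
          rw [Finset.prod_congr rfl fun i _ => this i, Finset.prod_mul_distrib, Finset.prod_ite_eq']
          simp
        unfold Yw
        split_ifs with h
        · exact hprod
        · have hgs : g s = 0 := by
            by_contra hgs
            apply h
            have hsX := hgX s hgs
            have h5 : ∏ i, Function.update r m s i = (∏ i, r i) * s := by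
              have : ∀ i, Function.update r m s i = r i * (if i = m then s else 1) := by
                intro i
                by_cases hi : i = m
                · subst hi; simp [hrm]
                · simp [hi]
              rw [Finset.prod_congr rfl fun i _ => this i, Finset.prod_mul_distrib, Finset.prod_ite_eq']
              simp
            rw [h5]
            exact (Nat.mul_le_mul hle hsX).trans hR
          simp [hgs]
      rw [Finset.sum_congr rfl hY, ← Finset.mul_sum, ← hG1, mul_pow, ← Finset.prod_pow, ← mul_assoc, ← Finset.prod_mul_distrib]
      have h6 : ∀ i, (Nat.totient (r i) : ℝ) * (if i = m then 1 else g (r i) / (Nat.totient (r i) : ℝ))^2 = v i (r i) := by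
        intro i
        by_cases hi : i = m
        · subst hi; simp [v, hrm]
        · have := (hφ _ (hri i hi)).ne'
          simp only [v, hi, if_false]
          field_simp
      rw [Finset.prod_congr rfl fun i _ => h6 i]
      have h7 : 0 ≤ (∑ i, Real.log (r i)) / Real.log R0 :=
        div_nonneg (Finset.sum_nonneg fun i _ => Real.log_natCast_nonneg _) hlR0.le
      have h8 : 0 ≤ G1^2 * (∏ i, v i (r i)) := by positivity
      nlinarith
    · push Not at hle
      have h9 : Real.log R0 ≤ ∑ i, Real.log (r i) := by
        rw [← Real.log_prod (fun i _ => by exact_mod_cast (hrpos i).ne')]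
        apply Real.log_le_log (by positivity)
        exact_mod_cast hle.le
      have h10 : 1 ≤ (∑ i, Real.log (r i)) / Real.log R0 := by rwa [le_div_iff₀ hlR0, one_mul]
      have h11 : G1^2 * (∏ i, v i (r i)) * (1 - (∑ i, Real.log (r i)) / Real.log R0) ≤ 0 :=
        mul_nonpos_of_nonneg_of_nonpos (by positivity) (by linarith)
      refine h11.trans ?_
      positivity
  refine le_trans ?_ (Finset.sum_le_sum hpt)
  have h12 : ∑ r ∈ Fintype.piFinset (Qm Q m), G1^2 * (∏ i, v i (r i)) * (1 - (∑ i, Real.log (r i)) / Real.log R0)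
      = G1^2 * (G2^(k-1) - (∑ r ∈ Fintype.piFinset (Qm Q m), (∑ i, Real.log (r i)) * ∏ j, v j (r j)) / Real.log R0) := by
    rw [← htot, Finset.sum_div, ← Finset.sum_sub_distrib, Finset.mul_sum]
    apply Finset.sum_congr rfl
    intro r _
    ring
  rw [h12]
  have h13 : (∑ r ∈ Fintype.piFinset (Qm Q m), (∑ i, Real.log (r i)) * ∏ j, v j (r j)) / Real.log R0 ≤ G2^(k-1)/2 := by
    rw [div_le_iff₀ hlR0]
    refine hlogsum.trans ?_
    have : 0 ≤ G2^(k-1) := by positivity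
    nlinarith
  have h14 : 0 ≤ G1^2 := by positivity
  nlinarith

/-- all prime factors exceed `z` -/
def Rough (z r : ℕ) : Prop := ∀ p, p.Prime → p ∣ r → z < p

noncomputable instance (z : ℕ) : DecidablePred (Rough z) := Classical.decPred _

noncomputable def Vp (z : ℕ) : ℝ := ∏ p ∈ prs z, (1 - 1/(p:ℝ))

lemma sum_inv_sq_prs (z : ℕ) : ∑ p ∈ prs z, 1/(p:ℝ)^2 ≤ 1 := by
  have h : prs z ⊆ Finset.Ioc 1 (z+1) := by
    intro p hp
    have := mem_prs.1 hp
    have := this.2.two_le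
    rw [Finset.mem_Ioc]; omega
  calc ∑ p ∈ prs z, 1/(p:ℝ)^2 ≤ ∑ p ∈ Finset.Ioc 1 (z+1), 1/(p:ℝ)^2 :=
        Finset.sum_le_sum_of_subset_of_nonneg h (fun _ _ _ => by positivity)
    _ ≤ 1 := by
      have := sum_Ioc_inv_sq_le_sub (α := ℝ) (k := 1) (n := z+1) (by norm_num) (by omega)
      simp only [one_div]
      refine this.trans ?_
      have : (0:ℝ) ≤ ((z+1 : ℕ):ℝ)⁻¹ := by positivity
      push_cast at *; linarith

lemma one_sub_ge (x : ℝ) (h0 : 0 ≤ x) (h1 : x ≤ 1/2) : Real.exp (-(x + x^2)) ≤ 1 - x := by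
  rw [Real.exp_neg]
  have e1 : 1 + (x+x^2) + (x+x^2)^2/2 ≤ Real.exp (x+x^2) := Real.quadratic_le_exp_of_nonneg (by positivity)
  have h2 : 0 < 1 + (x+x^2) + (x+x^2)^2/2 := by positivity
  refine (inv_anti₀ h2 e1).trans ?_
  rw [inv_le_iff_one_le_mul₀ h2]
  nlinarith [mul_nonneg h0 h0, mul_nonneg (mul_nonneg h0 h0) h0, mul_nonneg (mul_nonneg h0 h0) (by linarith : 0 ≤ 1/2 - x), mul_nonneg (mul_nonneg (mul_nonneg h0 h0) h0) (by linarith : 0 ≤ 1/2 - x), mul_nonneg (mul_nonneg (mul_nonneg (mul_nonneg h0 h0) h0) h0) (by linarith : 0 ≤ 1/2 - x)]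

/-- lower bound for sieve products -/
lemma V_lower (hEH : HasLevelOfDistribution 1) (κ : ℝ) (hκ : 0 ≤ κ) :
    ∃ c : ℝ, 0 < c ∧ ∀ z : ℕ, 2 ≤ z → ∀ P ⊆ prs z, ∀ x : ℕ → ℝ,
      (∀ p ∈ P, 0 ≤ x p ∧ x p ≤ κ / p ∧ x p ≤ 1/2) →
      c * Real.exp (-(κ * Real.log (Real.log z))) ≤ ∏ p ∈ P, (1 - x p) := by
  obtain ⟨C, hC, hm⟩ := mertens2 hEH
  refine ⟨Real.exp (-(κ*C + κ^2)), Real.exp_pos _, fun z hz P hP x hx => ?_⟩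
  have h1 : ∑ p ∈ P, (x p + x p^2) ≤ κ * (Real.log (Real.log z) + C) + κ^2 := by
    have h2 : ∑ p ∈ P, (x p + x p^2) ≤ ∑ p ∈ P, (κ * (1/(p:ℝ)) + κ^2 * (1/(p:ℝ)^2)) := by
      apply Finset.sum_le_sum
      intro p hp
      have h := hx p hp
      have e : κ / (p:ℝ) = κ * (1/(p:ℝ)) := by ring
      have e2 : κ^2 * (1/(p:ℝ)^2) = (κ/p)^2 := by ring
      have := pow_le_pow_left₀ h.1 h.2.1 2
      rw [e2, ← e]; linarith [h.2.1]
    have h3 : ∑ p ∈ P, (κ * (1/(p:ℝ)) + κ^2 * (1/(p:ℝ)^2)) ≤ ∑ p ∈ prs z, (κ * (1/(p:ℝ)) + κ^2 * (1/(p:ℝ)^2)) :=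
      Finset.sum_le_sum_of_subset_of_nonneg hP (fun _ _ _ => by positivity)
    replace h3 := h2.trans h3
    rw [Finset.sum_add_distrib (s := prs z), ← Finset.mul_sum, ← Finset.mul_sum] at h3
    have h4 := (abs_le.1 (hm z hz)).2
    have h5 := sum_inv_sq_prs z
    have h6 : κ * ∑ p ∈ prs z, 1/(p:ℝ) ≤ κ * (Real.log (Real.log z) + C) :=
      mul_le_mul_of_nonneg_left (by linarith) hκ
    have h7 : κ^2 * ∑ p ∈ prs z, 1/(p:ℝ)^2 ≤ κ^2 * 1 := mul_le_mul_of_nonneg_left h5 (by positivity)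
    linarith
  calc Real.exp (-(κ*C + κ^2)) * Real.exp (-(κ * Real.log (Real.log z)))
      = Real.exp (-(κ * (Real.log (Real.log z) + C) + κ^2)) := by rw [← Real.exp_add]; ring_nf
    _ ≤ Real.exp (∑ p ∈ P, -(x p + x p^2)) := by
      apply Real.exp_le_exp.2; rw [Finset.sum_neg_distrib]; linarith
    _ = ∏ p ∈ P, Real.exp (-(x p + x p^2)) := Real.exp_sum _ _
    _ ≤ _ := Finset.prod_le_prod (fun _ _ => (Real.exp_pos _).le)
      (fun p hp => one_sub_ge _ (hx p hp).1 (hx p hp).2.2)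

lemma Vp_lower (hEH : HasLevelOfDistribution 1) :
    ∃ c : ℝ, 0 < c ∧ ∀ z : ℕ, 2 ≤ z → c / Real.log z ≤ Vp z := by
  obtain ⟨c, hc, h⟩ := V_lower hEH 1 (by norm_num)
  refine ⟨c, hc, fun z hz => ?_⟩
  have hlog : 0 < Real.log z := Real.log_pos (by exact_mod_cast hz)
  have := h z hz (prs z) (subset_refl _) (fun p => 1/(p:ℝ)) (fun p hp => by
    have h2 := (mem_prs.1 hp).2.two_le
    have : (2:ℝ) ≤ p := by exact_mod_cast h2
    refine ⟨by positivity, le_refl _, ?_⟩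
    exact one_div_le_one_div_of_le (by norm_num) this)
  rw [one_mul, Real.exp_neg, Real.exp_log hlog] at this
  rw [div_eq_mul_inv]; exact this

lemma sum_powerset_filter (P : Finset ℕ) (q : ℕ → Prop) [DecidablePred q] (l : Finset ℕ → ℝ) :
    ∑ S ∈ (P.filter q).powerset, l S = ∑ S ∈ P.powerset, if ∀ p ∈ S, q p then l S else 0 := by
  rw [← Finset.sum_filter]
  apply Finset.sum_congr _ (fun _ _ => rfl)
  ext S
  simp only [Finset.mem_powerset, Finset.mem_filter, Finset.subset_iff]
  constructor
  · intro h; exact ⟨fun p hp => (h hp).1, fun p hp => (h hp).2⟩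
  · rintro ⟨h1, h2⟩ p hp; exact ⟨h1 hp, h2 p hp⟩

lemma primes_prod_dvd_iff (S : Finset ℕ) (hS : ∀ p ∈ S, p.Prime) (n : ℕ) :
    (∀ p ∈ S, p ∣ n) ↔ ∏ p ∈ S, p ∣ n := by
  constructor
  · intro h
    exact Finset.prod_primes_dvd n (fun p hp => (hS p hp).prime) h
  · intro h p hp
    exact (Finset.dvd_prod_of_mem _ hp).trans h

lemma primes_prod_inj (S T : Finset ℕ) (hS : ∀ p ∈ S, p.Prime) (hT : ∀ p ∈ T, p.Prime)
    (h : ∏ p ∈ S, p = ∏ p ∈ T, p) : S = T := by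
  rw [← Nat.primeFactors_prod hS, ← Nat.primeFactors_prod hT, h]

lemma harm_bound (m1 : ℕ) (h1 : 1 ≤ m1) (m2 : ℕ) (h2 : m1 ≤ m2) :
    Real.log m2 - Real.log m1 ≤ ∑ m ∈ Finset.Ico m1 m2, 1/(m:ℝ) ∧
    ∑ m ∈ Finset.Ico m1 m2, 1/(m:ℝ) ≤ Real.log m2 - Real.log m1 + 1/m1 - 1/m2 := by
  induction m2, h2 using Nat.le_induction with
  | base => simp
  | succ n hn ih =>
    have hn0 : (0:ℝ) < n := by exact_mod_cast (by omega : 0 < n)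
    rw [Finset.sum_Ico_succ_top hn]
    have h3 : Real.log ((n+1:ℕ):ℝ) - Real.log n = Real.log (1 + 1/n) := by
      rw [← Real.log_div (by positivity) (by positivity)]
      congr 1; push_cast; field_simp
    have h4 : Real.log (1 + 1/n) ≤ 1/(n:ℝ) := by
      have := Real.log_le_sub_one_of_pos (show (0:ℝ) < 1 + 1/n by positivity)
      linarith
    have h5 : 1/((n+1:ℕ):ℝ) ≤ Real.log (1 + 1/n) := by
      have := Real.one_sub_inv_le_log_of_pos (show (0:ℝ) < 1 + 1/n by positivity)
      refine le_trans (le_of_eq ?_) this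
      push_cast; field_simp; ring
    constructor
    · linarith [ih.1]
    · linarith [ih.2]

lemma harm_mult (D A B : ℕ) (hD : 1 ≤ D) (hA : 1 ≤ A) (hDA : D ≤ A) (hAB : A ≤ B) :
    |∑ n ∈ Finset.Ico A B, (if D ∣ n then 1/(n:ℝ) else 0) - 1/(D:ℝ) * (Real.log B - Real.log A)| ≤ 2/(A:ℝ) := by
  set m1 := (A + D - 1)/D with hm1
  set m2 := (B + D - 1)/D with hm2
  have hm11 : 1 ≤ m1 := by
    rw [hm1, Nat.le_div_iff_mul_le (by omega)]; omega
  have hm12 : m1 ≤ m2 := Nat.div_le_div_right (by omega)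
  have hDpos : (0:ℝ) < D := by exact_mod_cast hD
  have hApos : (0:ℝ) < A := by exact_mod_cast hA
  have hBpos : (0:ℝ) < B := by exact_mod_cast (by omega : 0 < B)
  have hceil : ∀ C : ℕ, C ≤ D * ((C + D - 1)/D) ∧ D * ((C+D-1)/D) + 1 ≤ C + D := by
    intro C
    have e := Nat.div_add_mod (C + D - 1) D
    have e2 := Nat.mod_lt (C + D - 1) (show D > 0 by omega)
    generalize D * ((C+D-1)/D) = X at *
    omega
  have hsum : ∑ n ∈ Finset.Ico A B, (if D ∣ n then 1/(n:ℝ) else 0) = 1/(D:ℝ) * ∑ m ∈ Finset.Ico m1 m2, 1/(m:ℝ) := by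
    rw [← Finset.sum_filter, Finset.mul_sum]
    symm
    apply Finset.sum_bij (fun m _ => D * m)
    · intro m hm
      rw [Finset.mem_Ico] at hm
      rw [Finset.mem_filter, Finset.mem_Ico]
      refine ⟨⟨?_, ?_⟩, Dvd.intro _ rfl⟩
      · exact (hceil A).1.trans (Nat.mul_le_mul_left D hm.1)
      · have h1 := (hceil B).2
        have h2 : D * (m+1) ≤ D * m2 := Nat.mul_le_mul_left D hm.2
        rw [← hm2] at h1
        rw [mul_add, mul_one] at h2
        omega
    · intro a _ b _ h
      exact Nat.eq_of_mul_eq_mul_left (by omega) h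
    · intro n hn
      rw [Finset.mem_filter, Finset.mem_Ico] at hn
      obtain ⟨⟨h1, h2⟩, ⟨m, rfl⟩⟩ := hn
      refine ⟨m, ?_, rfl⟩
      rw [Finset.mem_Ico]
      constructor
      · have := (hceil A).2
        rw [← hm1] at this
        by_contra hlt
        push Not at hlt
        have h3 : D * (m+1) ≤ D * m1 := Nat.mul_le_mul_left D hlt
        rw [mul_add, mul_one] at h3; omega
      · have := (hceil B).1
        rw [← hm2] at this
        by_contra hlt
        push Not at hlt
        have h3 : D * m2 ≤ D * m := Nat.mul_le_mul_left D hlt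
        omega
    · intro m _
      push_cast
      rw [one_div_mul_one_div]
  obtain ⟨h1, h2⟩ := harm_bound m1 hm11 m2 hm12
  have hlog : ∀ C : ℕ, A ≤ C → Real.log C - Real.log D ≤ Real.log (((C + D - 1)/D : ℕ):ℝ) ∧
      Real.log (((C + D - 1)/D : ℕ):ℝ) ≤ Real.log C - Real.log D + D / A := by
    intro C hC
    obtain ⟨c1, c2⟩ := hceil C
    set m := (C + D - 1)/D
    have hC0 : (0:ℝ) < C := by exact_mod_cast (by omega : 0 < C)
    have c1' : (C:ℝ) ≤ D * m := by exact_mod_cast c1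
    have c2' : (D:ℝ) * m ≤ C + D := by exact_mod_cast (by omega : D * m ≤ C + D)
    have hm0 : (0:ℝ) < m := by
      by_contra h
      push Not at h
      nlinarith
    have e : Real.log m = Real.log (D * m) - Real.log D := by
      rw [Real.log_mul hDpos.ne' hm0.ne']; ring
    rw [e]
    constructor
    · have := Real.log_le_log hC0 c1'; linarith
    · have h3 := Real.log_le_log (by positivity) c2'
      have h4 : Real.log (C + D) = Real.log C + Real.log (1 + D/C) := by
        rw [← Real.log_mul hC0.ne' (by positivity)]; congr 1; field_simp
      have h5 : Real.log (1 + D/C) ≤ D/(C:ℝ) := by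
        have := Real.log_le_sub_one_of_pos (show (0:ℝ) < 1 + D/C by positivity)
        linarith
      have h6 : (D:ℝ)/C ≤ D/A := div_le_div_of_nonneg_left hDpos.le hApos (by exact_mod_cast hC)
      linarith
  have hA' := hlog A le_rfl
  have hB' := hlog B hAB
  rw [← hm1] at hA'
  rw [← hm2] at hB'
  have hm1inv : 1/(m1:ℝ) ≤ D/A := by
    rw [div_le_div_iff₀ (by exact_mod_cast hm11) hApos]
    have := (hceil A).1
    rw [one_mul]; exact_mod_cast this
  have hm2inv : 0 ≤ 1/(m2:ℝ) := by positivity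
  rw [hsum, ← mul_sub, abs_mul, abs_of_pos (by positivity : (0:ℝ) < 1/D)]
  have : |∑ m ∈ Finset.Ico m1 m2, 1/(m:ℝ) - (Real.log B - Real.log A)| ≤ 2 * (D/A) := by
    rw [abs_le]; constructor <;> linarith [hA'.1, hA'.2, hB'.1, hB'.2]
  calc 1/(D:ℝ) * _ ≤ 1/(D:ℝ) * (2 * (D/A)) := mul_le_mul_of_nonneg_left this (by positivity)
    _ = 2/A := by field_simp

lemma one_sub_sum_le (S : Finset ℕ) (x : ℕ → ℝ) (h : ∀ p ∈ S, 0 ≤ x p ∧ x p ≤ 1) :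
    1 - ∑ p ∈ S, x p ≤ ∏ p ∈ S, (1 - x p) := by
  induction S using Finset.induction_on with
  | empty => simp
  | insert p S hp ih =>
    have ih := ih (fun q hq => h q (Finset.mem_insert_of_mem hq))
    have h1 := h p (Finset.mem_insert_self _ _)
    rw [Finset.sum_insert hp, Finset.prod_insert hp]
    have h2 : ∏ p ∈ S, (1 - x p) ≤ 1 := Finset.prod_le_one
      (fun q hq => by linarith [(h q (Finset.mem_insert_of_mem hq)).2])
      (fun q hq => by linarith [(h q (Finset.mem_insert_of_mem hq)).1])
    nlinarith

lemma rough_omega {z n K : ℕ} (hz : 2 ≤ z) (h : Rough z n) (hn : n ≠ 0) (hK : n ≤ z^K) : n.primeFactors.card ≤ K := by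
  have h1 : z ^ n.primeFactors.card ≤ ∏ p ∈ n.primeFactors, p :=
    Finset.pow_card_le_prod _ _ _ (fun p hp => (h p (Nat.prime_of_mem_primeFactors hp) (Nat.dvd_of_mem_primeFactors hp)).le)
  have h2 : ∏ p ∈ n.primeFactors, p ≤ n := Nat.le_of_dvd (Nat.pos_of_ne_zero hn) (Nat.prod_primeFactors_dvd n)
  exact (Nat.pow_le_pow_iff_right (by omega)).1 (h1.trans (h2.trans hK))

lemma rough_phi {z n K : ℕ} (hz : 2 ≤ z) (h : Rough z n) (hn : n ≠ 0) (hK : n ≤ z^K) :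
    (1 - (K:ℝ)/z) * n ≤ Nat.totient n := by
  have h1 : (Nat.totient n : ℝ) = n * ∏ p ∈ n.primeFactors, (1 - (p:ℝ)⁻¹) := by
    have := Nat.totient_eq_mul_prod_factors n
    have h := congrArg (fun x : ℚ => (x:ℝ)) this
    push_cast at h
    exact h
  have hz0 : (0:ℝ) < z := by exact_mod_cast (by omega : 0 < z)
  have h2 := one_sub_sum_le n.primeFactors (fun p => (p:ℝ)⁻¹) (fun p hp => by
    have : (1:ℝ) ≤ p := by exact_mod_cast (Nat.prime_of_mem_primeFactors hp).one_le
    exact ⟨by positivity, inv_le_one_of_one_le₀ this⟩)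
  have h3 : ∑ p ∈ n.primeFactors, (p:ℝ)⁻¹ ≤ K / z := by
    calc ∑ p ∈ n.primeFactors, (p:ℝ)⁻¹ ≤ ∑ p ∈ n.primeFactors, (z:ℝ)⁻¹ := by
          apply Finset.sum_le_sum
          intro p hp
          apply inv_anti₀ hz0
          exact_mod_cast (h p (Nat.prime_of_mem_primeFactors hp) (Nat.dvd_of_mem_primeFactors hp)).le
      _ = n.primeFactors.card * (z:ℝ)⁻¹ := by simp
      _ ≤ K * (z:ℝ)⁻¹ := by
        apply mul_le_mul_of_nonneg_right _ (by positivity)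
        exact_mod_cast rough_omega hz h hn hK
      _ = K / z := by ring
  rw [h1, mul_comm]
  apply mul_le_mul_of_nonneg_left _ (by positivity)
  linarith

lemma rough_iff (z n : ℕ) : Rough z n ↔ (prs z).filter (fun p => p ∣ n) = ∅ := by
  rw [Finset.filter_eq_empty_iff]
  constructor
  · intro h p hp hd
    have := mem_prs.1 hp
    have := h p this.2 hd
    omega
  · intro h p hp hd
    by_contra hlt
    exact h (mem_prs.2 ⟨by omega, hp⟩) hd

lemma log_le_small (c : ℝ) (hc : 0 < c) : ∃ z0 : ℕ, ∀ z : ℕ, z0 ≤ z → Real.log z ≤ c * z := by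
  have h := (Real.isLittleO_log_id_atTop.comp_tendsto tendsto_natCast_atTop_atTop).bound hc
  obtain ⟨z0, hz0⟩ := Filter.eventually_atTop.1 h
  refine ⟨z0, fun z hz => ?_⟩
  have := hz0 z hz
  simp only [Function.comp, id, Real.norm_eq_abs] at this
  rw [abs_of_nonneg (Real.log_natCast_nonneg z), abs_of_nonneg (by positivity)] at this
  exact this

/-- count of supported sieve terms -/
lemma supp_card (P : Finset ℕ) (hP : ∀ p ∈ P, p.Prime) (L : ℕ) :
    ((P.powerset).filter (fun S => ∏ p ∈ S, p ≤ L)).card ≤ L := by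
  have : ((P.powerset).filter (fun S => ∏ p ∈ S, p ≤ L)).card ≤ (Finset.Icc 1 L).card := by
    apply Finset.card_le_card_of_injOn (fun S => ∏ p ∈ S, p)
    · intro S hS
      simp only [Finset.coe_filter, Set.mem_ofPred_eq, Finset.mem_powerset] at hS
      simp only [Finset.coe_Icc, Set.mem_Icc]
      exact ⟨Finset.prod_pos fun p hp => (hP p (hS.1 hp)).pos, hS.2⟩
    · intro S hS T hT h
      simp only [Finset.coe_filter, Set.mem_ofPred_eq, Finset.mem_powerset] at hS hT
      exact primes_prod_inj S T (fun p hp => hP p (hS.1 hp)) (fun p hp => hP p (hT.1 hp)) h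
  simpa using this

lemma sieve_harm (P : Finset ℕ) (hP : ∀ p ∈ P, p.Prime) (L X : ℕ) (hX : 1 ≤ X) (hLX : L ≤ X)
    (l : Finset ℕ → ℝ) (habs : ∀ S, |l S| ≤ 1) (hsupp : ∀ S, l S ≠ 0 → S ⊆ P ∧ ∏ p ∈ S, p ≤ L) :
    |∑ n ∈ Finset.Ico X (X^2), (∑ S ∈ (P.filter (fun p => p ∣ n)).powerset, l S) * (1/(n:ℝ))
      - (∑ S ∈ P.powerset, l S * ∏ p ∈ S, (1/(p:ℝ))) * Real.log X| ≤ 2 * L / X := by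
  have hXpos : (0:ℝ) < X := by exact_mod_cast hX
  have h1 : ∑ n ∈ Finset.Ico X (X^2), (∑ S ∈ (P.filter (fun p => p ∣ n)).powerset, l S) * (1/(n:ℝ))
     = ∑ S ∈ P.powerset, l S * ∑ n ∈ Finset.Ico X (X^2), (if ∏ p ∈ S, p ∣ n then 1/(n:ℝ) else 0) := by
    simp_rw [sum_powerset_filter, Finset.sum_mul]
    rw [Finset.sum_comm]
    apply Finset.sum_congr rfl
    intro S hS
    rw [Finset.mem_powerset] at hS
    rw [Finset.mul_sum]
    apply Finset.sum_congr rfl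
    intro n _
    have := primes_prod_dvd_iff S (fun p hp => hP p (hS hp)) n
    by_cases h : ∀ p ∈ S, p ∣ n
    · rw [if_pos h, if_pos (this.1 h)]
    · rw [if_neg h, if_neg (fun h' => h (this.2 h'))]; simp
  rw [h1, Finset.sum_mul, ← Finset.sum_sub_distrib]
  have h2 : ∀ S ∈ P.powerset, |l S * ∑ n ∈ Finset.Ico X (X^2), (if ∏ p ∈ S, p ∣ n then 1/(n:ℝ) else 0)
      - l S * (∏ p ∈ S, (1/(p:ℝ))) * Real.log X| ≤ if ∏ p ∈ S, p ≤ L then 2/(X:ℝ) else 0 := by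
    intro S hS
    rw [Finset.mem_powerset] at hS
    by_cases hl : l S = 0
    · rw [hl]; simp; split_ifs <;> positivity
    · have hs := hsupp S hl
      rw [if_pos hs.2, mul_assoc, ← mul_sub, abs_mul]
      have hpos : 1 ≤ ∏ p ∈ S, p := Finset.prod_pos fun p hp => (hP p (hS hp)).pos
      have h3 := harm_mult (∏ p ∈ S, p) X (X^2) hpos hX (hs.2.trans hLX) (Nat.le_self_pow two_ne_zero X)
      have h4 : Real.log ((X^2 : ℕ):ℝ) - Real.log X = Real.log X := by
        push_cast; rw [Real.log_pow]; push_cast; ring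
      rw [h4] at h3
      have h5 : (1:ℝ)/((∏ p ∈ S, p : ℕ):ℝ) = ∏ p ∈ S, (1/(p:ℝ)) := by
        push_cast; simp
      rw [h5] at h3
      calc |l S| * _ ≤ 1 * (2/(X:ℝ)) := mul_le_mul (habs S) h3 (abs_nonneg _) zero_le_one
        _ = _ := one_mul _
  refine (Finset.abs_sum_le_sum_abs _ _).trans ((Finset.sum_le_sum h2).trans ?_)
  rw [← Finset.sum_filter, Finset.sum_const, nsmul_eq_mul]
  have h6 : ((P.powerset.filter (fun S => ∏ p ∈ S, p ≤ L)).card : ℝ) ≤ L := by exact_mod_cast supp_card P hP L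
  calc _ ≤ (L:ℝ) * (2/X) := mul_le_mul_of_nonneg_right h6 (by positivity)
    _ = _ := by ring

lemma sum_biUnion_le' {α β : Type*} [DecidableEq α] [DecidableEq β] (s : Finset α) (t : α → Finset β) (f : β → ℝ) (hf : ∀ x, 0 ≤ f x) :
    ∑ x ∈ s.biUnion t, f x ≤ ∑ a ∈ s, ∑ x ∈ t a, f x := by
  induction s using Finset.induction_on with
  | empty => simp
  | insert a s ha ih =>
    rw [Finset.biUnion_insert, Finset.sum_insert ha]
    have := Finset.sum_union_inter (s₁ := t a) (s₂ := s.biUnion t) (f := f)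
    have h0 : 0 ≤ ∑ x ∈ t a ∩ s.biUnion t, f x := Finset.sum_nonneg fun x _ => hf x
    linarith

lemma nonsq_sum (z Y : ℕ) (hz : 1 ≤ z) (hY : 1 ≤ Y) :
    ∑ n ∈ (Finset.Ico 1 Y).filter (fun n => ¬ Squarefree n ∧ Rough z n), 1/(n:ℝ) ≤ 1/(z:ℝ) * (1 + Real.log Y) := by
  have h1 : (Finset.Ico 1 Y).filter (fun n => ¬ Squarefree n ∧ Rough z n) ⊆
      (Finset.Ioc z (z+Y)).biUnion (fun m => (Finset.Ico 1 Y).image (fun j => m^2 * j)) := by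
    intro n hn
    rw [Finset.mem_filter, Finset.mem_Ico] at hn
    obtain ⟨⟨h1, h2⟩, h3, h4⟩ := hn
    rw [Nat.squarefree_iff_prime_squarefree] at h3
    push Not at h3
    obtain ⟨p, hp, j, rfl⟩ := h3
    have hzp := h4 p hp (Dvd.intro (p*j) (by ring))
    have hj : 1 ≤ j := by
      rcases Nat.eq_zero_or_pos j with h | h
      · subst h; simp at h1
      · exact h
    have hp2 := hp.two_le
    rw [Finset.mem_biUnion]
    refine ⟨p, ?_, ?_⟩
    · rw [Finset.mem_Ioc]
      refine ⟨hzp, ?_⟩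
      nlinarith [Nat.mul_le_mul hp2 hj]
    · rw [Finset.mem_image]
      refine ⟨j, ?_, by ring⟩
      rw [Finset.mem_Ico]
      refine ⟨hj, ?_⟩
      have : 1 * j ≤ p * p * j := Nat.mul_le_mul_right j (by nlinarith)
      omega
  calc _ ≤ ∑ n ∈ (Finset.Ioc z (z+Y)).biUnion (fun m : ℕ => (Finset.Ico 1 Y).image (fun j : ℕ => m^2 * j)), 1/((n:ℕ):ℝ) :=
        Finset.sum_le_sum_of_subset_of_nonneg h1 (fun _ _ _ => by positivity)
    _ ≤ ∑ m ∈ Finset.Ioc z (z+Y), ∑ n ∈ (Finset.Ico 1 Y).image (fun j : ℕ => m^2 * j), 1/((n:ℕ):ℝ) :=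
        sum_biUnion_le' _ _ _ (fun _ => by positivity)
    _ = ∑ m ∈ Finset.Ioc z (z+Y), ∑ j ∈ Finset.Ico 1 Y, 1/(m:ℝ)^2 * (1/(j:ℝ)) := by
        apply Finset.sum_congr rfl
        intro m hm
        rw [Finset.mem_Ioc] at hm
        rw [Finset.sum_image]
        · apply Finset.sum_congr rfl
          intro j _
          push_cast
          rw [one_div_mul_one_div]
        · intro a _ b _ h
          exact Nat.eq_of_mul_eq_mul_left (pow_pos (by omega) 2) h
    _ = (∑ m ∈ Finset.Ioc z (z+Y), 1/(m:ℝ)^2) * ∑ j ∈ Finset.Ico 1 Y, 1/(j:ℝ) := by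
        rw [Finset.sum_mul_sum]
    _ ≤ 1/(z:ℝ) * (1 + Real.log Y) := by
        have a1 : ∑ m ∈ Finset.Ioc z (z+Y), 1/(m:ℝ)^2 ≤ 1/(z:ℝ) := by
          have := sum_Ioc_inv_sq_le_sub (α := ℝ) (k := z) (n := z+Y) (by omega) (by omega)
          simp only [one_div]
          refine this.trans ?_
          have : (0:ℝ) ≤ ((z+Y : ℕ):ℝ)⁻¹ := by positivity
          linarith
        have a2 : ∑ j ∈ Finset.Ico 1 Y, 1/(j:ℝ) ≤ 1 + Real.log Y := by
          have := (harm_bound 1 le_rfl Y hY).2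
          simp only [Nat.cast_one, Real.log_one] at this
          have h0 : (0:ℝ) ≤ 1/(Y:ℝ) := by positivity
          linarith
        exact mul_le_mul a1 a2 (Finset.sum_nonneg fun _ _ => by positivity) (by positivity)

/-- The measure of rough numbers in `[X, X²)` -/
lemma rough_measure (hEH : HasLevelOfDistribution 1) :
    ∃ s1 : ℕ, ∀ K : ℕ, ∃ z0 : ℕ, ∀ z, z0 ≤ z → ∀ X : ℕ, z^s1 ≤ X → X ≤ z^K →
      (1/4) * (Vp z * Real.log X) ≤
        ∑ r ∈ (Finset.Ico X (X^2)).filter (fun r => Squarefree r ∧ Rough z r), 1/(Nat.totient r : ℝ) ∧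
      ∑ r ∈ (Finset.Ico X (X^2)).filter (fun r => Squarefree r ∧ Rough z r), 1/(Nat.totient r : ℝ)
        ≤ 5 * (Vp z * Real.log X) := by
  obtain ⟨s, hFL⟩ := FL hEH 1 (by norm_num)
  obtain ⟨c, hc, hV⟩ := Vp_lower hEH
  refine ⟨s+1, fun K => ?_⟩
  obtain ⟨z1, hz1⟩ := log_le_small (c/24) (by positivity)
  refine ⟨max z1 (4*K + 8), fun z hz X hX1 hX2 => ?_⟩
  have hzz1 : z1 ≤ z := (le_max_left _ _).trans hz
  have hzK : 4*K+8 ≤ z := (le_max_right _ _).trans hz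
  have hz2 : 2 ≤ z := by omega
  have hzpos : (0:ℝ) < z := by exact_mod_cast (by omega : 0 < z)
  have hlz : 1 ≤ Real.log z := by
    rw [Real.le_log_iff_exp_le hzpos]
    have : (8:ℝ) ≤ z := by exact_mod_cast (by omega : 8 ≤ z)
    linarith [Real.exp_one_lt_d9]
  have hXz : z ≤ X := by
    calc z = z^1 := (pow_one z).symm
      _ ≤ z^(s+1) := Nat.pow_le_pow_right (by omega) (by omega)
      _ ≤ X := hX1
  have hXpos : (0:ℝ) < X := by exact_mod_cast (by omega : 0 < X)
  have hlX : Real.log z ≤ Real.log X := Real.log_le_log hzpos (by exact_mod_cast hXz)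
  have hVlog : c / Real.log z ≤ Vp z := hV z hz2
  have hVX : 0 < Vp z := lt_of_lt_of_le (by positivity) hVlog
  set VX := Vp z * Real.log X with hVXdef
  have hsmall : 3 * Real.log X / z ≤ (1/8) * VX := by
    have h1 := hz1 z hzz1
    have h2 : 3 / (z:ℝ) ≤ (1/8) * (c / Real.log z) := by
      rw [div_le_iff₀ hzpos]
      have : (1/8) * (c / Real.log z) * z = (c/24 * z) * 3 / Real.log z := by field_simp; ring
      rw [this, le_div_iff₀ (by linarith)]
      linarith
    calc 3 * Real.log X / z = 3/z * Real.log X := by ring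
      _ ≤ ((1/8) * Vp z) * Real.log X := by
        apply mul_le_mul_of_nonneg_right _ (by linarith)
        linarith
      _ = _ := by rw [hVXdef]; ring
  obtain ⟨lp, lm, hok, hg⟩ := hFL z (by omega) (prs z) (subset_refl _)
  have hgp := hg (fun p => 1/(p:ℝ)) (fun p hp => by
    have h2 := (mem_prs.1 hp).2.two_le
    have : (2:ℝ) ≤ p := by exact_mod_cast h2
    refine ⟨by positivity, le_refl _, ?_⟩
    exact one_div_le_one_div_of_le (by norm_num) this)
  have hPp : ∀ p ∈ prs z, p.Prime := fun p hp => (mem_prs.1 hp).2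
  have hLX : z^s ≤ X := (Nat.pow_le_pow_right (by omega) (by omega)).trans hX1
  have hp := sieve_harm (prs z) hPp (z^s) X (by omega) hLX lp hok.abs_p hok.supp_p
  have hm := sieve_harm (prs z) hPp (z^s) X (by omega) hLX lm hok.abs_m hok.supp_m
  have herr : 2 * ((z^s : ℕ):ℝ) / X ≤ (1/8) * VX := by
    have h1 : ((z^s : ℕ):ℝ) * z ≤ X := by exact_mod_cast (by rw [← pow_succ]; exact hX1 : z^s * z ≤ X)
    refine le_trans ?_ hsmall
    rw [div_le_div_iff₀ hXpos hzpos]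
    nlinarith
  set A := ∑ n ∈ Finset.Ico X (X^2), (if Rough z n then 1 else 0) * (1/(n:ℝ)) with hA
  have hAu : A ≤ (2 + 1/8) * VX := by
    have h1 : A ≤ ∑ n ∈ Finset.Ico X (X^2), (∑ S ∈ ((prs z).filter (fun p => p ∣ n)).powerset, lp S) * (1/(n:ℝ)) := by
      apply Finset.sum_le_sum
      intro n _
      apply mul_le_mul_of_nonneg_right _ (by positivity)
      have := hok.upper ((prs z).filter (fun p => p ∣ n)) (Finset.filter_subset _ _)
      simpa only [rough_iff] using this
    have h2 := (abs_le.1 hp).2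
    have h3 : (∑ S ∈ (prs z).powerset, lp S * ∏ p ∈ S, (1/(p:ℝ))) * Real.log X ≤ 2 * VX := by
      calc _ ≤ (2 * Vp z) * Real.log X := mul_le_mul_of_nonneg_right hgp.1 (by linarith)
        _ = _ := by rw [hVXdef]; ring
    linarith
  have hAl : (1/2 - 1/8) * VX ≤ A := by
    have h1 : ∑ n ∈ Finset.Ico X (X^2), (∑ S ∈ ((prs z).filter (fun p => p ∣ n)).powerset, lm S) * (1/(n:ℝ)) ≤ A := by
      apply Finset.sum_le_sum
      intro n _
      apply mul_le_mul_of_nonneg_right _ (by positivity)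
      have := hok.lower ((prs z).filter (fun p => p ∣ n)) (Finset.filter_subset _ _)
      simpa only [rough_iff] using this
    have h2 := (abs_le.1 hm).1
    have h3 : (1/2) * VX ≤ (∑ S ∈ (prs z).powerset, lm S * ∏ p ∈ S, (1/(p:ℝ))) * Real.log X := by
      calc (1/2) * VX = ((1/2) * Vp z) * Real.log X := by rw [hVXdef]; ring
        _ ≤ _ := mul_le_mul_of_nonneg_right hgp.2 (by linarith)
    linarith
  have hA' : A = ∑ n ∈ (Finset.Ico X (X^2)).filter (fun r => Rough z r), 1/(n:ℝ) := by
    rw [hA, Finset.sum_filter]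
    apply Finset.sum_congr rfl
    intro n _
    split_ifs <;> simp
  have hsplit : A = ∑ n ∈ (Finset.Ico X (X^2)).filter (fun r => Squarefree r ∧ Rough z r), 1/(n:ℝ)
      + ∑ n ∈ (Finset.Ico X (X^2)).filter (fun r => ¬ Squarefree r ∧ Rough z r), 1/(n:ℝ) := by
    rw [hA', ← Finset.sum_union]
    · apply Finset.sum_congr _ (fun _ _ => rfl)
      ext n
      simp only [Finset.mem_filter, Finset.mem_union]
      tauto
    · rw [Finset.disjoint_left]
      intro n hn
      simp only [Finset.mem_filter] at hn ⊢
      tauto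
  have hns : ∑ n ∈ (Finset.Ico X (X^2)).filter (fun r => ¬ Squarefree r ∧ Rough z r), 1/(n:ℝ) ≤ (1/8) * VX := by
    have h1 := nonsq_sum z (X^2) (by omega) (Nat.one_le_pow _ _ (by omega))
    have h2 : ∑ n ∈ (Finset.Ico X (X^2)).filter (fun r => ¬ Squarefree r ∧ Rough z r), 1/(n:ℝ) ≤
      ∑ n ∈ (Finset.Ico 1 (X^2)).filter (fun n => ¬ Squarefree n ∧ Rough z n), 1/(n:ℝ) := by
      apply Finset.sum_le_sum_of_subset_of_nonneg
      · apply Finset.filter_subset_filter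
        apply Finset.Ico_subset_Ico_left; omega
      · intro _ _ _; positivity
    refine h2.trans (h1.trans (le_trans ?_ hsmall))
    push_cast
    rw [Real.log_pow, mul_comm, mul_one_div]
    apply div_le_div_of_nonneg_right _ hzpos.le
    push_cast; linarith
  have hns0 : 0 ≤ ∑ n ∈ (Finset.Ico X (X^2)).filter (fun r => ¬ Squarefree r ∧ Rough z r), 1/(n:ℝ) :=
    Finset.sum_nonneg fun _ _ => by positivity
  have hphi : ∀ r ∈ (Finset.Ico X (X^2)).filter (fun r => Squarefree r ∧ Rough z r),
      1/(r:ℝ) ≤ 1/(Nat.totient r : ℝ) ∧ 1/(Nat.totient r : ℝ) ≤ 2 * (1/(r:ℝ)) := by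
    intro r hr
    rw [Finset.mem_filter, Finset.mem_Ico] at hr
    have hr0 : 0 < r := by omega
    have hr0' : (0:ℝ) < r := by exact_mod_cast hr0
    have hφ0 : (0:ℝ) < Nat.totient r := by exact_mod_cast Nat.totient_pos.2 hr0
    have h1 := rough_phi (K := 2*K) hz2 hr.2.2 hr0.ne' (by
      calc r ≤ X^2 := hr.1.2.le
        _ ≤ (z^K)^2 := Nat.pow_le_pow_left hX2 2
        _ = z^(2*K) := by rw [← pow_mul]; ring_nf)
    have h2 : ((2*K : ℕ):ℝ)/z ≤ 1/2 := by
      rw [div_le_iff₀ hzpos]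
      have : ((4*K+8 : ℕ):ℝ) ≤ z := by exact_mod_cast hzK
      push_cast at this ⊢; linarith
    constructor
    · apply one_div_le_one_div_of_le hφ0
      exact_mod_cast Nat.totient_le r
    · rw [mul_one_div, div_le_div_iff₀ hφ0 hr0']
      nlinarith
  constructor
  · calc (1/4) * VX ≤ ∑ n ∈ (Finset.Ico X (X^2)).filter (fun r => Squarefree r ∧ Rough z r), 1/(n:ℝ) := by linarith
      _ ≤ _ := Finset.sum_le_sum fun r hr => (hphi r hr).1
  · have hVX0 : 0 ≤ VX := by rw [hVXdef]; exact mul_nonneg hVX.le (by linarith)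
    calc _ ≤ ∑ n ∈ (Finset.Ico X (X^2)).filter (fun r => Squarefree r ∧ Rough z r), 2 * (1/(n:ℝ)) :=
          Finset.sum_le_sum fun r hr => (hphi r hr).2
      _ = 2 * ∑ n ∈ (Finset.Ico X (X^2)).filter (fun r => Squarefree r ∧ Rough z r), 1/(n:ℝ) := by rw [Finset.mul_sum]
      _ ≤ 5 * VX := by linarith

/-- rough squarefree numbers up to R -/
noncomputable def Qs (z R : ℕ) : Finset ℕ := (Finset.Icc 1 R).filter (fun r => Squarefree r ∧ Rough z r)

lemma Qs_dc (z R : ℕ) : ∀ d ∈ Qs z R, ∀ r, r ∣ d → r ∈ Qs z R := by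
  intro d hd r hr
  simp only [Qs, Finset.mem_filter, Finset.mem_Icc] at hd ⊢
  obtain ⟨⟨h1, h2⟩, h3, h4⟩ := hd
  refine ⟨⟨Nat.pos_of_dvd_of_pos hr h1, (Nat.le_of_dvd h1 hr).trans h2⟩, h3.squarefree_of_dvd hr, ?_⟩
  intro p hp hpr
  exact h4 p hp (hpr.trans hr)

lemma Qs_sq (z R : ℕ) : ∀ d ∈ Qs z R, Squarefree d := by
  intro d hd
  simp only [Qs, Finset.mem_filter] at hd
  exact hd.2.1

noncomputable def gw (u A J : ℕ) (r : ℕ) : ℝ :=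
  ∑ j ∈ Finset.range J, if u^(A*2^j) ≤ r ∧ r < u^(A*2^(j+1)) then (1/2:ℝ)^j else 0

lemma gw_pow (u A J : ℕ) (hu : 2 ≤ u) (hA : 1 ≤ A) (r : ℕ) :
    gw u A J r ^ 2 = ∑ j ∈ Finset.range J, if u^(A*2^j) ≤ r ∧ r < u^(A*2^(j+1)) then ((1/2:ℝ)^j)^2 else 0 := by
  have hmono : ∀ i j : ℕ, i < j → u^(A*2^(i+1)) ≤ u^(A*2^j) := by
    intro i j hij
    apply Nat.pow_le_pow_right (by omega)
    apply Nat.mul_le_mul_left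
    exact Nat.pow_le_pow_right (by norm_num) hij
  have huniq : ∀ i j : ℕ, (u^(A*2^i) ≤ r ∧ r < u^(A*2^(i+1))) → (u^(A*2^j) ≤ r ∧ r < u^(A*2^(j+1))) → i = j := by
    intro i j hi hj
    rcases lt_trichotomy i j with h | h | h
    · have := hmono i j h; omega
    · exact h
    · have := hmono j i h; omega
  unfold gw
  by_cases h : ∃ j ∈ Finset.range J, u^(A*2^j) ≤ r ∧ r < u^(A*2^(j+1))
  · obtain ⟨j, hj, h⟩ := h
    rw [Finset.sum_eq_single j, Finset.sum_eq_single j]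
    · simp [h]
    · intro i _ hij
      rw [if_neg]
      intro h'
      exact hij (huniq i j h' h)
    · intro h'; exact absurd hj h'
    · intro i _ hij
      rw [if_neg]
      intro h'
      exact hij (huniq i j h' h)
    · intro h'; exact absurd hj h'
  · push Not at h
    rw [Finset.sum_eq_zero, Finset.sum_eq_zero]
    · norm_num
    · intro j hj
      rw [if_neg]
      rintro ⟨h1, h2⟩
      exact absurd h2 (not_lt.2 (h j hj h1))
    · intro j hj
      rw [if_neg]
      rintro ⟨h1, h2⟩
      exact absurd h2 (not_lt.2 (h j hj h1))

lemma gw_nonneg (u A J r : ℕ) : 0 ≤ gw u A J r := by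
  unfold gw
  apply Finset.sum_nonneg
  intro j _
  split_ifs <;> positivity

lemma gw_le (u A J r : ℕ) (hu : 2 ≤ u) (hA : 1 ≤ A) : gw u A J r ≤ 2 := by
  unfold gw
  calc _ ≤ ∑ j ∈ Finset.range J, (1/2:ℝ)^j := by
        apply Finset.sum_le_sum
        intro j _
        split_ifs
        · exact le_rfl
        · positivity
    _ ≤ 2 := by
        have := sum_geometric_two_le J
        simpa using this

lemma gw_supp (u A J r : ℕ) (hu : 2 ≤ u) (h : gw u A J r ≠ 0) : r ≤ u^(A*2^J) := by
  unfold gw at h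
  obtain ⟨j, hj, hne⟩ := Finset.exists_ne_zero_of_sum_ne_zero h
  rw [Finset.mem_range] at hj
  have h2 : u^(A*2^j) ≤ r ∧ r < u^(A*2^(j+1)) := by
    by_contra hc
    rw [if_neg hc] at hne
    exact hne rfl
  refine h2.2.le.trans ?_
  apply Nat.pow_le_pow_right (by omega)
  apply Nat.mul_le_mul_left
  exact Nat.pow_le_pow_right (by norm_num) hj

noncomputable def blk (u A j : ℕ) : Finset ℕ :=
  (Finset.Ico (u^(A*2^j)) ((u^(A*2^j))^2)).filter (fun r => Squarefree r ∧ Rough u r)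

lemma blk_sum (u A J R : ℕ) (hu : 2 ≤ u) (hR : u^(A*2^J) ≤ R) (c : ℕ → ℝ) (F : ℕ → ℝ) :
    ∑ r ∈ Qs u R, (∑ j ∈ Finset.range J, if u^(A*2^j) ≤ r ∧ r < u^(A*2^(j+1)) then c j else 0) * F r
    = ∑ j ∈ Finset.range J, c j * ∑ r ∈ blk u A j, F r := by
  simp_rw [Finset.sum_mul]
  rw [Finset.sum_comm]
  apply Finset.sum_congr rfl
  intro j hj
  rw [Finset.mem_range] at hj
  rw [Finset.mul_sum]
  simp_rw [ite_mul, zero_mul]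
  rw [← Finset.sum_filter]
  apply Finset.sum_congr _ (fun _ _ => rfl)
  ext r
  simp only [Qs, blk, Finset.mem_filter, Finset.mem_Icc, Finset.mem_Ico, ← pow_mul]
  have e : A * 2^j * 2 = A * 2^(j+1) := by ring
  rw [e]
  have h1 : u^(A*2^(j+1)) ≤ u^(A*2^J) := by
    apply Nat.pow_le_pow_right (by omega)
    apply Nat.mul_le_mul_left
    exact Nat.pow_le_pow_right (by norm_num) hj
  have h2 : 1 ≤ u^(A*2^j) := Nat.one_le_pow _ _ (by omega)
  constructor
  · rintro ⟨⟨_, h⟩, h'⟩; exact ⟨h', h⟩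
  · rintro ⟨h', h⟩; exact ⟨⟨⟨by omega, by omega⟩, h⟩, h'⟩

lemma Vp_pos (z : ℕ) : 0 < Vp z := by
  unfold Vp
  apply Finset.prod_pos
  intro p hp
  have := (mem_prs.1 hp).2.two_le
  have h : (1:ℝ) < p := by exact_mod_cast this
  have : 1/(p:ℝ) < 1 := by rw [div_lt_one (by linarith)]; exact h
  linarith

lemma opt_weights (hEH : HasLevelOfDistribution 1) : ∃ s1 : ℕ, ∀ J : ℕ, 13107200 ≤ J → ∀ A : ℕ, s1 ≤ A → 1 ≤ A →
    ∃ z0 : ℕ, ∀ u : ℕ, z0 ≤ u →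
      512 * ((160*2^J*J*A : ℕ):ℝ) * Real.log u * Vp u * (∑ r ∈ Qs u (u^(160*2^J*J*A)), gw u A J r ^ 2 / (Nat.totient r : ℝ))
        ≤ (2:ℝ)^J * (∑ r ∈ Qs u (u^(160*2^J*J*A)), gw u A J r / (Nat.totient r : ℝ))^2 ∧
      (1/4) * Vp u * A * Real.log u ≤ (∑ r ∈ Qs u (u^(160*2^J*J*A)), gw u A J r ^ 2 / (Nat.totient r : ℝ)) ∧
      (∑ r ∈ Qs u (u^(160*2^J*J*A)), gw u A J r ^ 2 / (Nat.totient r : ℝ)) ≤ 10 * Vp u * A * Real.log u ∧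
      ∀ m : Fin (2^J), (1/2) * (∑ r ∈ Qs u (u^(160*2^J*J*A)), gw u A J r / (Nat.totient r : ℝ))^2 *
        (∑ r ∈ Qs u (u^(160*2^J*J*A)), gw u A J r ^ 2 / (Nat.totient r : ℝ))^(2^J-1) ≤
        ∑ d ∈ Fintype.piFinset (Qm (Qs u (u^(160*2^J*J*A))) m), ∑ e ∈ Fintype.piFinset (Qm (Qs u (u^(160*2^J*J*A))) m),
          lamb (Qs u (u^(160*2^J*J*A))) (Yw (u^(160*2^J*J*A)) (gw u A J)) d *
          lamb (Qs u (u^(160*2^J*J*A))) (Yw (u^(160*2^J*J*A)) (gw u A J)) e / ∏ i, (Nat.lcm (d i) (e i) : ℝ) := by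
  obtain ⟨s1, hs1⟩ := rough_measure hEH
  refine ⟨s1, ?_⟩
  intro J hJ A hA hA1
  obtain ⟨z0, hz0⟩ := hs1 (A*2^J)
  refine ⟨max z0 2, ?_⟩
  intro u hu
  have hu2 : 2 ≤ u := le_trans (le_max_right _ _) hu
  have hu0 : z0 ≤ u := le_trans (le_max_left _ _) hu
  set K := 160*2^J*J*A with hK
  set R := u^K with hRdef
  have hXR0 : A*2^J ≤ 80*2^J*J*A := by nlinarith [Nat.one_le_two_pow (n := J), Nat.mul_le_mul (Nat.le_refl (A*2^J)) (show 1 ≤ 80*J by omega)]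
  have hXR : u^(A*2^J) ≤ R := Nat.pow_le_pow_right (by omega) (by rw [hK]; linarith)
  set V := Vp u with hV
  have hVpos : 0 < V := Vp_pos u
  have hlu : 0 < Real.log u := Real.log_pos (by exact_mod_cast hu2)
  set l := (A:ℝ) * Real.log u with hl
  have hApos : (0:ℝ) < A := by exact_mod_cast hA1
  have hlpos : 0 < l := mul_pos hApos hlu
  -- blocks
  have hblk : ∀ j ∈ Finset.range J, (1/4)*(V*(2^j*l)) ≤ ∑ r ∈ blk u A j, 1/(Nat.totient r:ℝ) ∧
      ∑ r ∈ blk u A j, 1/(Nat.totient r:ℝ) ≤ 5*(V*(2^j*l)) := by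
    intro j hj
    rw [Finset.mem_range] at hj
    have h := hz0 u hu0 (u^(A*2^j)) (Nat.pow_le_pow_right (by omega) (by nlinarith [Nat.one_le_two_pow (n := j)]))
      (Nat.pow_le_pow_right (by omega) (Nat.mul_le_mul_left _ (Nat.pow_le_pow_right (by norm_num) hj.le)))
    have e : Real.log ((u^(A*2^j) : ℕ):ℝ) = 2^j*l := by
      push_cast
      rw [Real.log_pow, hl]; push_cast; ring
    rw [e] at h
    exact h
  have hG1e : ∑ r ∈ Qs u R, gw u A J r / (Nat.totient r : ℝ) = ∑ j ∈ Finset.range J, (1/2:ℝ)^j * ∑ r ∈ blk u A j, 1/(Nat.totient r:ℝ) := by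
    rw [← blk_sum u A J R hu2 hXR]
    apply Finset.sum_congr rfl
    intro r _
    rw [gw, mul_one_div]
  have hG2e : ∑ r ∈ Qs u R, gw u A J r ^ 2 / (Nat.totient r : ℝ) = ∑ j ∈ Finset.range J, ((1/2:ℝ)^j)^2 * ∑ r ∈ blk u A j, 1/(Nat.totient r:ℝ) := by
    rw [← blk_sum u A J R hu2 hXR (fun j => ((1/2:ℝ)^j)^2)]
    apply Finset.sum_congr rfl
    intro r _
    rw [gw_pow u A J hu2 hA1, mul_one_div]
  have hG3e : ∑ r ∈ Qs u R, gw u A J r ^ 2 / (Nat.totient r : ℝ) * Real.log r = ∑ j ∈ Finset.range J, ((1/2:ℝ)^j)^2 * ∑ r ∈ blk u A j, 1/(Nat.totient r:ℝ) * Real.log r := by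
    rw [← blk_sum u A J R hu2 hXR (fun j => ((1/2:ℝ)^j)^2)]
    apply Finset.sum_congr rfl
    intro r _
    rw [gw_pow u A J hu2 hA1, ← mul_assoc, mul_one_div]
  have hhalf : ∀ j : ℕ, (1/2:ℝ)^j * 2^j = 1 := by
    intro j; rw [← mul_pow]; norm_num
  set G1 := ∑ r ∈ Qs u R, gw u A J r / (Nat.totient r : ℝ) with hG1
  set G2 := ∑ r ∈ Qs u R, gw u A J r ^ 2 / (Nat.totient r : ℝ) with hG2
  have hJpos : (0:ℝ) < J := by exact_mod_cast (by omega : 0 < J)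
  have hG1lo : (1/4)*V*l*J ≤ G1 := by
    rw [hG1e]
    calc (1/4)*V*l*J = ∑ j ∈ Finset.range J, (1/4)*V*l := by simp; ring
      _ ≤ _ := by
        apply Finset.sum_le_sum
        intro j hj
        have := mul_le_mul_of_nonneg_left (hblk j hj).1 (show (0:ℝ) ≤ (1/2)^j by positivity)
        have e := hhalf j
        calc 1/4*V*l = 1/4*V*l*((1/2:ℝ)^j * 2^j) := by rw [e, mul_one]
          _ = (1/2:ℝ)^j*((1/4)*(V*(2^j*l))) := by ring
          _ ≤ _ := this
  have hG2lo : (1/4)*V*l ≤ G2 := by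
    rw [hG2e]
    have h0 : 0 ∈ Finset.range J := by simp; omega
    calc _ ≤ ((1/2:ℝ)^0)^2 * ∑ r ∈ blk u A 0, 1/(Nat.totient r:ℝ) := by
          have := (hblk 0 h0).1
          simp only [pow_zero, one_pow, one_mul] at this ⊢
          linarith
      _ ≤ _ := by
        apply Finset.single_le_sum (f := fun j => ((1/2:ℝ)^j)^2 * ∑ r ∈ blk u A j, 1/(Nat.totient r:ℝ)) _ h0
        intro j _
        apply mul_nonneg (by positivity)
        exact Finset.sum_nonneg fun r _ => by positivity
  have hG2hi : G2 ≤ 10*V*l := by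
    rw [hG2e]
    calc _ ≤ ∑ j ∈ Finset.range J, (1/2:ℝ)^j * (5*V*l) := by
          apply Finset.sum_le_sum
          intro j hj
          have := mul_le_mul_of_nonneg_left (hblk j hj).2 (show (0:ℝ) ≤ ((1/2)^j)^2 by positivity)
          refine this.trans (le_of_eq ?_)
          have e := hhalf j
          calc ((1/2:ℝ)^j)^2 * (5*(V*(2^j*l))) = (1/2:ℝ)^j * ((1/2:ℝ)^j * 2^j) * (5*V*l) := by ring
            _ = _ := by rw [e, mul_one]
      _ = (∑ j ∈ Finset.range J, (1/2:ℝ)^j) * (5*V*l) := by rw [Finset.sum_mul]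
      _ ≤ 2 * (5*V*l) := by
          apply mul_le_mul_of_nonneg_right (sum_geometric_two_le J) (by positivity)
      _ = 10*V*l := by ring
  have hG3 : ∑ r ∈ Qs u R, gw u A J r ^ 2 / (Nat.totient r : ℝ) * Real.log r ≤ 10*V*l^2*J := by
    rw [hG3e]
    calc _ ≤ ∑ j ∈ Finset.range J, 10*V*l^2 := by
          apply Finset.sum_le_sum
          intro j hj
          have h1 : ∑ r ∈ blk u A j, 1/(Nat.totient r:ℝ) * Real.log r ≤ (∑ r ∈ blk u A j, 1/(Nat.totient r:ℝ)) * (2^j*l*2) := by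
            rw [Finset.sum_mul]
            apply Finset.sum_le_sum
            intro r hr
            apply mul_le_mul_of_nonneg_left _ (by positivity)
            simp only [blk, Finset.mem_filter, Finset.mem_Ico] at hr
            have hr0 : 0 < r := by
              have : 1 ≤ u^(A*2^j) := Nat.one_le_pow _ _ (by omega)
              omega
            calc Real.log r ≤ Real.log (((u^(A*2^j))^2 : ℕ):ℝ) := Real.log_le_log (by exact_mod_cast hr0) (by exact_mod_cast hr.1.2.le)
              _ = _ := by push_cast; rw [← pow_mul, Real.log_pow, hl]; push_cast; ring
          have h2 := mul_le_mul_of_nonneg_right (hblk j hj).2 (show (0:ℝ) ≤ 2^j*l*2 by positivity)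
          have h3 := mul_le_mul_of_nonneg_left (h1.trans h2) (show (0:ℝ) ≤ ((1/2)^j)^2 by positivity)
          refine h3.trans (le_of_eq ?_)
          have e := hhalf j
          calc ((1/2:ℝ)^j)^2 * (5*(V*(2^j*l))*(2^j*l*2)) = ((1/2:ℝ)^j * 2^j)^2 * (10*V*l^2) := by ring
            _ = _ := by rw [e]; ring
      _ = _ := by simp; ring
  refine ⟨?_, by rw [hl] at hG2lo; linarith, by rw [hl] at hG2hi; linarith, ?_⟩
  · have hG1sq : ((1/4)*V*l*J)^2 ≤ G1^2 := by
      apply pow_le_pow_left₀ (by positivity) hG1lo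
    have hJr : (13107200:ℝ) ≤ J := by exact_mod_cast hJ
    have hKr : (K:ℝ) = 160 * 2^J * J * A := by rw [hK]; push_cast; ring
    calc 512*(K:ℝ)*Real.log u*V*G2 ≤ 512*(K:ℝ)*Real.log u*V*(10*V*l) := by
          apply mul_le_mul_of_nonneg_left hG2hi (by positivity)
      _ = 2^J*(V^2*l^2*J/16)*13107200 := by rw [hKr, hl]; ring
      _ ≤ 2^J*(V^2*l^2*J/16)*J := by apply mul_le_mul_of_nonneg_left hJr (by positivity)
      _ = 2^J*((1/4)*V*l*J)^2 := by ring
      _ ≤ _ := by apply mul_le_mul_of_nonneg_left hG1sq (by positivity)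
  · intro m
    apply S2_bound (Qs u R) (Qs_dc u R) (Qs_sq u R) R (u^(80*2^J*J*A)) (u^(A*2^J)) ?_ (gw u A J) (gw_nonneg u A J)
      (gw_supp u A J · hu2) (40*J*l) ?_ ?_ ?_ (by positivity) m
    · rw [← pow_add]
      exact Nat.pow_le_pow_right (by omega) (by rw [hK]; linarith)
    · have : 80*2^J*J*A ≠ 0 := by positivity
      calc 2 ≤ u := hu2
        _ ≤ _ := Nat.le_self_pow this u
    · push_cast
      rw [Real.log_pow, hl]
      push_cast
      apply le_of_eq; ring
    · refine hG3.trans ?_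
      calc 10*V*l^2*J = 40*J*l*((1/4)*V*l) := by ring
        _ ≤ _ := by apply mul_le_mul_of_nonneg_left hG2lo (by positivity)

lemma Qphi_sum (hEH : HasLevelOfDistribution 1) (K : ℕ) : ∃ C : ℝ, 0 < C ∧ ∀ z : ℕ, 2 ≤ z →
    ∑ s ∈ Qs z (z^K), 1/(Nat.totient s:ℝ) ≤ C := by
  obtain ⟨C, hC, hm⟩ := mertens2 hEH
  refine ⟨Real.exp (2*(Real.log (K+1) + 2*C)), Real.exp_pos _, ?_⟩
  intro z hz
  set P := (prs (z^(K+1))).filter (fun p => z < p) with hP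
  have hz1 : 1 ≤ z := by omega
  have hPp : ∀ p ∈ P, p.Prime := fun p hp => (mem_prs.1 (Finset.mem_filter.1 hp).1).2
  have h1 : ∑ s ∈ Qs z (z^K), 1/(Nat.totient s:ℝ) ≤ ∑ S ∈ P.powerset, ∏ p ∈ S, 1/((p:ℝ)-1) := by
    have hinj : Set.InjOn Nat.primeFactors (Qs z (z^K) : Set ℕ) := by
      intro a ha b hb hab
      have ha' := Qs_sq _ _ a ha
      have hb' := Qs_sq _ _ b hb
      rw [← Nat.prod_primeFactors_of_squarefree ha', ← Nat.prod_primeFactors_of_squarefree hb', hab]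
    have hval : ∀ s ∈ Qs z (z^K), 1/(Nat.totient s:ℝ) = ∏ p ∈ s.primeFactors, 1/((p:ℝ)-1) := by
      intro s hs
      have hsq := Qs_sq _ _ s hs
      rw [Finset.prod_div_distrib, Finset.prod_const_one]
      congr 1
      have h := Nat.totient_eq_prod_factorization hsq.ne_zero
      rw [h, Finsupp.prod]
      push_cast
      rw [Nat.support_factorization]
      apply Finset.prod_congr rfl
      intro p hp
      have hpp := Nat.prime_of_mem_primeFactors hp
      have hfac : s.factorization p = 1 := by
        have h1 := hsq.natFactorization_le_one p
        have h2 := (hpp.dvd_iff_one_le_factorization hsq.ne_zero).1 (Nat.dvd_of_mem_primeFactors hp)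
        omega
      rw [hfac]
      simp [Nat.cast_sub hpp.one_le]
    rw [Finset.sum_congr rfl hval, ← Finset.sum_image (f := fun S : Finset ℕ => ∏ p ∈ S, 1/((p:ℝ)-1)) hinj]
    apply Finset.sum_le_sum_of_subset_of_nonneg
    · intro S hS
      rw [Finset.mem_image] at hS
      obtain ⟨s, hs, rfl⟩ := hS
      rw [Finset.mem_powerset]
      intro p hp
      have hpp := Nat.prime_of_mem_primeFactors hp
      have hpd := Nat.dvd_of_mem_primeFactors hp
      simp only [Qs, Finset.mem_filter, Finset.mem_Icc] at hs
      rw [hP, Finset.mem_filter, mem_prs]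
      refine ⟨⟨?_, hpp⟩, hs.2.2 p hpp hpd⟩
      exact (Nat.le_of_dvd (by omega) hpd).trans (hs.1.2.trans (Nat.pow_le_pow_right hz1 (by omega)))
    · intro S hS _
      rw [Finset.mem_powerset] at hS
      apply Finset.prod_nonneg
      intro p hp
      have : (1:ℝ) ≤ p := by exact_mod_cast (hPp p (hS hp)).one_le
      apply div_nonneg (by norm_num); linarith
  refine h1.trans ?_
  rw [← Finset.prod_one_add]
  have h2 : ∏ p ∈ P, (1 + 1/((p:ℝ)-1)) ≤ ∏ p ∈ P, Real.exp (2*(1/(p:ℝ))) := by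
    apply Finset.prod_le_prod
    · intro p hp
      have : (1:ℝ) ≤ p := by exact_mod_cast (hPp p hp).one_le
      have : 0 ≤ 1/((p:ℝ)-1) := by apply div_nonneg (by norm_num); linarith
      linarith
    · intro p hp
      have h2 : (2:ℝ) ≤ p := by exact_mod_cast (hPp p hp).two_le
      have h3 : 1/((p:ℝ)-1) ≤ 2*(1/(p:ℝ)) := by
        rw [mul_one_div, div_le_div_iff₀ (by linarith) (by linarith)]; linarith
      have := Real.add_one_le_exp (2*(1/(p:ℝ)))
      linarith
  refine h2.trans ?_
  rw [← Real.exp_sum, ← Finset.mul_sum]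
  apply Real.exp_le_exp.2
  apply mul_le_mul_of_nonneg_left _ (by norm_num)
  have hzK : z ≤ z^(K+1) := Nat.le_self_pow (by omega) z
  have hsplit : ∑ p ∈ P, 1/(p:ℝ) = ∑ p ∈ prs (z^(K+1)), 1/(p:ℝ) - ∑ p ∈ prs z, 1/(p:ℝ) := by
    rw [eq_sub_iff_add_eq, ← Finset.sum_filter_add_sum_filter_not (prs (z^(K+1))) (fun p => z < p)]
    congr 1
    apply Finset.sum_congr _ (fun _ _ => rfl)
    ext p
    simp only [Finset.mem_filter, mem_prs]
    constructor
    · rintro ⟨h, h'⟩; exact ⟨⟨h.trans hzK, h'⟩, by omega⟩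
    · rintro ⟨⟨_, h'⟩, h⟩; exact ⟨by omega, h'⟩
  rw [hsplit]
  have e1 := abs_le.1 (hm (z^(K+1)) (hz.trans hzK))
  have e2 := abs_le.1 (hm z hz)
  have hlz : 0 < Real.log z := Real.log_pos (by exact_mod_cast hz)
  have e3 : Real.log (Real.log ((z^(K+1):ℕ):ℝ)) = Real.log (K+1) + Real.log (Real.log z) := by
    push_cast
    rw [Real.log_pow, Real.log_mul (by positivity) hlz.ne']
    push_cast; ring
  rw [e3] at e1
  linarith [e1.2, e2.1]

lemma Qphi_mult (z R d : ℕ) (hd : d ∈ Qs z R) :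
    ∑ t ∈ (Qs z R).filter (fun t => d ∣ t), 1/(Nat.totient t:ℝ) ≤ 1/(Nat.totient d:ℝ) * ∑ s ∈ Qs z R, 1/(Nat.totient s:ℝ) := by
  rw [Finset.mul_sum]
  have hd0 : 0 < d := Nat.pos_of_ne_zero (Qs_sq _ _ d hd).ne_zero
  have hinj : Set.InjOn (fun t => t / d) ((Qs z R).filter (fun t => d ∣ t) : Set ℕ) := by
    intro a ha b hb hab
    simp only [Finset.coe_filter, Set.mem_ofPred_eq] at ha hb
    simp only at hab
    rw [← Nat.mul_div_cancel' ha.2, ← Nat.mul_div_cancel' hb.2, hab]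
  have hval : ∀ t ∈ (Qs z R).filter (fun t => d ∣ t), 1/(Nat.totient t:ℝ) = 1/(Nat.totient d:ℝ) * (1/(Nat.totient (t/d):ℝ)) := by
    intro t ht
    rw [Finset.mem_filter] at ht
    obtain ⟨c, rfl⟩ := ht.2
    rw [Nat.mul_div_cancel_left _ hd0]
    have hcop := Nat.coprime_of_squarefree_mul (Qs_sq _ _ _ ht.1)
    rw [Nat.totient_mul hcop]
    push_cast
    rw [one_div_mul_one_div]
  rw [Finset.sum_congr rfl hval, ← Finset.sum_image (f := fun s : ℕ => 1/(Nat.totient d:ℝ) * (1/(Nat.totient s:ℝ))) hinj]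
  apply Finset.sum_le_sum_of_subset_of_nonneg
  · intro s hs
    rw [Finset.mem_image] at hs
    obtain ⟨t, ht, rfl⟩ := hs
    rw [Finset.mem_filter] at ht
    exact Qs_dc _ _ t ht.1 _ (Nat.div_dvd_of_dvd ht.2)
  · intro s _ _
    positivity

lemma lamb_supp {k : ℕ} (z R R' : ℕ) (g : ℕ → ℝ) (d : Fin k → ℕ) 
    (h : lamb (Qs z R') (Yw R g) d ≠ 0) : ∏ i, d i ≤ R := by
  unfold lamb at h
  have h2 := right_ne_zero_of_mul h
  obtain ⟨t, ht, hne⟩ := Finset.exists_ne_zero_of_sum_ne_zero h2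
  rw [Fintype.mem_piFinset] at ht
  have hdt : ∀ i, d i ∣ t i := by
    by_contra hc; rw [if_neg hc] at hne; exact hne rfl
  rw [if_pos hdt, Yw] at hne
  have hR : ∏ i, t i ≤ R := by
    by_contra hc; rw [if_neg hc] at hne; exact hne rfl
  refine le_trans (Finset.prod_le_prod' fun i _ => Nat.le_of_dvd (Nat.pos_of_ne_zero (Qs_sq _ _ _ (ht i)).ne_zero) (hdt i)) hR

lemma lamb_abs_le (hEH : HasLevelOfDistribution 1) (K k : ℕ) : ∃ Λ : ℝ, 0 < Λ ∧ ∃ z0 : ℕ, ∀ z : ℕ, z0 ≤ z →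
    ∀ R : ℕ, ∀ g : ℕ → ℝ, (∀ r, 0 ≤ g r ∧ g r ≤ 2) → ∀ d ∈ Fintype.piFinset (fun _ : Fin k => Qs z (z^K)),
    |lamb (Qs z (z^K)) (Yw R g) d| ≤ Λ := by
  obtain ⟨C, hC, hQ⟩ := Qphi_sum hEH K
  refine ⟨(4*C)^k, by positivity, 2*K+2, ?_⟩
  intro z hz R g hg d hd
  rw [Fintype.mem_piFinset] at hd
  have hz2 : 2 ≤ z := by omega
  unfold lamb
  rw [abs_mul, Finset.abs_prod]
  set Q := Qs z (z^K) with hQdef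
  have h1 : ∏ i, |((ArithmeticFunction.moebius (d i) : ℤ):ℝ) * (d i : ℝ)| ≤ ∏ i, (d i:ℝ) := by
    apply Finset.prod_le_prod (fun i _ => abs_nonneg _)
    intro i _
    rw [abs_mul, Nat.abs_cast]
    have : |((ArithmeticFunction.moebius (d i) : ℤ):ℝ)| ≤ 1 := by
      have := ArithmeticFunction.abs_moebius_le_one (n := d i)
      exact_mod_cast this
    calc _ ≤ 1 * (d i:ℝ) := by gcongr
      _ = _ := one_mul _
  have h2 : |∑ t ∈ Fintype.piFinset (fun _ : Fin k => Q), if ∀ i, d i ∣ t i then Yw R g t else 0|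
      ≤ ∏ i, ∑ t ∈ Q, (if d i ∣ t then 2/(Nat.totient t:ℝ) else 0) := by
    rw [Finset.prod_univ_sum]
    refine (Finset.abs_sum_le_sum_abs _ _).trans ?_
    apply Finset.sum_le_sum
    intro t ht
    rw [prod_ite_all (fun i => d i ∣ t i)]
    split_ifs with h
    · unfold Yw
      split_ifs
      · rw [Finset.abs_prod]
        apply Finset.prod_le_prod (fun i _ => abs_nonneg _)
        intro i _
        rw [abs_of_nonneg (div_nonneg (hg _).1 (by positivity))]
        exact div_le_div_of_nonneg_right (hg _).2 (by positivity)
      · rw [abs_zero]; positivity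
    · simp
  refine (mul_le_mul h1 h2 (abs_nonneg _) (by positivity)).trans ?_
  rw [← Finset.prod_mul_distrib]
  calc _ ≤ ∏ _i : Fin k, (4*C) := by
        apply Finset.prod_le_prod
        · intro i _
          apply mul_nonneg (by positivity)
          apply Finset.sum_nonneg
          intro t _
          split_ifs <;> positivity
        · intro i _
          have hdi := hd i
          have e : ∑ t ∈ Q, (if d i ∣ t then 2/(Nat.totient t:ℝ) else 0) = 2 * ∑ t ∈ Q.filter (fun t => d i ∣ t), 1/(Nat.totient t:ℝ) := by
            rw [Finset.mul_sum, Finset.sum_filter]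
            apply Finset.sum_congr rfl
            intro t _
            split_ifs
            · ring
            · rfl
          rw [e]
          have h3 := Qphi_mult z (z^K) (d i) hdi
          have hm := hdi
          simp only [hQdef, Qs, Finset.mem_filter, Finset.mem_Icc] at hm
          have h4 := rough_phi hz2 hm.2.2 (by omega) hm.1.2
          have hφ : (0:ℝ) < Nat.totient (d i) := by exact_mod_cast Nat.totient_pos.2 (by omega)
          have h5 : (d i:ℝ) ≤ 2 * Nat.totient (d i) := by
            have : (K:ℝ)/z ≤ 1/2 := by
              rw [div_le_div_iff₀ (by positivity) (by norm_num)]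
              have : ((2*K+2:ℕ):ℝ) ≤ z := by exact_mod_cast hz
              push_cast at this; linarith
            have hd0 : (0:ℝ) ≤ d i := by positivity
            nlinarith
          have h6 : ∑ t ∈ Q.filter (fun t => d i ∣ t), 1/(Nat.totient t:ℝ) ≤ 1/(Nat.totient (d i):ℝ) * C :=
            h3.trans (mul_le_mul_of_nonneg_left (hQ z hz2) (by positivity))
          calc (d i:ℝ) * (2 * ∑ t ∈ Q.filter (fun t => d i ∣ t), 1/(Nat.totient t:ℝ)) 
              ≤ (2 * Nat.totient (d i)) * (2 * (1/(Nat.totient (d i):ℝ) * C)) := by gcongr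
            _ = 4*C := by field_simp; ring
    _ = _ := by simp

lemma rough_divisors (z : ℕ) (hz : 1 ≤ z) : ∀ M D : ℕ, Rough z D → D ≠ 0 → D ≤ z^M → D.divisors.card ≤ 2^M := by
  intro M
  induction M with
  | zero =>
    intro D _ h0 hD
    have : D = 1 := by simp at hD; omega
    subst this
    simp
  | succ M ih =>
    intro D hr h0 hD
    by_cases h1 : D = 1
    · subst h1; simp; exact Nat.one_le_two_pow
    · have hp := Nat.minFac_prime h1
      set p := D.minFac with hpdef
      have hpd : p ∣ D := Nat.minFac_dvd D
      have hzp := hr p hp hpd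
      obtain ⟨D', hD'⟩ := hpd
      have hD'0 : D' ≠ 0 := by rintro rfl; simp at hD'; exact h0 hD'
      have hr' : Rough z D' := fun q hq hqd => hr q hq (hqd.trans ⟨p, by rw [hD']; ring⟩)
      have hle : D' ≤ z^M := by
        by_contra hc
        push Not at hc
        have : z^(M+1) < D := by
          rw [hD', pow_succ]
          calc z^M*z ≤ z^M * p := Nat.mul_le_mul_left _ hzp.le
            _ < D' * p := Nat.mul_lt_mul_of_pos_right hc hp.pos
            _ = _ := mul_comm _ _
        omega
      have hsub : D.divisors ⊆ D'.divisors ∪ D'.divisors.image (fun x => p * x) := by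
        intro d hd
        rw [Nat.mem_divisors] at hd
        rw [Finset.mem_union, Finset.mem_image]
        by_cases hpd : p ∣ d
        · right
          obtain ⟨c, rfl⟩ := hpd
          refine ⟨c, ?_, rfl⟩
          rw [Nat.mem_divisors]
          refine ⟨?_, hD'0⟩
          have := hd.1
          rw [hD'] at this
          exact Nat.dvd_of_mul_dvd_mul_left hp.pos this
        · left
          rw [Nat.mem_divisors]
          refine ⟨?_, hD'0⟩
          have := hd.1
          rw [hD'] at this
          exact Nat.Coprime.dvd_of_dvd_mul_left ((Nat.Prime.coprime_iff_not_dvd hp).2 hpd).symm this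
      calc D.divisors.card ≤ (D'.divisors ∪ D'.divisors.image (fun x => p * x)).card := Finset.card_le_card hsub
        _ ≤ D'.divisors.card + (D'.divisors.image (fun x => p * x)).card := Finset.card_union_le _ _
        _ ≤ D'.divisors.card + D'.divisors.card := Nat.add_le_add_left Finset.card_image_le _
        _ ≤ 2^M + 2^M := by have := ih D' hr' hD'0 hle; omega
        _ = 2^(M+1) := by ring

lemma Rough_mul {z a b : ℕ} (ha : Rough z a) (hb : Rough z b) : Rough z (a*b) := by
  intro p hp h
  rcases (Nat.Prime.dvd_mul hp).1 h with h | h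
  · exact ha p hp h
  · exact hb p hp h

lemma Rough_dvd {z a b : ℕ} (hb : Rough z b) (h : a ∣ b) : Rough z a :=
  fun p hp hpa => hb p hp (hpa.trans h)

lemma Rough_lcm {z a b : ℕ} (ha : Rough z a) (hb : Rough z b) : Rough z (Nat.lcm a b) :=
  Rough_dvd (Rough_mul ha hb) (Nat.lcm_dvd_mul a b)

lemma Rough_prod {k z : ℕ} {f : Fin k → ℕ} (h : ∀ i, Rough z (f i)) : Rough z (∏ i, f i) := by
  intro p hp hd
  obtain ⟨i, _, hi⟩ := (hp.prime.dvd_finsetProd_iff _).1 hd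
  exact h i p hp hi

def DD {k : ℕ} (x : (Fin k → ℕ) × (Fin k → ℕ)) : ℕ := ∏ i, Nat.lcm (x.1 i) (x.2 i)

noncomputable def prsQ (k z R : ℕ) : Finset ((Fin k → ℕ) × (Fin k → ℕ)) :=
  (Fintype.piFinset (fun _ : Fin k => Qs z R) ×ˢ Fintype.piFinset (fun _ : Fin k => Qs z R)).filter
    (fun x => ∏ i, x.1 i ≤ R ∧ ∏ i, x.2 i ≤ R)

lemma mem_Qs {z R r : ℕ} : r ∈ Qs z R ↔ (1 ≤ r ∧ r ≤ R) ∧ Squarefree r ∧ Rough z r := by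
  simp [Qs]

lemma mem_prsQ {k z R : ℕ} {x : (Fin k → ℕ) × (Fin k → ℕ)} : x ∈ prsQ k z R ↔
    ((∀ i, x.1 i ∈ Qs z R) ∧ (∀ i, x.2 i ∈ Qs z R)) ∧ ∏ i, x.1 i ≤ R ∧ ∏ i, x.2 i ≤ R := by
  simp [prsQ, Fintype.mem_piFinset]

lemma DD_props {k z R : ℕ} {x : (Fin k → ℕ) × (Fin k → ℕ)} (hx : x ∈ prsQ k z R) :
    1 ≤ DD x ∧ DD x ≤ R^2 ∧ Rough z (DD x) := by
  rw [mem_prsQ] at hx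
  obtain ⟨⟨h1, h2⟩, h3, h4⟩ := hx
  simp only [mem_Qs] at h1 h2
  refine ⟨?_, ?_, ?_⟩
  · apply Nat.succ_le_of_lt
    unfold DD
    refine Finset.prod_pos (fun i _ => ?_)
    exact Nat.lcm_pos (h1 i).1.1 (h2 i).1.1
  · unfold DD
    calc _ ≤ ∏ i, (x.1 i * x.2 i) := by
          apply Finset.prod_le_prod'
          intro i _
          exact Nat.le_of_dvd (Nat.mul_pos (h1 i).1.1 (h2 i).1.1) (Nat.lcm_dvd_mul _ _)
      _ = (∏ i, x.1 i) * ∏ i, x.2 i := Finset.prod_mul_distrib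
      _ ≤ R * R := Nat.mul_le_mul h3 h4
      _ = R^2 := by ring
  · apply Rough_prod
    intro i
    exact Rough_lcm (h1 i).2.2 (h2 i).2.2

lemma fiber_sum (k z R K : ℕ) (hz : 1 ≤ z) (hR : R ≤ z^K) (F : ℕ → ℝ) (hF : ∀ n, 0 ≤ F n) :
    ∑ x ∈ prsQ k z R, F (DD x) ≤ ((2^(2*K))^k)^2 * ∑ D ∈ (Finset.Icc 1 (R^2)).filter (Rough z), F D := by
  have hmaps : ∀ x ∈ prsQ k z R, DD x ∈ (Finset.Icc 1 (R^2)).filter (Rough z) := by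
    intro x hx
    obtain ⟨h1, h2, h3⟩ := DD_props hx
    simp [h1, h2, h3]
  rw [← Finset.sum_fiberwise_of_maps_to hmaps, Finset.mul_sum]
  apply Finset.sum_le_sum
  intro D hD
  rw [Finset.mem_filter, Finset.mem_Icc] at hD
  rw [Finset.sum_congr rfl (g := fun _ => F D) (fun x hx => by rw [(Finset.mem_filter.1 hx).2])]
  rw [Finset.sum_const, nsmul_eq_mul]
  apply mul_le_mul_of_nonneg_right _ (hF D)
  have hsub : (prsQ k z R).filter (fun x => DD x = D) ⊆
      Fintype.piFinset (fun _ : Fin k => D.divisors) ×ˢ Fintype.piFinset (fun _ : Fin k => D.divisors) := by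
    intro x hx
    rw [Finset.mem_filter] at hx
    rw [Finset.mem_product, Fintype.mem_piFinset, Fintype.mem_piFinset]
    have hdv : ∀ i, Nat.lcm (x.1 i) (x.2 i) ∣ D := by
      intro i
      rw [← hx.2]
      exact Finset.dvd_prod_of_mem _ (Finset.mem_univ i)
    constructor <;> intro i <;> rw [Nat.mem_divisors]
    · exact ⟨(Nat.dvd_lcm_left _ _).trans (hdv i), by omega⟩
    · exact ⟨(Nat.dvd_lcm_right _ _).trans (hdv i), by omega⟩
  have hc := Finset.card_le_card hsub
  rw [Finset.card_product, Fintype.card_piFinset] at hc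
  simp only [Finset.prod_const, Finset.card_univ, Fintype.card_fin] at hc
  have hτ : D.divisors.card ≤ 2^(2*K) := by
    apply rough_divisors z hz _ D hD.2 (by omega)
    refine hD.1.2.trans ?_
    calc R^2 ≤ (z^K)^2 := Nat.pow_le_pow_left hR 2
      _ = _ := by rw [← pow_mul]; ring_nf
  have : ((prsQ k z R).filter (fun x => DD x = D)).card ≤ ((2^(2*K))^k)^2 := by
    refine hc.trans ?_
    rw [← sq]
    exact Nat.pow_le_pow_left (Nat.pow_le_pow_left hτ k) 2
  exact_mod_cast this

noncomputable def supL (P : Finset ℕ) (L : ℕ) : Finset (Finset ℕ) := P.powerset.filter (fun S => ∏ p ∈ S, p ≤ L)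

lemma fiber_sum_S (k z R K L : ℕ) (hz : 1 ≤ z) (hR : R ≤ z^K) (P : Finset ℕ) (hP : P ⊆ prs z) (F : ℕ → ℝ) (hF : ∀ n, 0 ≤ F n) :
    ∑ S ∈ supL P L, ∑ x ∈ prsQ k z R, F ((∏ p ∈ S, p) * DD x) ≤ ((2^(2*K))^k)^2 * ∑ q ∈ Finset.Icc 1 (L*R^2), F q := by
  calc _ ≤ ∑ S ∈ supL P L, ((2^(2*K))^k)^2 * ∑ D ∈ (Finset.Icc 1 (R^2)).filter (Rough z), F ((∏ p ∈ S, p) * D) := by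
        apply Finset.sum_le_sum
        intro S _
        exact fiber_sum k z R K hz hR (fun D => F ((∏ p ∈ S, p) * D)) (fun n => hF _)
    _ = ((2^(2*K))^k)^2 * ∑ y ∈ supL P L ×ˢ (Finset.Icc 1 (R^2)).filter (Rough z), F ((∏ p ∈ y.1, p) * y.2) := by
        rw [← Finset.mul_sum, Finset.sum_product]
    _ ≤ _ := by
        apply mul_le_mul_of_nonneg_left _ (by positivity)
        have hSp : ∀ S ∈ supL P L, ∀ p ∈ S, p.Prime ∧ p ≤ z := by
          intro S hS p hp
          have := hP (Finset.mem_powerset.1 (Finset.mem_filter.1 hS).1 hp)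
          rw [mem_prs] at this
          exact ⟨this.2, this.1⟩
        have hinj : Set.InjOn (fun y : Finset ℕ × ℕ => (∏ p ∈ y.1, p) * y.2) (supL P L ×ˢ (Finset.Icc 1 (R^2)).filter (Rough z) : Finset _) := by
          rintro ⟨S, D⟩ h1 ⟨S', D'⟩ h2 h
          simp only [Finset.mem_coe, Finset.mem_product, Finset.mem_filter, Finset.mem_Icc] at h1 h2
          simp only at h
          have key : ∀ S D S' D', S ∈ supL P L → S' ∈ supL P L → Rough z D' → (∏ p ∈ S, p) * D = (∏ p ∈ S', p) * D' → S ⊆ S' := by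
            intro S D S' D' hS hS' hD' h p hp
            have hpp := hSp S hS p hp
            have hd : p ∣ (∏ p ∈ S', p) * D' := by
              rw [← h]; exact (Finset.dvd_prod_of_mem _ hp).mul_right _
            rcases (Nat.Prime.dvd_mul hpp.1).1 hd with hd | hd
            · obtain ⟨q, hq, hpq⟩ := (hpp.1.prime.dvd_finsetProd_iff _).1 hd
              rw [(Nat.prime_dvd_prime_iff_eq hpp.1 (hSp S' hS' q hq).1).1 hpq]
              exact hq
            · have := hD' p hpp.1 hd
              omega
          have hSS : S = S' := Finset.Subset.antisymm (key S D S' D' h1.1 h2.1 h2.2.2 h) (key S' D' S D h2.1 h1.1 h1.2.2 h.symm)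
          subst hSS
          have : 0 < ∏ p ∈ S, p := Finset.prod_pos fun p hp => (hSp S h1.1 p hp).1.pos
          have := Nat.eq_of_mul_eq_mul_left this h
          rw [this]
        rw [← Finset.sum_image (f := F) hinj]
        apply Finset.sum_le_sum_of_subset_of_nonneg _ (fun q _ _ => hF q)
        intro q hq
        rw [Finset.mem_image] at hq
        obtain ⟨⟨S, D⟩, h, rfl⟩ := hq
        simp only [Finset.mem_product, Finset.mem_filter, Finset.mem_Icc] at h
        rw [Finset.mem_Icc]
        have h0 : 0 < ∏ p ∈ S, p := Finset.prod_pos fun p hp => (hSp S h.1 p hp).1.pos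
        have hL : ∏ p ∈ S, p ≤ L := (Finset.mem_filter.1 h.1).2
        exact ⟨Nat.mul_pos h0 h.2.1.1, Nat.mul_le_mul hL h.2.1.2⟩

/-- sum of 1/DD over all pairs -/
lemma DD_sum (k z R K : ℕ) (hz : 1 ≤ z) (hR : R ≤ z^K) (hR1 : 1 ≤ R) :
    ∑ x ∈ prsQ k z R, 1/(DD x:ℝ) ≤ ((2^(2*K))^k)^2 * (1 + Real.log (R^2 : ℕ)) := by
  refine (fiber_sum k z R K hz hR (fun n => 1/(n:ℝ)) (fun n => by positivity)).trans ?_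
  apply mul_le_mul_of_nonneg_left _ (by positivity)
  have h2 : ∑ i ∈ Finset.Icc 1 (R^2), 1/(i:ℝ) ≤ 1 + Real.log ((R^2:ℕ):ℝ) := by
    have := harmonic_le_one_add_log (R^2)
    rw [harmonic_eq_sum_Icc] at this
    push_cast at this ⊢
    simpa using this
  refine le_trans ?_ h2
  exact Finset.sum_le_sum_of_subset_of_nonneg (Finset.filter_subset _ _) (fun _ _ _ => by positivity)

lemma DD_bad_sum (k z R K : ℕ) (hz : 1 ≤ z) (hR : R ≤ z^K) (hR1 : 1 ≤ R) :
    ∑ x ∈ (prsQ k z R).filter (fun x => ¬ Squarefree (DD x)), 1/(DD x:ℝ) ≤ ((2^(2*K))^k)^2 * (1/(z:ℝ) * (1 + Real.log (R^2+1 : ℕ))) := by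
  classical
  rw [Finset.sum_filter]
  refine (fiber_sum k z R K hz hR (fun n => if ¬ Squarefree n then 1/(n:ℝ) else 0) (fun n => by positivity)).trans ?_
  apply mul_le_mul_of_nonneg_left _ (by positivity)
  refine le_trans (le_of_eq ?_) (nonsq_sum z (R^2+1) hz (by omega))
  rw [← Finset.sum_filter, Finset.filter_filter]
  apply Finset.sum_congr _ (fun _ _ => rfl)
  ext n
  simp only [Finset.mem_filter, Finset.mem_Icc, Finset.mem_Ico]
  constructor
  · rintro ⟨h, h1, h2⟩; exact ⟨by omega, h2, h1⟩
  · rintro ⟨h, h1, h2⟩; exact ⟨by omega, h2, h1⟩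

noncomputable def classes (W : ℕ) (S : Finset ℕ) (ρ : ℕ → Finset ℕ) : Finset ℕ :=
  (Finset.range (W * ∏ p ∈ S, p)).filter (fun a => a % W = 1 % W ∧ ∀ p ∈ S, a % p ∈ ρ p)

lemma card_classes (W : ℕ) (hW : 1 ≤ W) (S : Finset ℕ) (hS : ∀ p ∈ S, p.Prime ∧ Nat.Coprime p W)
    (ρ : ℕ → Finset ℕ) (hρ : ∀ p ∈ S, ρ p ⊆ Finset.range p) :
    (classes W S ρ).card = ∏ p ∈ S, (ρ p).card := by
  classical
  induction S using Finset.induction_on with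
  | empty =>
    simp only [classes, Finset.prod_empty, mul_one]
    rw [Finset.card_eq_one]
    refine ⟨1 % W, ?_⟩
    ext a
    simp only [Finset.mem_filter, Finset.mem_range, Finset.mem_singleton, Finset.notMem_empty, false_imp_iff, implies_true, and_true]
    constructor
    · rintro ⟨h1, h2⟩; rw [Nat.mod_eq_of_lt h1] at h2; exact h2
    · rintro rfl; exact ⟨Nat.mod_lt _ (by omega), Nat.mod_mod _ _⟩
  | insert p S hp ih =>
    have ih' := ih (fun q hq => hS q (Finset.mem_insert_of_mem hq)) (fun q hq => hρ q (Finset.mem_insert_of_mem hq))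
    rw [Finset.prod_insert hp, ← ih', mul_comm, ← Finset.card_product]
    set q := W * ∏ p ∈ S, p with hq
    have hpp := (hS p (Finset.mem_insert_self _ _)).1
    have hq0 : 0 < q := Nat.mul_pos (by omega) (Finset.prod_pos fun r hr => (hS r (Finset.mem_insert_of_mem hr)).1.pos)
    have hcop : Nat.Coprime q p := by
      apply Nat.Coprime.mul_left
      · exact (hS p (Finset.mem_insert_self _ _)).2.symm
      · apply Nat.Coprime.prod_left
        intro r hr
        rw [Nat.coprime_primes (hS r (Finset.mem_insert_of_mem hr)).1 hpp]
        rintro rfl; exact hp hr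
    have hq' : W * ∏ r ∈ insert p S, r = q * p := by rw [Finset.prod_insert hp, hq]; ring
    have hdW : W ∣ q := ⟨_, hq⟩
    have hdr : ∀ r ∈ S, r ∣ q := fun r hr => (Finset.dvd_prod_of_mem _ hr).mul_left _
    apply Finset.card_bij (fun a _ => (a % q, a % p))
    · intro a ha
      simp only [classes, Finset.mem_filter, Finset.mem_range] at ha
      rw [Finset.mem_product]
      simp only [classes, Finset.mem_filter, Finset.mem_range]
      refine ⟨⟨Nat.mod_lt _ hq0, ?_, ?_⟩, ha.2.2 p (Finset.mem_insert_self _ _)⟩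
      · rw [Nat.mod_mod_of_dvd _ hdW]; exact ha.2.1
      · intro r hr
        rw [Nat.mod_mod_of_dvd _ (hdr r hr)]
        exact ha.2.2 r (Finset.mem_insert_of_mem hr)
    · intro a ha b hb hab
      simp only [classes, Finset.mem_filter, Finset.mem_range, hq'] at ha hb
      simp only [Prod.mk.injEq] at hab
      have : a ≡ b [MOD q * p] := (Nat.modEq_and_modEq_iff_modEq_mul hcop).1 hab
      unfold Nat.ModEq at this
      rwa [Nat.mod_eq_of_lt ha.1, Nat.mod_eq_of_lt hb.1] at this
    · rintro ⟨b, c⟩ hbc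
      rw [Finset.mem_product] at hbc
      simp only [classes, Finset.mem_filter, Finset.mem_range] at hbc
      have hc : c < p := Finset.mem_range.1 (hρ p (Finset.mem_insert_self _ _) hbc.2)
      have h1 := (Nat.chineseRemainder hcop b c).2.1
      have h2 := (Nat.chineseRemainder hcop b c).2.2
      have h3 := Nat.chineseRemainder_lt_mul hcop b c hq0.ne' hpp.pos.ne'
      set a : ℕ := (Nat.chineseRemainder hcop b c : ℕ) with ha
      have e1 : a % q = b := by rw [h1, Nat.mod_eq_of_lt hbc.1.1]
      have e2 : a % p = c := by rw [h2, Nat.mod_eq_of_lt hc]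
      refine ⟨a, ?_, by rw [e1, e2]⟩
      simp only [classes, Finset.mem_filter, Finset.mem_range, hq']
      refine ⟨h3, ?_, ?_⟩
      · rw [← Nat.mod_mod_of_dvd _ hdW, e1]; exact hbc.1.2.1
      · intro r hr
        rcases Finset.mem_insert.1 hr with rfl | hr
        · rw [e2]; exact hbc.2
        · rw [← Nat.mod_mod_of_dvd _ (hdr r hr), e1]; exact hbc.1.2.2 r hr

lemma class_approx (W : ℕ) (hW : 1 ≤ W) (S : Finset ℕ) (hS : ∀ p ∈ S, p.Prime ∧ Nat.Coprime p W)
    (ρ : ℕ → Finset ℕ) (hρ : ∀ p ∈ S, ρ p ⊆ Finset.range p) (I : Finset ℕ) (f : ℕ → ℝ) (Y E : ℝ)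
    (hE : ∀ a ∈ classes W S ρ, |∑ n ∈ I.filter (fun n => n % (W * ∏ p ∈ S, p) = a), f n - Y| ≤ E) :
    |∑ n ∈ I.filter (fun n => n % W = 1 % W ∧ ∀ p ∈ S, n % p ∈ ρ p), f n - Y * ∏ p ∈ S, ((ρ p).card:ℝ)|
      ≤ (∏ p ∈ S, ((ρ p).card:ℝ)) * E := by
  classical
  set q := W * ∏ p ∈ S, p with hq
  have hq0 : 0 < q := Nat.mul_pos (by omega) (Finset.prod_pos fun r hr => (hS r hr).1.pos)
  have hdW : W ∣ q := ⟨_, hq⟩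
  have hdr : ∀ r ∈ S, r ∣ q := fun r hr => (Finset.dvd_prod_of_mem _ hr).mul_left _
  have hcard : ∏ p ∈ S, ((ρ p).card:ℝ) = ((classes W S ρ).card : ℝ) := by
    rw [card_classes W hW S hS ρ hρ]; push_cast; rfl
  have hsum : ∑ n ∈ I.filter (fun n => n % W = 1 % W ∧ ∀ p ∈ S, n % p ∈ ρ p), f n
      = ∑ a ∈ classes W S ρ, ∑ n ∈ I.filter (fun n => n % q = a), f n := by
    have hmaps : ∀ n ∈ I.filter (fun n => n % W = 1 % W ∧ ∀ p ∈ S, n % p ∈ ρ p), n % q ∈ classes W S ρ := by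
      intro n hn
      rw [Finset.mem_filter] at hn
      simp only [classes, Finset.mem_filter, Finset.mem_range]
      refine ⟨Nat.mod_lt _ hq0, ?_, ?_⟩
      · rw [Nat.mod_mod_of_dvd _ hdW]; exact hn.2.1
      · intro r hr; rw [Nat.mod_mod_of_dvd _ (hdr r hr)]; exact hn.2.2 r hr
    rw [← Finset.sum_fiberwise_of_maps_to hmaps]
    apply Finset.sum_congr rfl
    intro a ha
    apply Finset.sum_congr _ (fun _ _ => rfl)
    ext n
    simp only [Finset.mem_filter]
    constructor
    · rintro ⟨⟨h1, _⟩, h2⟩; exact ⟨h1, h2⟩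
    · rintro ⟨h1, h2⟩
      refine ⟨⟨h1, ?_⟩, h2⟩
      simp only [classes, Finset.mem_filter, Finset.mem_range] at ha
      rw [← h2] at ha
      refine ⟨?_, ?_⟩
      · have := ha.2.1; rwa [Nat.mod_mod_of_dvd _ hdW] at this
      · intro r hr; have := ha.2.2 r hr; rwa [Nat.mod_mod_of_dvd _ (hdr r hr)] at this
  rw [hsum, hcard]
  calc _ = |∑ a ∈ classes W S ρ, (∑ n ∈ I.filter (fun n => n % q = a), f n - Y)| := by
        rw [Finset.sum_sub_distrib, Finset.sum_const, nsmul_eq_mul, mul_comm Y]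
    _ ≤ ∑ a ∈ classes W S ρ, |∑ n ∈ I.filter (fun n => n % q = a), f n - Y| := Finset.abs_sum_le_sum_abs _ _
    _ ≤ ∑ a ∈ classes W S ρ, E := Finset.sum_le_sum hE
    _ = _ := by rw [Finset.sum_const, nsmul_eq_mul]

lemma class_count (N q a : ℕ) (hq : 1 ≤ q) (ha : a < q) :
    |∑ n ∈ (Finset.Ioc N (2*N)).filter (fun n => n % q = a), (1:ℝ) - (N:ℝ)/q| ≤ 1 := by
  have h := Nat.Ioc_filter_modEq_card N (2*N) (show 0 < q by omega) a
  have e : (Finset.Ioc N (2*N)).filter (fun n => n % q = a) = (Finset.Ioc N (2*N)).filter (fun n => n ≡ a [MOD q]) := by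
    apply Finset.filter_congr
    intro n _
    unfold Nat.ModEq
    rw [Nat.mod_eq_of_lt ha]
  rw [e, Finset.sum_const, nsmul_eq_mul, mul_one]
  have hqr : (0:ℚ) < q := by exact_mod_cast hq
  have h1 : ⌊((2*N:ℕ) - a : ℚ)/q⌋ ≥ ⌊((N:ℕ) - a : ℚ)/q⌋ := by
    apply Int.floor_le_floor
    apply div_le_div_of_nonneg_right _ hqr.le
    push_cast
    have : (0:ℚ) ≤ N := by positivity
    linarith
  rw [max_eq_left (by linarith)] at h
  have hc : (((Finset.Ioc N (2*N)).filter (fun n => n ≡ a [MOD q])).card : ℚ) = ⌊((2*N:ℕ) - a : ℚ)/q⌋ - ⌊((N:ℕ) - a : ℚ)/q⌋ := by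
    exact_mod_cast h
  have f1 := Int.floor_le (((2*N:ℕ) - a : ℚ)/q)
  have f2 := Int.lt_floor_add_one (((2*N:ℕ) - a : ℚ)/q)
  have f3 := Int.floor_le (((N:ℕ) - a : ℚ)/q)
  have f4 := Int.lt_floor_add_one (((N:ℕ) - a : ℚ)/q)
  have e2 : ((2*N:ℕ) - a : ℚ)/q - ((N:ℕ) - a : ℚ)/q = (N:ℚ)/q := by push_cast; field_simp; ring
  have hfin : |(((Finset.Ioc N (2*N)).filter (fun n => n ≡ a [MOD q])).card : ℚ) - (N:ℚ)/q| ≤ 1 := by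
    rw [abs_le]; constructor <;> linarith
  have h9 := (Rat.cast_le (K := ℝ)).2 hfin
  push_cast at h9
  exact h9

/-- residues mod p hit by the tuple -/
def res {k : ℕ} (h : Fin k → ℕ) (p : ℕ) : Finset ℕ := (Finset.range p).filter (fun r => p ∣ ∏ i, (r + h i))

lemma dvd_mod_add (p n c : ℕ) : p ∣ n % p + c ↔ p ∣ n + c := by
  rw [Nat.dvd_iff_mod_eq_zero, Nat.dvd_iff_mod_eq_zero, Nat.mod_add_mod]

lemma mem_res_mod {k : ℕ} (h : Fin k → ℕ) (p n : ℕ) (hp : p.Prime) : n % p ∈ res h p ↔ p ∣ ∏ i, (n + h i) := by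
  simp only [res, Finset.mem_filter, Finset.mem_range, Nat.mod_lt _ hp.pos, true_and]
  rw [hp.prime.dvd_finsetProd_iff, hp.prime.dvd_finsetProd_iff]
  simp only [dvd_mod_add]

lemma single_res (p c : ℕ) (hp : 1 ≤ p) : ((Finset.range p).filter (fun r => p ∣ r + c)).card = 1 := by
  rw [Finset.card_eq_one]
  have hex : ∃ r, r < p ∧ p ∣ r + c := by
    refine ⟨(p - c % p) % p, Nat.mod_lt _ hp, ?_⟩
    rw [dvd_mod_add]
    have h1 : c % p < p := Nat.mod_lt _ hp
    have h2 := Nat.div_add_mod c p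
    refine ⟨1 + c/p, ?_⟩
    rw [mul_add, mul_one]; omega
  obtain ⟨r, hr, hrc⟩ := hex
  refine ⟨r, ?_⟩
  ext s
  simp only [Finset.mem_filter, Finset.mem_range, Finset.mem_singleton]
  constructor
  · rintro ⟨hs, hsc⟩
    have : r + c ≡ s + c [MOD p] := by
      unfold Nat.ModEq
      rw [Nat.mod_eq_zero_of_dvd hrc, Nat.mod_eq_zero_of_dvd hsc]
    have := Nat.ModEq.add_right_cancel' c this
    unfold Nat.ModEq at this
    rw [Nat.mod_eq_of_lt hr, Nat.mod_eq_of_lt hs] at this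
    exact this.symm
  · rintro rfl; exact ⟨hr, hrc⟩

lemma res_card_le {k : ℕ} (h : Fin k → ℕ) (p : ℕ) (hp : p.Prime) : (res h p).card ≤ k := by
  classical
  have hsub : res h p ⊆ Finset.univ.biUnion (fun i => (Finset.range p).filter (fun r => p ∣ r + h i)) := by
    intro r hr
    simp only [res, Finset.mem_filter, Finset.mem_range] at hr
    rw [hp.prime.dvd_finsetProd_iff] at hr
    obtain ⟨hr, i, _, hi⟩ := hr
    simp only [Finset.mem_biUnion, Finset.mem_univ, Finset.mem_filter, Finset.mem_range, true_and]
    exact ⟨i, hr, hi⟩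
  refine (Finset.card_le_card hsub).trans ?_
  refine (Finset.card_biUnion_le_card_mul _ _ 1 (fun i _ => (single_res p (h i) hp.pos).le)).trans ?_
  simp

/-- number of residues when excluding one -/
def resm {k : ℕ} (h : Fin k → ℕ) (m : Fin k) (p : ℕ) : Finset ℕ := (res h p).filter (fun r => ¬ p ∣ r + h m)

lemma resm_card {k : ℕ} (h : Fin k → ℕ) (m : Fin k) (p : ℕ) (hp : p.Prime) : (resm h m p).card + 1 = (res h p).card := by
  unfold resm
  rw [← Finset.card_filter_add_card_filter_not (s := res h p) (fun r => p ∣ r + h m), add_comm]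
  congr 1
  rw [← single_res p (h m) hp.pos]
  congr 1
  ext r
  simp only [res, Finset.mem_filter, Finset.mem_range]
  constructor
  · rintro ⟨h1, h2⟩; exact ⟨⟨h1, h2.trans (Finset.dvd_prod_of_mem (fun i => r + h i) (Finset.mem_univ m))⟩, h2⟩
  · rintro ⟨⟨h1, _⟩, h2⟩; exact ⟨h1, h2⟩

structure TupleOK {k : ℕ} (W z : ℕ) (P : Finset ℕ) (h : Fin k → ℕ) : Prop where
  W1 : 1 ≤ W
  inj : Function.Injective h
  dvd : ∀ i, W ∣ h i
  le : ∀ i, h i ≤ z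
  Wz : ∀ p, p.Prime → p ∣ W → p ≤ z
  Pz : P ⊆ prs z
  PW : ∀ p ∈ P, Nat.Coprime p W

/-- the condition on n -/
def Cond {k : ℕ} (W : ℕ) (h : Fin k → ℕ) (S : Finset ℕ) (x : (Fin k → ℕ) × (Fin k → ℕ)) (n : ℕ) : Prop :=
  n % W = 1 % W ∧ (∀ p ∈ S, p ∣ ∏ i, (n + h i)) ∧ ∀ i, x.1 i ∣ n + h i ∧ x.2 i ∣ n + h i

noncomputable instance {k : ℕ} (W : ℕ) (h : Fin k → ℕ) (S : Finset ℕ) (x : (Fin k → ℕ) × (Fin k → ℕ)) :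
    DecidablePred (Cond W h S x) := Classical.decPred _

noncomputable def TT {k : ℕ} (N W : ℕ) (h : Fin k → ℕ) (f : ℕ → ℝ) (S : Finset ℕ) (x : (Fin k → ℕ) × (Fin k → ℕ)) : ℝ :=
  ∑ n ∈ (Finset.Ioc N (2*N)).filter (Cond W h S x), f n

lemma diff_ne {k W z : ℕ} {P : Finset ℕ} {h : Fin k → ℕ} (hT : TupleOK W z P h) {p n : ℕ} (hp : z < p) {i j : Fin k} (hi : p ∣ n + h i)
    (hj : p ∣ n + h j) : i = j := by
  apply hT.inj
  have h1 := hT.le i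
  have h2 := hT.le j
  rcases le_total (h i) (h j) with hle | hle
  · have := Nat.dvd_sub hj hi
    have e : n + h j - (n + h i) = h j - h i := by omega
    rw [e] at this
    have := Nat.eq_zero_of_dvd_of_lt this (by omega)
    omega
  · have := Nat.dvd_sub hi hj
    have e : n + h i - (n + h j) = h i - h j := by omega
    rw [e] at this
    have := Nat.eq_zero_of_dvd_of_lt this (by omega)
    omega

lemma sq_lcm {a b : ℕ} (ha : Squarefree a) (hb : Squarefree b) : Squarefree (Nat.lcm a b) := by
  have h0 : Nat.lcm a b ≠ 0 := Nat.lcm_ne_zero ha.ne_zero hb.ne_zero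
  rw [Nat.squarefree_iff_factorization_le_one h0]
  intro p
  rw [Nat.factorization_lcm ha.ne_zero hb.ne_zero]
  simp only [Finsupp.sup_apply]
  exact max_le (ha.natFactorization_le_one p) (hb.natFactorization_le_one p)

lemma TT_bad {k N W z R : ℕ} {P : Finset ℕ} {h : Fin k → ℕ} (hT : TupleOK W z P h) (f : ℕ → ℝ) (S : Finset ℕ)
    (x : (Fin k → ℕ) × (Fin k → ℕ)) (hx : x ∈ prsQ k z R) (hbad : ¬ Squarefree (DD x)) : TT N W h f S x = 0 := by
  unfold TT
  rw [Finset.filter_false_of_mem, Finset.sum_empty]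
  intro n _ hc
  apply hbad
  rw [mem_prsQ] at hx
  have hlcm : ∀ i, Nat.lcm (x.1 i) (x.2 i) ∣ n + h i := fun i => Nat.lcm_dvd (hc.2.2 i).1 (hc.2.2 i).2
  have hr : ∀ i, Rough z (Nat.lcm (x.1 i) (x.2 i)) := fun i =>
    Rough_lcm (mem_Qs.1 (hx.1.1 i)).2.2 (mem_Qs.1 (hx.1.2 i)).2.2
  unfold DD
  apply Finset.squarefree_prod_of_pairwise_isCoprime
  · intro i _ j _ hij
    simp only [Function.onFun]
    rw [← Nat.coprime_iff_isRelPrime]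
    rw [Nat.coprime_iff_gcd_eq_one]
    by_contra hg
    obtain ⟨p, hp, hpd⟩ := Nat.exists_prime_and_dvd hg
    have hpi := hpd.trans (Nat.gcd_dvd_left _ _)
    have hpj := hpd.trans (Nat.gcd_dvd_right _ _)
    exact hij (diff_ne hT (hr i p hp hpi) (hpi.trans (hlcm i)) (hpj.trans (hlcm j)))
  · intro i _
    exact sq_lcm (Qs_sq _ _ _ (hx.1.1 i)) (Qs_sq _ _ _ (hx.1.2 i))

noncomputable def SS {k : ℕ} (S : Finset ℕ) (x : (Fin k → ℕ) × (Fin k → ℕ)) : Finset ℕ := S ∪ (DD x).primeFactors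

noncomputable def rho {k : ℕ} (h : Fin k → ℕ) (x : (Fin k → ℕ) × (Fin k → ℕ)) (p : ℕ) : Finset ℕ :=
  if p ∣ DD x then (Finset.range p).filter (fun r => ∃ i, p ∣ Nat.lcm (x.1 i) (x.2 i) ∧ p ∣ r + h i) else res h p

lemma rho_sub {k : ℕ} (h : Fin k → ℕ) (x : (Fin k → ℕ) × (Fin k → ℕ)) (p : ℕ) : rho h x p ⊆ Finset.range p := by
  unfold rho res
  split_ifs <;> exact Finset.filter_subset _ _

lemma sq_uniq {k : ℕ} {x : (Fin k → ℕ) × (Fin k → ℕ)} (hsq : Squarefree (DD x)) {p : ℕ} (hp : p.Prime) {i j : Fin k}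
    (hi : p ∣ Nat.lcm (x.1 i) (x.2 i)) (hj : p ∣ Nat.lcm (x.1 j) (x.2 j)) : i = j := by
  by_contra hij
  have h2 : Nat.lcm (x.1 i) (x.2 i) * Nat.lcm (x.1 j) (x.2 j) ∣ DD x := by
    unfold DD
    rw [← Finset.mul_prod_erase _ _ (Finset.mem_univ i)]
    apply mul_dvd_mul_left
    exact Finset.dvd_prod_of_mem (fun i => Nat.lcm (x.1 i) (x.2 i)) (Finset.mem_erase.2 ⟨fun e => hij e.symm, Finset.mem_univ j⟩)
  have h3 : p * p ∣ DD x := (mul_dvd_mul hi hj).trans h2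
  have := hsq p h3
  rw [Nat.isUnit_iff] at this
  exact hp.one_lt.ne' this

lemma S_not_dvd {k W z R : ℕ} {P : Finset ℕ} {h : Fin k → ℕ} (hT : TupleOK W z P h) {S : Finset ℕ} (hS : S ⊆ P)
    {x : (Fin k → ℕ) × (Fin k → ℕ)} (hx : x ∈ prsQ k z R) : ∀ p ∈ S, p.Prime ∧ ¬ p ∣ DD x := by
  intro p hp
  have h1 := mem_prs.1 (hT.Pz (hS hp))
  refine ⟨h1.2, fun hd => ?_⟩
  have := (DD_props hx).2.2 p h1.2 hd
  omega

lemma cond_iff {k W z R : ℕ} {P : Finset ℕ} {h : Fin k → ℕ} (hT : TupleOK W z P h) {S : Finset ℕ} (hS : S ⊆ P)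
    {x : (Fin k → ℕ) × (Fin k → ℕ)} (hx : x ∈ prsQ k z R) (hsq : Squarefree (DD x)) (n : ℕ) :
    Cond W h S x n ↔ n % W = 1 % W ∧ ∀ p ∈ SS S x, n % p ∈ rho h x p := by
  unfold Cond
  have hD0 : DD x ≠ 0 := hsq.ne_zero
  apply and_congr_right
  intro _
  have hnd := S_not_dvd hT hS hx
  have hxq := mem_prsQ.1 hx
  have hmem : ∀ p, p.Prime → p ∣ DD x → (n % p ∈ rho h x p ↔ ∃ i, p ∣ Nat.lcm (x.1 i) (x.2 i) ∧ p ∣ n + h i) := by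
    intro p hp hd
    simp only [rho, if_pos hd, Finset.mem_filter, Finset.mem_range, Nat.mod_lt _ hp.pos, true_and, dvd_mod_add]
  constructor
  · rintro ⟨h1, h2⟩ p hp
    rcases Finset.mem_union.1 hp with hp | hp
    · obtain ⟨hpp, hpd⟩ := hnd p hp
      rw [rho, if_neg hpd, mem_res_mod _ _ _ hpp]
      exact h1 p hp
    · have hpp := Nat.prime_of_mem_primeFactors hp
      have hpd := Nat.dvd_of_mem_primeFactors hp
      rw [hmem p hpp hpd]
      obtain ⟨i, _, hi⟩ := (hpp.prime.dvd_finsetProd_iff _).1 (show p ∣ ∏ i, Nat.lcm (x.1 i) (x.2 i) from hpd)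
      exact ⟨i, hi, hi.trans (Nat.lcm_dvd (h2 i).1 (h2 i).2)⟩
  · intro h1
    constructor
    · intro p hp
      obtain ⟨hpp, hpd⟩ := hnd p hp
      have := h1 p (Finset.mem_union_left _ hp)
      rwa [rho, if_neg hpd, mem_res_mod _ _ _ hpp] at this
    · intro i
      suffices hl : Nat.lcm (x.1 i) (x.2 i) ∣ n + h i from
        ⟨(Nat.dvd_lcm_left _ _).trans hl, (Nat.dvd_lcm_right _ _).trans hl⟩
      have hsql : Squarefree (Nat.lcm (x.1 i) (x.2 i)) := sq_lcm (Qs_sq _ _ _ (hxq.1.1 i)) (Qs_sq _ _ _ (hxq.1.2 i))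
      rw [← Nat.prod_primeFactors_of_squarefree hsql]
      rw [← primes_prod_dvd_iff _ (fun p hp => Nat.prime_of_mem_primeFactors hp)]
      intro p hp
      have hpp := Nat.prime_of_mem_primeFactors hp
      have hpl := Nat.dvd_of_mem_primeFactors hp
      have hpd : p ∣ DD x := hpl.trans (Finset.dvd_prod_of_mem (fun i => Nat.lcm (x.1 i) (x.2 i)) (Finset.mem_univ i))
      have := h1 p (Finset.mem_union_right _ (Nat.mem_primeFactors.2 ⟨hpp, hpd, hD0⟩))
      rw [hmem p hpp hpd] at this
      obtain ⟨j, hj, hj2⟩ := this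
      rw [sq_uniq hsq hpp hpl hj]
      exact hj2

lemma SS_props {k W z R : ℕ} {P : Finset ℕ} {h : Fin k → ℕ} (hT : TupleOK W z P h) {S : Finset ℕ} (hS : S ⊆ P)
    {x : (Fin k → ℕ) × (Fin k → ℕ)} (hx : x ∈ prsQ k z R) (hsq : Squarefree (DD x)) :
    (∀ p ∈ SS S x, p.Prime ∧ Nat.Coprime p W) ∧ Disjoint S (DD x).primeFactors ∧
    ∏ p ∈ SS S x, p = (∏ p ∈ S, p) * DD x := by
  have hnd := S_not_dvd hT hS hx
  have hdis : Disjoint S (DD x).primeFactors := by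
    rw [Finset.disjoint_left]
    intro p hp hp2
    exact (hnd p hp).2 (Nat.dvd_of_mem_primeFactors hp2)
  refine ⟨?_, hdis, ?_⟩
  · intro p hp
    rcases Finset.mem_union.1 hp with hp | hp
    · exact ⟨(hnd p hp).1, hT.PW p (hS hp)⟩
    · have hpp := Nat.prime_of_mem_primeFactors hp
      refine ⟨hpp, ?_⟩
      rw [Nat.Prime.coprime_iff_not_dvd hpp]
      intro hd
      have h1 := hT.Wz p hpp hd
      have h2 := (DD_props hx).2.2 p hpp (Nat.dvd_of_mem_primeFactors hp)
      omega
  · rw [SS, Finset.prod_union hdis, Nat.prod_primeFactors_of_squarefree hsq]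

lemma rho_card_D {k : ℕ} {h : Fin k → ℕ} {x : (Fin k → ℕ) × (Fin k → ℕ)} (hsq : Squarefree (DD x)) {p : ℕ} (hp : p.Prime)
    (hd : p ∣ DD x) : (rho h x p).card = 1 := by
  obtain ⟨i, _, hi⟩ := (hp.prime.dvd_finsetProd_iff _).1 (show p ∣ ∏ i, Nat.lcm (x.1 i) (x.2 i) from hd)
  rw [rho, if_pos hd, ← single_res p (h i) hp.pos]
  congr 1
  apply Finset.filter_congr
  intro r _
  constructor
  · rintro ⟨j, hj, hj2⟩; rw [sq_uniq hsq hp hi hj]; exact hj2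
  · intro hr; exact ⟨i, hi, hr⟩

lemma T1_approx {k N W z R : ℕ} {P : Finset ℕ} {h : Fin k → ℕ} (hT : TupleOK W z P h) {S : Finset ℕ} (hS : S ⊆ P)
    {x : (Fin k → ℕ) × (Fin k → ℕ)} (hx : x ∈ prsQ k z R) (hsq : Squarefree (DD x)) :
    |TT N W h (fun _ => 1) S x - (N:ℝ)/W * (∏ p ∈ S, ((res h p).card : ℝ)/p) * (1/(DD x:ℝ))| ≤ (k:ℝ)^S.card := by
  obtain ⟨hSS, hdis, hprod⟩ := SS_props hT hS hx hsq
  have hnd := S_not_dvd hT hS hx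
  have hq1 : 1 ≤ W * ∏ p ∈ SS S x, p := Nat.mul_pos hT.W1 (Finset.prod_pos fun p hp => (hSS p hp).1.pos)
  have key := class_approx W hT.W1 (SS S x) hSS (rho h x) (fun p _ => rho_sub h x p) (Finset.Ioc N (2*N)) (fun _ => (1:ℝ))
    ((N:ℝ)/((W * ∏ p ∈ SS S x, p : ℕ):ℝ)) 1 (fun a ha => by
      simp only [classes, Finset.mem_filter, Finset.mem_range] at ha
      exact class_count N _ a hq1 ha.1)
  have hcardprod : ∏ p ∈ SS S x, ((rho h x p).card:ℝ) = ∏ p ∈ S, ((res h p).card:ℝ) := by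
    rw [SS, Finset.prod_union hdis]
    rw [Finset.prod_eq_one (s := (DD x).primeFactors), mul_one]
    · apply Finset.prod_congr rfl
      intro p hp
      rw [rho, if_neg (hnd p hp).2]
    · intro p hp
      rw [rho_card_D hsq (Nat.prime_of_mem_primeFactors hp) (Nat.dvd_of_mem_primeFactors hp)]
      norm_num
  rw [hcardprod, mul_one] at key
  have hTT : TT N W h (fun _ => 1) S x = ∑ n ∈ (Finset.Ioc N (2*N)).filter (fun n => n % W = 1 % W ∧ ∀ p ∈ SS S x, n % p ∈ rho h x p), (1:ℝ) := by
    unfold TT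
    apply Finset.sum_congr _ (fun _ _ => rfl)
    apply Finset.filter_congr
    intro n _
    exact cond_iff hT hS hx hsq n
  have hmain : (N:ℝ)/W * (∏ p ∈ S, ((res h p).card : ℝ)/p) * (1/(DD x:ℝ)) = (N:ℝ)/((W * ∏ p ∈ SS S x, p : ℕ):ℝ) * ∏ p ∈ S, ((res h p).card:ℝ) := by
    rw [hprod, Finset.prod_div_distrib]
    push_cast
    rw [div_mul_div_comm, div_mul_div_comm, div_mul_eq_mul_div, mul_one, mul_assoc]
  rw [hTT, hmain]
  refine key.trans ?_
  calc _ ≤ ∏ p ∈ S, (k:ℝ) := by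
        apply Finset.prod_le_prod (fun _ _ => by positivity)
        intro p hp
        exact_mod_cast res_card_le h p (hnd p hp).1
    _ = _ := by simp

lemma exists_worst (x q : ℕ) : ∃ a : ℕ, Nat.Coprime a q ∧ ∀ b, Nat.Coprime b q →
    |primeSumAP x q b - (x:ℝ)/(Nat.totient q)| ≤ |primeSumAP x q a - (x:ℝ)/(Nat.totient q)| := by
  obtain ⟨a, ha, hmax⟩ := Finset.exists_max_image ((Finset.range (q+2)).filter (fun a => Nat.Coprime a q))
    (fun a => |primeSumAP x q a - (x:ℝ)/(Nat.totient q)|) ⟨1, by simp⟩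
  rw [Finset.mem_filter] at ha
  refine ⟨a, ha.2, ?_⟩
  intro b hb
  have hbm : primeSumAP x q b = primeSumAP x q (b % q) := by
    unfold primeSumAP
    simp only [Nat.mod_mod]
  by_cases hq : q = 0
  · subst hq
    have hb1 : b = 1 := by simpa using hb
    exact hmax b (by rw [Finset.mem_filter, Finset.mem_range]; exact ⟨by omega, hb⟩)
  · rw [hbm]
    apply hmax
    rw [Finset.mem_filter, Finset.mem_range]
    have := Nat.mod_lt b (Nat.pos_of_ne_zero hq)
    refine ⟨by omega, ?_⟩
    rw [Nat.coprime_iff_gcd_eq_one, ← Nat.gcd_rec, Nat.gcd_comm]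
    exact hb

noncomputable def aw (x q : ℕ) : ℕ := Classical.choose (exists_worst x q)

noncomputable def Err (x q : ℕ) : ℝ := |primeSumAP x q (aw x q) - (x:ℝ)/(Nat.totient q)|

lemma Err_nonneg (x q : ℕ) : 0 ≤ Err x q := abs_nonneg _

lemma aw_coprime (x q : ℕ) : Nat.Coprime (aw x q) q := (Classical.choose_spec (exists_worst x q)).1

lemma Err_spec (x q b : ℕ) (hb : Nat.Coprime b q) : |primeSumAP x q b - (x:ℝ)/(Nat.totient q)| ≤ Err x q :=
  (Classical.choose_spec (exists_worst x q)).2 b hb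

lemma theta_class (N q a c : ℕ) (hq : 1 ≤ q) (ha : a < q) (hc : Nat.Coprime (a + c) q) :
    |∑ n ∈ (Finset.Ioc N (2*N)).filter (fun n => n % q = a), theta (n + c) - (N:ℝ)/(Nat.totient q)| ≤
      Err (2*N+c) q + Err (N+c) q := by
  have e : ∑ n ∈ (Finset.Ioc N (2*N)).filter (fun n => n % q = a), theta (n + c) =
      primeSumAP (2*N+c) q (a+c) - primeSumAP (N+c) q (a+c) := by
    have h1 : ∀ M, primeSumAP M q (a+c) = ∑ p ∈ (Finset.range (M+1)).filter (fun p => p % q = (a+c) % q), theta p := by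
      intro M
      unfold primeSumAP theta
      rw [← Finset.sum_filter, Finset.filter_filter]
      apply Finset.sum_congr _ (fun _ _ => rfl)
      apply Finset.filter_congr
      intro n _
      exact and_comm
    rw [h1, h1, eq_sub_iff_add_eq]
    have hsplit : (Finset.range (2*N+c+1)).filter (fun p => p % q = (a+c) % q) =
        ((Finset.Ioc N (2*N)).filter (fun n => n % q = a)).image (fun n => n + c) ∪
        (Finset.range (N+c+1)).filter (fun p => p % q = (a+c) % q) := by
      ext p
      simp only [Finset.mem_filter, Finset.mem_range, Finset.mem_union, Finset.mem_image, Finset.mem_Ioc]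
      constructor
      · rintro ⟨h2, h3⟩
        by_cases hp : p < N + c + 1
        · right; exact ⟨hp, h3⟩
        · left
          refine ⟨p - c, ⟨⟨by omega, by omega⟩, ?_⟩, by omega⟩
          have e : p - c + c = p := by omega
          have : p - c + c ≡ a + c [MOD q] := by rw [e]; exact h3
          have := Nat.ModEq.add_right_cancel' c this
          unfold Nat.ModEq at this
          rwa [Nat.mod_eq_of_lt ha] at this
      · rintro (⟨n, ⟨⟨h2, h3⟩, h4⟩, rfl⟩ | ⟨h2, h3⟩)
        · refine ⟨by omega, ?_⟩
          rw [Nat.add_mod, h4, Nat.add_mod a c, Nat.mod_eq_of_lt ha]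
        · exact ⟨by omega, h3⟩
    rw [hsplit, Finset.sum_union]
    · rw [Finset.sum_image]
      intro n _ m _ hnm
      simpa using hnm
    · rw [Finset.disjoint_left]
      intro p hp hp2
      simp only [Finset.mem_image, Finset.mem_filter, Finset.mem_Ioc, Finset.mem_range] at hp hp2
      obtain ⟨n, hn, rfl⟩ := hp
      omega
  rw [e]
  have h1 := Err_spec (2*N+c) q (a+c) hc
  have h2 := Err_spec (N+c) q (a+c) hc
  rw [abs_le] at h1 h2 ⊢
  have e3 : (((2*N+c:ℕ):ℝ))/(Nat.totient q) - ((N+c:ℕ):ℝ)/(Nat.totient q) = (N:ℝ)/(Nat.totient q) := by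
    push_cast; rw [← sub_div]; congr 1; ring
  constructor <;> linarith

lemma theta_nonneg (n : ℕ) : 0 ≤ theta n := by
  unfold theta
  split_ifs with h
  · exact Real.log_natCast_nonneg n
  · exact le_rfl

lemma theta_zero_of_dvd {n p : ℕ} (hp : 2 ≤ p) (hpn : p < n) (hd : p ∣ n) : theta n = 0 := by
  unfold theta
  rw [if_neg]
  intro hn
  rcases (Nat.dvd_prime hn).1 hd with h | h <;> omega

lemma T2_zero {k N W z R : ℕ} {h : Fin k → ℕ} (m : Fin k) (hRN : R ≤ N) (S : Finset ℕ)
    {x : (Fin k → ℕ) × (Fin k → ℕ)} (hx : x ∈ prsQ k z R) (hm : ¬ (x.1 m = 1 ∧ x.2 m = 1)) :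
    TT N W h (fun n => theta (n + h m)) S x = 0 := by
  unfold TT
  apply Finset.sum_eq_zero
  intro n hn
  rw [Finset.mem_filter, Finset.mem_Ioc] at hn
  have hc := hn.2.2.2 m
  have hxq := mem_prsQ.1 hx
  have h1 := (mem_Qs.1 (hxq.1.1 m)).1
  have h2 := (mem_Qs.1 (hxq.1.2 m)).1
  by_cases h3 : x.1 m = 1
  · have h4 : x.2 m ≠ 1 := fun e => hm ⟨h3, e⟩
    exact theta_zero_of_dvd (p := x.2 m) (by omega) (by omega) hc.2
  · exact theta_zero_of_dvd (p := x.1 m) (by omega) (by omega) hc.1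

lemma T2_approx {k N W z R : ℕ} {P : Finset ℕ} {h : Fin k → ℕ} (hT : TupleOK W z P h) (m : Fin k) (hRN : R^2 ≤ N) (hzN : z ≤ N)
    {S : Finset ℕ} (hS : S ⊆ P)
    {x : (Fin k → ℕ) × (Fin k → ℕ)} (hx : x ∈ prsQ k z R) (hsq : Squarefree (DD x)) (hm : x.1 m = 1 ∧ x.2 m = 1) :
    |TT N W h (fun n => theta (n + h m)) S x - (N:ℝ)/(Nat.totient W) * (∏ p ∈ S, ((resm h m p).card : ℝ)/((p:ℝ)-1)) * (1/(Nat.totient (DD x):ℝ))|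
      ≤ (k:ℝ)^S.card * (Err (2*N+h m) (W*((∏ p ∈ S, p) * DD x)) + Err (N+h m) (W*((∏ p ∈ S, p) * DD x))) := by
  obtain ⟨hSS, hdis, hprod⟩ := SS_props hT hS hx hsq
  have hnd := S_not_dvd hT hS hx
  have hDp := DD_props hx
  have hq1 : 1 ≤ W * ∏ p ∈ SS S x, p := Nat.mul_pos hT.W1 (Finset.prod_pos fun p hp => (hSS p hp).1.pos)
  have hW1 := hT.W1
  let ρ : ℕ → Finset ℕ := fun p => (rho h x p).filter (fun r => ¬ p ∣ r + h m)
  have hcls : ∀ a ∈ classes W (SS S x) ρ, a < W * ∏ p ∈ SS S x, p ∧ Nat.Coprime (a + h m) (W * ∏ p ∈ SS S x, p) := by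
    intro a ha
    simp only [classes, Finset.mem_filter, Finset.mem_range, ρ] at ha
    refine ⟨ha.1, ?_⟩
    apply Nat.Coprime.mul_right
    · obtain ⟨c, hc⟩ := hT.dvd m
      have h1 : (a + h m) % W = 1 % W := by rw [hc, Nat.add_mul_mod_self_left]; exact ha.2.1
      rw [Nat.coprime_iff_gcd_eq_one, Nat.gcd_comm, Nat.gcd_rec, h1, ← Nat.gcd_rec]
      simp
    · apply Nat.Coprime.prod_right
      intro p hp
      have := (ha.2.2 p hp).2
      rw [dvd_mod_add] at this
      exact ((Nat.Prime.coprime_iff_not_dvd (hSS p hp).1).2 this).symm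
  have key := class_approx W hT.W1 (SS S x) hSS ρ (fun p _ => (Finset.filter_subset _ _).trans (rho_sub h x p)) (Finset.Ioc N (2*N)) (fun n => theta (n + h m))
    ((N:ℝ)/(Nat.totient (W * ∏ p ∈ SS S x, p))) (Err (2*N+h m) (W * ∏ p ∈ SS S x, p) + Err (N+h m) (W * ∏ p ∈ SS S x, p)) (fun a ha =>
      theta_class N _ a (h m) hq1 (hcls a ha).1 (hcls a ha).2)
  have hcardprod : ∏ p ∈ SS S x, ((ρ p).card:ℝ) = ∏ p ∈ S, ((resm h m p).card:ℝ) := by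
    rw [SS, Finset.prod_union hdis]
    rw [Finset.prod_eq_one (s := (DD x).primeFactors), mul_one]
    · apply Finset.prod_congr rfl
      intro p hp
      simp only [ρ]
      rw [rho, if_neg (hnd p hp).2, resm]
    · intro p hp
      have hpp := Nat.prime_of_mem_primeFactors hp
      have hpd := Nat.dvd_of_mem_primeFactors hp
      have : ρ p = rho h x p := by
        simp only [ρ]
        apply Finset.filter_true_of_mem
        intro r hr hrm
        rw [rho, if_pos hpd, Finset.mem_filter] at hr
        obtain ⟨_, i, hi, hi2⟩ := hr
        have him := diff_ne hT (hDp.2.2 p hpp hpd) hi2 hrm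
        rw [him, hm.1, hm.2, Nat.lcm_self] at hi
        exact hpp.one_lt.ne' (Nat.dvd_one.1 hi)
      rw [this, rho_card_D hsq hpp hpd]
      norm_num
  rw [hcardprod] at key
  have hTT : TT N W h (fun n => theta (n + h m)) S x = ∑ n ∈ (Finset.Ioc N (2*N)).filter (fun n => n % W = 1 % W ∧ ∀ p ∈ SS S x, n % p ∈ ρ p), theta (n + h m) := by
    unfold TT
    rw [Finset.sum_filter, Finset.sum_filter]
    apply Finset.sum_congr rfl
    intro n hn
    rw [Finset.mem_Ioc] at hn
    by_cases hc : Cond W h S x n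
    · rw [if_pos hc]
      by_cases hc2 : ∃ p ∈ SS S x, p ∣ n + h m
      · obtain ⟨p, hp, hpd⟩ := hc2
        have hpN : p ≤ N := by
          rcases Finset.mem_union.1 hp with hp | hp
          · exact (mem_prs.1 (hT.Pz (hS hp))).1.trans hzN
          · exact (Nat.le_of_dvd (by omega) (Nat.dvd_of_mem_primeFactors hp)).trans (hDp.2.1.trans hRN)
        rw [theta_zero_of_dvd (hSS p hp).1.two_le (by omega) hpd]
        simp
      · rw [if_pos]
        push Not at hc2
        rw [cond_iff hT hS hx hsq] at hc
        refine ⟨hc.1, fun p hp => ?_⟩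
        simp only [ρ, Finset.mem_filter, dvd_mod_add]
        exact ⟨hc.2 p hp, hc2 p hp⟩
    · rw [if_neg hc, if_neg]
      rintro ⟨h1, h2⟩
      apply hc
      rw [cond_iff hT hS hx hsq]
      exact ⟨h1, fun p hp => (Finset.mem_filter.1 (h2 p hp)).1⟩
  have htot : ((Nat.totient (W * ∏ p ∈ SS S x, p)):ℝ) = (Nat.totient W:ℝ) * ((∏ p ∈ S, ((p:ℝ)-1)) * (Nat.totient (DD x):ℝ)) := by
    have hc1 : Nat.Coprime W (∏ p ∈ SS S x, p) := Nat.Coprime.prod_right fun p hp => (hSS p hp).2.symm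
    have hc2 : Nat.Coprime (∏ p ∈ S, p) (DD x) := by
      apply Nat.Coprime.prod_left
      intro p hp
      exact (Nat.Prime.coprime_iff_not_dvd (hnd p hp).1).2 (hnd p hp).2
    rw [Nat.totient_mul hc1, hprod, Nat.totient_mul hc2]
    push_cast
    congr 2
    have : ∀ S : Finset ℕ, (∀ p ∈ S, p.Prime) → ((Nat.totient (∏ p ∈ S, p)):ℝ) = ∏ p ∈ S, ((p:ℝ)-1) := by
      intro S
      induction S using Finset.induction_on with
      | empty => simp
      | insert p S hp ih =>
        intro hS
        have hpp := hS p (Finset.mem_insert_self _ _)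
        rw [Finset.prod_insert hp, Finset.prod_insert hp, Nat.totient_mul]
        · push_cast
          rw [ih (fun q hq => hS q (Finset.mem_insert_of_mem hq)), Nat.totient_prime hpp, Nat.cast_sub hpp.one_le]
          simp
        · apply Nat.Coprime.prod_right
          intro q hq
          rw [Nat.coprime_primes hpp (hS q (Finset.mem_insert_of_mem hq))]
          rintro rfl; exact hp hq
    exact this S (fun p hp => (hnd p hp).1)
  have hmain : (N:ℝ)/(Nat.totient W) * (∏ p ∈ S, ((resm h m p).card : ℝ)/((p:ℝ)-1)) * (1/(Nat.totient (DD x):ℝ)) = (N:ℝ)/(Nat.totient (W * ∏ p ∈ SS S x, p)) * ∏ p ∈ S, ((resm h m p).card:ℝ) := by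
    rw [htot, Finset.prod_div_distrib]
    rw [div_mul_div_comm, div_mul_div_comm, div_mul_eq_mul_div, mul_one, mul_assoc]
  rw [hTT, hmain, ← hprod]
  refine key.trans ?_
  apply mul_le_mul_of_nonneg_right _ (add_nonneg (Err_nonneg _ _) (Err_nonneg _ _))
  calc _ ≤ ∏ p ∈ S, (k:ℝ) := by
        apply Finset.prod_le_prod (fun _ _ => by positivity)
        intro p hp
        have h1 := res_card_le h p (hnd p hp).1
        have h2 := resm_card h m p (hnd p hp).1
        exact_mod_cast (by omega : (resm h m p).card ≤ k)
    _ = _ := by simp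

lemma prod_one_add_bound (hEH : HasLevelOfDistribution 1) (κ : ℕ) : ∃ C : ℝ, 0 < C ∧ ∀ z : ℕ, 2 ≤ z → ∀ P ⊆ prs z,
    ∑ S ∈ P.powerset, ∏ p ∈ S, (κ:ℝ)/p ≤ C * (Real.log z)^κ := by
  obtain ⟨C, hC, hm⟩ := mertens2 hEH
  refine ⟨Real.exp (κ*C), Real.exp_pos _, ?_⟩
  intro z hz P hP
  rw [← Finset.prod_one_add]
  have hlz : 0 < Real.log z := Real.log_pos (by exact_mod_cast hz)
  have h1 : ∏ p ∈ P, (1 + (κ:ℝ)/p) ≤ Real.exp (∑ p ∈ P, (κ:ℝ)/p) := by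
    rw [Real.exp_sum]
    apply Finset.prod_le_prod (fun p _ => by positivity)
    intro p _
    linarith [Real.add_one_le_exp ((κ:ℝ)/p)]
  refine h1.trans ?_
  have h2 : ∑ p ∈ P, (κ:ℝ)/p ≤ κ * (Real.log (Real.log z) + C) := by
    calc _ ≤ ∑ p ∈ prs z, (κ:ℝ)/p := Finset.sum_le_sum_of_subset_of_nonneg hP (fun _ _ _ => by positivity)
      _ = κ * ∑ p ∈ prs z, 1/(p:ℝ) := by rw [Finset.mul_sum]; apply Finset.sum_congr rfl; intro p _; ring
      _ ≤ _ := by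
        apply mul_le_mul_of_nonneg_left _ (by positivity)
        have := (abs_le.1 (hm z hz)).2
        linarith
  calc _ ≤ Real.exp (κ * (Real.log (Real.log z) + C)) := Real.exp_le_exp.2 h2
    _ = Real.exp (κ*C) * (Real.log z)^κ := by
      have he : Real.exp (Real.log (Real.log z) * κ) = (Real.log z)^κ := by
        rw [Real.exp_mul, Real.exp_log hlz, Real.rpow_natCast]
      rw [← he, ← Real.exp_add]
      congr 1
      ring

lemma totient_lower (q : ℕ) : (q:ℝ) ≤ (Nat.totient q:ℝ) * 2^q.primeFactors.card := by
  have h := Nat.totient_mul_prod_primeFactors q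
  have h1 : ∏ p ∈ q.primeFactors, p ≤ 2^q.primeFactors.card * ∏ p ∈ q.primeFactors, (p-1) := by
    rw [← Finset.prod_const, ← Finset.prod_mul_distrib]
    apply Finset.prod_le_prod'
    intro p hp
    have := (Nat.prime_of_mem_primeFactors hp).two_le
    omega
  have h2 : 0 < ∏ p ∈ q.primeFactors, (p-1) := Finset.prod_pos fun p hp => by
    have := (Nat.prime_of_mem_primeFactors hp).two_le
    omega
  have h3 : q * ∏ p ∈ q.primeFactors, (p-1) ≤ (Nat.totient q * 2^q.primeFactors.card) * ∏ p ∈ q.primeFactors, (p-1) := by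
    rw [← h, mul_assoc]
    exact Nat.mul_le_mul_left _ h1
  have := Nat.le_of_mul_le_mul_right h3 h2
  exact_mod_cast this

lemma primeSum_trivial (X q a : ℕ) (hX : 1 ≤ X) (hq : 1 ≤ q) (hqX : q ≤ X) :
    0 ≤ primeSumAP X q a ∧ primeSumAP X q a ≤ 2 * X * Real.log X / q := by
  unfold primeSumAP
  have hlX : 0 ≤ Real.log X := Real.log_natCast_nonneg X
  constructor
  · exact Finset.sum_nonneg fun p _ => Real.log_natCast_nonneg p
  · have hle : ∑ p ∈ (Finset.range (X+1)).filter (fun p => p.Prime ∧ p % q = a % q), Real.log p ≤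
        ∑ p ∈ (Finset.Ioc 0 X).filter (fun p => p ≡ a [MOD q]), Real.log X := by
      refine (Finset.sum_le_sum (g := fun _ => Real.log X) ?_).trans ?_
      · intro p hp
        rw [Finset.mem_filter, Finset.mem_range] at hp
        exact Real.log_le_log (by exact_mod_cast hp.2.1.pos) (by exact_mod_cast (by omega : p ≤ X))
      · apply Finset.sum_le_sum_of_subset_of_nonneg
        · intro p hp
          rw [Finset.mem_filter, Finset.mem_range] at hp
          rw [Finset.mem_filter, Finset.mem_Ioc]
          exact ⟨⟨hp.2.1.pos, by omega⟩, hp.2.2⟩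
        · intros; exact hlX
    refine hle.trans ?_
    rw [Finset.sum_const, nsmul_eq_mul]
    have hc : (((Finset.Ioc 0 X).filter (fun p => p ≡ a [MOD q])).card:ℝ) ≤ 2*X/q := by
      have hqr : (0:ℚ) < q := by exact_mod_cast hq
      have h := Nat.Ioc_filter_modEq_card 0 X (show 0 < q by omega) a
      have hm : ((((Finset.Ioc 0 X).filter (fun p => p ≡ a [MOD q])).card : ℤ) : ℚ) ≤ X/q + 1 := by
        rw [h]
        have f1 := Int.floor_le (((X:ℕ) - a : ℚ)/q)
        have f4 := Int.lt_floor_add_one (((0:ℕ) - a : ℚ)/q)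
        have e2 : ((X:ℕ) - a : ℚ)/q - ((0:ℕ) - a : ℚ)/q = (X:ℚ)/q := by push_cast; field_simp; ring
        push_cast at f1 f4 e2 ⊢
        apply max_le
        · linarith
        · positivity
      have h1 : (1:ℚ) ≤ X/q := by rw [le_div_iff₀ hqr, one_mul]; exact_mod_cast hqX
      have h3 : ((((Finset.Ioc 0 X).filter (fun p => p ≡ a [MOD q])).card : ℕ) : ℚ) ≤ 2*X/q := by
        push_cast at hm
        calc _ ≤ (X:ℚ)/q + 1 := by exact_mod_cast hm
          _ ≤ _ := by rw [mul_div_assoc]; linarith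
      have h9 := (Rat.cast_le (K := ℝ)).2 h3
      push_cast at h9
      exact h9
    calc _ ≤ 2*X/q * Real.log X := mul_le_mul_of_nonneg_right hc hlX
      _ = _ := by ring

lemma Err_trivial (X q : ℕ) (hX : 3 ≤ X) (hq : 1 ≤ q) (hqX : q ≤ X) :
    Err X q ≤ 3 * 2^q.primeFactors.card * (X * Real.log X) / q := by
  have hlX : 1 ≤ Real.log X := by
    rw [Real.le_log_iff_exp_le (by positivity)]
    have h1 : (3:ℝ) ≤ X := by exact_mod_cast hX
    linarith [Real.exp_one_lt_d9]
  unfold Err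
  have h := primeSum_trivial X q (aw X q) (by omega) hq hqX
  have hq0 : (0:ℝ) < q := by exact_mod_cast hq
  have hφ : (0:ℝ) < Nat.totient q := by exact_mod_cast Nat.totient_pos.2 (by omega)
  have h2 : (X:ℝ)/(Nat.totient q) ≤ 2^q.primeFactors.card * X / q := by
    rw [div_le_div_iff₀ hφ hq0]
    have := totient_lower q
    have hX0 : (0:ℝ) ≤ X := by positivity
    nlinarith
  have hpw : (1:ℝ) ≤ 2^q.primeFactors.card := one_le_pow₀ (by norm_num)
  have h3 : (2:ℝ) * X * Real.log X / q ≤ 2 * 2^q.primeFactors.card * (X * Real.log X) / q := by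
    apply div_le_div_of_nonneg_right _ hq0.le
    have : 0 ≤ (X:ℝ) * Real.log X := by positivity
    nlinarith
  have h4 : (2:ℝ)^q.primeFactors.card * X / q ≤ 2^q.primeFactors.card * (X * Real.log X) / q := by
    apply div_le_div_of_nonneg_right _ hq0.le
    apply mul_le_mul_of_nonneg_left _ (by positivity)
    nlinarith [show (0:ℝ) ≤ X by positivity]
  have h5 : 0 ≤ (X:ℝ)/(Nat.totient q) := by positivity
  have e : 3 * 2^q.primeFactors.card * (X * Real.log X) / q = 2 * 2^q.primeFactors.card * (X * Real.log X) / q + 2^q.primeFactors.card * (X * Real.log X) / (q:ℝ) := by ring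
  rw [e, abs_le]
  constructor <;> linarith [h.1, h.2]

lemma Err_EH (hEH : HasLevelOfDistribution 1) (A : ℕ) (hA : 1 ≤ A) : ∃ C : ℝ, 0 < C ∧ ∀ X : ℕ, 2 ≤ X → ∀ Y : ℕ, Y^2 ≤ X →
    ∑ q ∈ Finset.Icc 1 Y, Err X q ≤ C * X / (Real.log X)^A := by
  obtain ⟨C, hC, h⟩ := hEH A (by exact_mod_cast hA) (1/2) (by norm_num)
  refine ⟨C, hC, ?_⟩
  intro X hX Y hY
  have h2 := h X hX (fun q => aw X q) (fun q => aw_coprime X q)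
  rw [Real.rpow_natCast] at h2
  refine le_trans ?_ h2
  apply Finset.sum_le_sum_of_subset_of_nonneg
  · apply Finset.Icc_subset_Icc_right
    apply Nat.le_floor
    have e : (1:ℝ) - 1/2 = 1/2 := by norm_num
    rw [e, ← Real.sqrt_eq_rpow]
    apply Real.le_sqrt_of_sq_le
    exact_mod_cast hY
  · intros; exact abs_nonneg _

lemma EH_err (hEH : HasLevelOfDistribution 1) (k K s W B : ℕ) (hW : 1 ≤ W) : ∃ C : ℝ, 0 < C ∧ ∀ z : ℕ, 3 ≤ z →
    ∀ P ⊆ prs z, ∀ X : ℕ, z ≤ X → (W*(z^s*(z^K)^2))^2 ≤ X →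
    ∑ S ∈ supL P (z^s), ∑ x ∈ prsQ k z (z^K), (k:ℝ)^S.card * Err X (W*((∏ p ∈ S, p) * DD x)) ≤ C * X / (Real.log X)^B := by
  obtain ⟨C1, hC1, h1⟩ := prod_one_add_bound hEH (2*k^2)
  obtain ⟨C2, hC2, h2⟩ := Err_EH hEH (2*B+2*k^2+2) (by omega)
  set Cf : ℝ := ((2^(2*K))^k)^2 with hCf
  have hCfpos : 0 < Cf := by positivity
  set D1 : ℝ := 3*2^(W+2*K)*C1*Cf*2 with hD1
  have hD1pos : 0 < D1 := by positivity
  set D2 : ℝ := Cf*C2 with hD2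
  have hD2pos : 0 < D2 := by positivity
  refine ⟨D1*D2+1, by positivity, ?_⟩
  intro z hz P hP X hzX hX
  have hlX : 1 ≤ Real.log X := by
    rw [Real.le_log_iff_exp_le (by exact_mod_cast (by omega : 0 < X))]
    have h1 : (3:ℝ) ≤ X := by exact_mod_cast hz.trans hzX
    linarith [Real.exp_one_lt_d9]
  set l := Real.log X with hl
  set R := z^K with hR
  set L := z^s with hL
  have hR1 : 1 ≤ R := Nat.one_le_pow _ _ (by omega)
  have hL1 : 1 ≤ L := Nat.one_le_pow _ _ (by omega)
  have hY : W*(L*R^2) ≤ X := le_trans (Nat.le_self_pow (by norm_num) _) hX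
  have hSp : ∀ S ∈ supL P L, ∀ p ∈ S, p.Prime ∧ p ≤ z := by
    intro S hS p hp
    have := hP (Finset.mem_powerset.1 (Finset.mem_filter.1 hS).1 hp)
    rw [mem_prs] at this
    exact ⟨this.2, this.1⟩
  -- first: sum of Err
  have hF2 : ∑ S ∈ supL P L, ∑ x ∈ prsQ k z R, Err X (W*((∏ p ∈ S, p) * DD x)) ≤ D2 * X / l^(2*B+2*k^2+2) := by
    refine (fiber_sum_S k z R K L (by omega) le_rfl P hP (fun q => Err X (W*q)) (fun q => Err_nonneg _ _)).trans ?_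
    have h3 : ∑ q ∈ Finset.Icc 1 (L*R^2), Err X (W*q) ≤ ∑ q ∈ Finset.Icc 1 (W*(L*R^2)), Err X q := by
      rw [← Finset.sum_image (f := fun q => Err X q) (s := Finset.Icc 1 (L*R^2)) (g := fun q => W*q)]
      · apply Finset.sum_le_sum_of_subset_of_nonneg
        · intro q hq
          rw [Finset.mem_image] at hq
          obtain ⟨r, hr, rfl⟩ := hq
          rw [Finset.mem_Icc] at hr ⊢
          exact ⟨Nat.mul_pos hW hr.1, Nat.mul_le_mul_left _ hr.2⟩
        · intros; exact Err_nonneg _ _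
      · intro a _ b _ hab
        exact Nat.eq_of_mul_eq_mul_left hW hab
    have h4 := h3.trans (h2 X (by omega) _ hX)
    calc _ ≤ Cf * (C2 * X / l^(2*B+2*k^2+2)) := mul_le_mul_of_nonneg_left h4 hCfpos.le
      _ = _ := by rw [hD2]; ring
  have hF1 : ∑ S ∈ supL P L, ∑ x ∈ prsQ k z R, ((k:ℝ)^S.card)^2 * Err X (W*((∏ p ∈ S, p) * DD x)) ≤ D1 * X * l^(2*k^2+2) := by
    have hterm : ∀ S ∈ supL P L, ∀ x ∈ prsQ k z R, ((k:ℝ)^S.card)^2 * Err X (W*((∏ p ∈ S, p) * DD x)) ≤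
        3*2^(W+2*K)*X*l*((∏ p ∈ S, (((2*k^2:ℕ):ℝ)/p)) * (1/(DD x:ℝ))) := by
      intro S hS x hx
      have hD := DD_props hx
      have hSpos : 0 < ∏ p ∈ S, p := Finset.prod_pos fun p hp => (hSp S hS p hp).1.pos
      have hSL : ∏ p ∈ S, p ≤ L := (Finset.mem_filter.1 hS).2
      have hq1 : 1 ≤ W*((∏ p ∈ S, p) * DD x) := Nat.mul_pos hW (Nat.mul_pos hSpos hD.1)
      have hqX : W*((∏ p ∈ S, p) * DD x) ≤ X := le_trans (Nat.mul_le_mul_left _ (Nat.mul_le_mul hSL hD.2.1)) hY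
      have hE := Err_trivial X _ (hz.trans hzX) hq1 hqX
      have hom : (W*((∏ p ∈ S, p) * DD x)).primeFactors.card ≤ W + 2*K + S.card := by
        rw [Nat.primeFactors_mul (by omega) (Nat.mul_pos hSpos hD.1).ne', Nat.primeFactors_mul hSpos.ne' (by omega)]
        have c1 : W.primeFactors.card ≤ W := by
          have : W.primeFactors ⊆ Finset.Icc 1 W := by
            intro p hp
            rw [Finset.mem_Icc]
            exact ⟨(Nat.prime_of_mem_primeFactors hp).pos, Nat.le_of_dvd hW (Nat.dvd_of_mem_primeFactors hp)⟩
          have := Finset.card_le_card this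
          simpa using this
        have c2 : (∏ p ∈ S, p).primeFactors = S := Nat.primeFactors_prod (fun p hp => (hSp S hS p hp).1)
        have c3 : (DD x).primeFactors.card ≤ 2*K := by
          apply rough_omega (by omega) hD.2.2 (by omega)
          refine hD.2.1.trans ?_
          rw [hR, ← pow_mul, mul_comm]
        rw [c2]
        refine (Finset.card_union_le _ _).trans ?_
        have := Finset.card_union_le S (DD x).primeFactors
        omega
      have hpw : (2:ℝ)^(W*((∏ p ∈ S, p) * DD x)).primeFactors.card ≤ 2^(W+2*K) * 2^S.card := by
        rw [← pow_add]
        exact pow_le_pow_right₀ (by norm_num) hom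
      have hX0 : (0:ℝ) ≤ X * l := by positivity
      have hSr : (0:ℝ) < ((∏ p ∈ S, p : ℕ):ℝ) := by exact_mod_cast hSpos
      have hDr : (0:ℝ) < (DD x:ℝ) := by exact_mod_cast hD.1
      have hE2 : Err X (W*((∏ p ∈ S, p) * DD x)) ≤ 3*(2^(W+2*K)*2^S.card)*(X*l) / (((∏ p ∈ S, p : ℕ):ℝ) * DD x) := by
        refine hE.trans ?_
        apply div_le_div₀ (by positivity)
        · apply mul_le_mul_of_nonneg_right _ hX0
          apply mul_le_mul_of_nonneg_left hpw (by norm_num)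
        · positivity
        · have : (1:ℝ) ≤ W := by exact_mod_cast hW
          push_cast
          have h0 : (0:ℝ) ≤ (∏ p ∈ S, (p:ℝ)) * DD x := by positivity
          nlinarith
      calc _ ≤ ((k:ℝ)^S.card)^2 * (3*(2^(W+2*K)*2^S.card)*(X*l) / (((∏ p ∈ S, p : ℕ):ℝ) * DD x)) :=
            mul_le_mul_of_nonneg_left hE2 (by positivity)
        _ = _ := by
          rw [Finset.prod_div_distrib, Finset.prod_const]
          push_cast
          rw [mul_pow, ← pow_mul, ← pow_mul, mul_comm 2 S.card]
          field_simp
    calc _ ≤ ∑ S ∈ supL P L, ∑ x ∈ prsQ k z R, 3*2^(W+2*K)*X*l*((∏ p ∈ S, (((2*k^2:ℕ):ℝ)/p)) * (1/(DD x:ℝ))) :=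
          Finset.sum_le_sum fun S hS => Finset.sum_le_sum fun x hx => hterm S hS x hx
      _ = 3*2^(W+2*K)*X*l*((∑ S ∈ supL P L, ∏ p ∈ S, (((2*k^2:ℕ):ℝ)/p)) * ∑ x ∈ prsQ k z R, (1/(DD x:ℝ))) := by
          rw [Finset.sum_mul_sum, Finset.mul_sum]
          apply Finset.sum_congr rfl
          intro S _
          rw [Finset.mul_sum]
      _ ≤ 3*2^(W+2*K)*X*l*((C1*l^(2*k^2)) * (Cf*(2*l))) := by
          apply mul_le_mul_of_nonneg_left _ (by positivity)
          apply mul_le_mul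
          · calc _ ≤ ∑ S ∈ P.powerset, ∏ p ∈ S, (((2*k^2:ℕ):ℝ)/p) := by
                  apply Finset.sum_le_sum_of_subset_of_nonneg (Finset.filter_subset _ _)
                  intros; positivity
              _ ≤ C1 * (Real.log z)^(2*k^2) := h1 z (by omega) P hP
              _ ≤ _ := by
                apply mul_le_mul_of_nonneg_left _ hC1.le
                apply pow_le_pow_left₀ (Real.log_natCast_nonneg z)
                exact Real.log_le_log (by exact_mod_cast (by omega : 0 < z)) (by exact_mod_cast hzX)
          · refine (DD_sum k z R K (by omega) le_rfl hR1).trans ?_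
            apply mul_le_mul_of_nonneg_left _ hCfpos.le
            have : Real.log ((R^2:ℕ):ℝ) ≤ l := by
              apply Real.log_le_log
              · exact_mod_cast (by positivity : 0 < R^2)
              · have : R^2 ≤ W*(L*R^2) := by
                  calc R^2 = 1*(1*R^2) := by ring
                    _ ≤ _ := Nat.mul_le_mul hW (Nat.mul_le_mul_right _ hL1)
                exact_mod_cast this.trans hY
            linarith
          · exact Finset.sum_nonneg fun x _ => by positivity
          · positivity
      _ = _ := by rw [hD1]; ring
  -- Cauchy-Schwarz
  have hCS : (∑ S ∈ supL P L, ∑ x ∈ prsQ k z R, (k:ℝ)^S.card * Err X (W*((∏ p ∈ S, p) * DD x)))^2 ≤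
      (D1 * X * l^(2*k^2+2)) * (D2 * X / l^(2*B+2*k^2+2)) := by
    rw [← Finset.sum_product'] at hF1 hF2 ⊢
    have hcs := Finset.sum_mul_sq_le_sq_mul_sq (supL P L ×ˢ prsQ k z R)
      (fun y => (k:ℝ)^y.1.card * Real.sqrt (Err X (W*((∏ p ∈ y.1, p) * DD y.2))))
      (fun y => Real.sqrt (Err X (W*((∏ p ∈ y.1, p) * DD y.2))))
    have e1 : ∀ y : Finset ℕ × ((Fin k → ℕ) × (Fin k → ℕ)), (k:ℝ)^y.1.card * Real.sqrt (Err X (W*((∏ p ∈ y.1, p) * DD y.2))) * Real.sqrt (Err X (W*((∏ p ∈ y.1, p) * DD y.2)))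
        = (k:ℝ)^y.1.card * Err X (W*((∏ p ∈ y.1, p) * DD y.2)) := by
      intro y; rw [mul_assoc, Real.mul_self_sqrt (Err_nonneg _ _)]
    have e2 : ∀ y : Finset ℕ × ((Fin k → ℕ) × (Fin k → ℕ)), ((k:ℝ)^y.1.card * Real.sqrt (Err X (W*((∏ p ∈ y.1, p) * DD y.2))))^2
        = ((k:ℝ)^y.1.card)^2 * Err X (W*((∏ p ∈ y.1, p) * DD y.2)) := by
      intro y; rw [mul_pow, Real.sq_sqrt (Err_nonneg _ _)]
    have e3 : ∀ y : Finset ℕ × ((Fin k → ℕ) × (Fin k → ℕ)), (Real.sqrt (Err X (W*((∏ p ∈ y.1, p) * DD y.2))))^2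
        = Err X (W*((∏ p ∈ y.1, p) * DD y.2)) := by
      intro y; rw [Real.sq_sqrt (Err_nonneg _ _)]
    simp only [e1, e2, e3] at hcs
    refine hcs.trans ?_
    apply mul_le_mul hF1 hF2 _ (by positivity)
    exact Finset.sum_nonneg fun y _ => Err_nonneg _ _
  have hfin : (∑ S ∈ supL P L, ∑ x ∈ prsQ k z R, (k:ℝ)^S.card * Err X (W*((∏ p ∈ S, p) * DD x)))^2 ≤ ((D1*D2+1) * X / l^B)^2 := by
    refine hCS.trans ?_
    have e : (D1 * X * l^(2*k^2+2)) * (D2 * X / l^(2*B+2*k^2+2)) = D1*D2 * (X / l^B)^2 := by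
      have : l^(2*B+2*k^2+2) = l^(2*k^2+2) * (l^B)^2 := by ring
      rw [this]
      field_simp
    rw [e, mul_div_assoc, mul_pow]
    apply mul_le_mul_of_nonneg_right _ (by positivity)
    have : 0 < D1*D2 := by positivity
    nlinarith
  exact le_of_sq_le_sq hfin (by positivity)

noncomputable def ww {k : ℕ} (Q : Finset ℕ) (lam : (Fin k → ℕ) → ℝ) (h : Fin k → ℕ) (n : ℕ) : ℝ :=
  ∑ d ∈ Fintype.piFinset (fun _ : Fin k => Q), if ∀ i, d i ∣ n + h i then lam d else 0

noncomputable def TP {k : ℕ} (P : Finset ℕ) (h : Fin k → ℕ) (n : ℕ) : Finset ℕ := P.filter (fun p => p ∣ ∏ i, (n + h i))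

noncomputable def NW (N W : ℕ) : Finset ℕ := (Finset.Ioc N (2*N)).filter (fun n => n % W = 1 % W)

lemma ww_sq {k z R : ℕ} (lam : (Fin k → ℕ) → ℝ) (h : Fin k → ℕ) (n : ℕ)
    (hsupp : ∀ d, lam d ≠ 0 → ∏ i, d i ≤ R) :
    (ww (Qs z R) lam h n)^2 = ∑ x ∈ prsQ k z R,
      if (∀ i, x.1 i ∣ n + h i ∧ x.2 i ∣ n + h i) then lam x.1 * lam x.2 else 0 := by
  unfold ww prsQ
  rw [sq, Finset.sum_mul_sum, ← Finset.sum_product', Finset.sum_filter]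
  apply Finset.sum_congr rfl
  intro x _
  by_cases hc : ∏ i, x.1 i ≤ R ∧ ∏ i, x.2 i ≤ R
  · rw [if_pos hc]
    by_cases h1 : ∀ i, x.1 i ∣ n + h i
    · by_cases h2 : ∀ i, x.2 i ∣ n + h i
      · rw [if_pos h1, if_pos h2, if_pos (fun i => ⟨h1 i, h2 i⟩)]
      · rw [if_neg h2, if_neg (fun hh : (∀ i, x.1 i ∣ n + h i ∧ x.2 i ∣ n + h i) => h2 (fun i => (hh i).2)), mul_zero]
    · rw [if_neg h1, if_neg (fun hh : (∀ i, x.1 i ∣ n + h i ∧ x.2 i ∣ n + h i) => h1 (fun i => (hh i).1)), zero_mul]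
  · rw [if_neg hc]
    have : lam x.1 = 0 ∨ lam x.2 = 0 := by
      by_contra hcon
      push Not at hcon
      exact hc ⟨hsupp _ hcon.1, hsupp _ hcon.2⟩
    rcases this with h0 | h0 <;> simp [h0]

lemma M_expand {k z R N W L : ℕ} (P : Finset ℕ) (h : Fin k → ℕ) (f : ℕ → ℝ) (lam : (Fin k → ℕ) → ℝ)
    (hsupp : ∀ d, lam d ≠ 0 → ∏ i, d i ≤ R) (l : Finset ℕ → ℝ) (hl : ∀ S, l S ≠ 0 → S ⊆ P ∧ ∏ p ∈ S, p ≤ L) :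
    ∑ n ∈ NW N W, f n * (ww (Qs z R) lam h n)^2 * ∑ S ∈ (TP P h n).powerset, l S =
    ∑ S ∈ supL P L, ∑ x ∈ prsQ k z R, l S * (lam x.1 * lam x.2) * TT N W h f S x := by
  classical
  have h1 : ∀ n, ∑ S ∈ (TP P h n).powerset, l S = ∑ S ∈ supL P L, if ∀ p ∈ S, p ∣ ∏ i, (n + h i) then l S else 0 := by
    intro n
    unfold TP supL
    rw [sum_powerset_filter, Finset.sum_filter]
    apply Finset.sum_congr rfl
    intro S _
    by_cases hc : ∏ p ∈ S, p ≤ L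
    · rw [if_pos hc]
    · rw [if_neg hc]
      have : l S = 0 := by
        by_contra h0
        exact hc (hl S h0).2
      simp [this]
  have h2 : ∀ S x, TT N W h f S x = ∑ n ∈ NW N W, if ((∀ p ∈ S, p ∣ ∏ i, (n + h i)) ∧ ∀ i, x.1 i ∣ n + h i ∧ x.2 i ∣ n + h i) then f n else 0 := by
    intro S x
    unfold TT NW
    rw [← Finset.sum_filter, Finset.filter_filter]
    apply Finset.sum_congr _ (fun _ _ => rfl)
    apply Finset.filter_congr
    intro n _
    rfl
  calc _ = ∑ n ∈ NW N W, ∑ S ∈ supL P L, ∑ x ∈ prsQ k z R, l S * (lam x.1 * lam x.2) *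
        (if ((∀ p ∈ S, p ∣ ∏ i, (n + h i)) ∧ ∀ i, x.1 i ∣ n + h i ∧ x.2 i ∣ n + h i) then f n else 0) := by
        apply Finset.sum_congr rfl
        intro n _
        rw [h1, ww_sq lam h n hsupp, mul_comm, Finset.sum_mul]
        apply Finset.sum_congr rfl
        intro S _
        rw [Finset.mul_sum, Finset.mul_sum]
        apply Finset.sum_congr rfl
        intro x _
        by_cases a : ∀ p ∈ S, p ∣ ∏ i, (n + h i)
        · by_cases b : ∀ i, x.1 i ∣ n + h i ∧ x.2 i ∣ n + h i
          · rw [if_pos a, if_pos b, if_pos ⟨a, b⟩]; ring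
          · rw [if_neg b, if_neg (fun hh : ((∀ p ∈ S, p ∣ ∏ i, (n + h i)) ∧ ∀ i, x.1 i ∣ n + h i ∧ x.2 i ∣ n + h i) => b hh.2)]; ring
        · rw [if_neg a, if_neg (fun hh : ((∀ p ∈ S, p ∣ ∏ i, (n + h i)) ∧ ∀ i, x.1 i ∣ n + h i ∧ x.2 i ∣ n + h i) => a hh.1)]; ring
    _ = _ := by
        rw [Finset.sum_comm]
        apply Finset.sum_congr rfl
        intro S _
        rw [Finset.sum_comm]
        apply Finset.sum_congr rfl
        intro x _
        rw [h2, Finset.mul_sum]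

lemma M_approx {α β : Type*} (A : Finset α) (B : Finset β) (l : α → ℝ) (hl : ∀ a, |l a| ≤ 1) (v : β → ℝ) (V : ℝ)
    (hv : ∀ b ∈ B, |v b| ≤ V) (T : α → β → ℝ) (X : ℝ) (hX : 0 ≤ X) (g : α → ℝ) (hg : ∀ a ∈ A, 0 ≤ g a) (b' c : β → ℝ)
    (E : α → β → ℝ) (hE : ∀ a ∈ A, ∀ b ∈ B, |T a b - X * g a * b' b| ≤ E a b) :
    |∑ a ∈ A, ∑ b ∈ B, l a * v b * T a b - X * (∑ a ∈ A, l a * g a) * (∑ b ∈ B, v b * c b)| ≤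
      V * (∑ a ∈ A, ∑ b ∈ B, E a b + X * (∑ a ∈ A, g a) * ∑ b ∈ B, |b' b - c b|) := by
  have h1 : X * (∑ a ∈ A, l a * g a) * (∑ b ∈ B, v b * c b) = ∑ a ∈ A, ∑ b ∈ B, l a * v b * (X * g a * c b) := by
    rw [mul_assoc, Finset.sum_mul_sum, Finset.mul_sum]
    apply Finset.sum_congr rfl
    intro a _
    rw [Finset.mul_sum]
    apply Finset.sum_congr rfl
    intro b _
    ring
  have h2 : V * (∑ a ∈ A, ∑ b ∈ B, E a b + X * (∑ a ∈ A, g a) * ∑ b ∈ B, |b' b - c b|) =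
      ∑ a ∈ A, ∑ b ∈ B, V * (E a b + X * g a * |b' b - c b|) := by
    rw [mul_assoc, Finset.sum_mul_sum, Finset.mul_sum, ← Finset.sum_add_distrib, Finset.mul_sum]
    apply Finset.sum_congr rfl
    intro a _
    rw [Finset.mul_sum, ← Finset.sum_add_distrib, Finset.mul_sum]
    apply Finset.sum_congr rfl
    intro b _
    ring
  rw [h1, h2, ← Finset.sum_sub_distrib]
  refine (Finset.abs_sum_le_sum_abs _ _).trans (Finset.sum_le_sum ?_)
  intro a ha
  rw [← Finset.sum_sub_distrib]
  refine (Finset.abs_sum_le_sum_abs _ _).trans (Finset.sum_le_sum ?_)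
  intro b hb
  rw [← mul_sub, abs_mul, abs_mul]
  have hV0 : 0 ≤ V := (abs_nonneg _).trans (hv b hb)
  have h3 : |l a| * |v b| ≤ V := by
    have := mul_le_mul (hl a) (hv b hb) (abs_nonneg _) zero_le_one
    linarith
  apply mul_le_mul h3 _ (abs_nonneg _) hV0
  calc |T a b - X * g a * c b| = |(T a b - X * g a * b' b) + X * g a * (b' b - c b)| := by ring_nf
    _ ≤ |T a b - X * g a * b' b| + |X * g a * (b' b - c b)| := abs_add_le _ _
    _ ≤ _ := by
      rw [abs_mul (X * g a), abs_of_nonneg (mul_nonneg hX (hg a ha))]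
      linarith [hE a ha b hb]

lemma log_pow_le (a : ℕ) : ∃ C : ℝ, 0 < C ∧ ∀ z : ℕ, 2 ≤ z → (Real.log z)^a ≤ C * z := by
  refine ⟨a.factorial, by positivity, ?_⟩
  intro z hz
  have h0 : 0 ≤ Real.log z := Real.log_natCast_nonneg z
  have := Real.pow_div_factorial_le_exp (Real.log z) h0 a
  rw [Real.exp_log (by positivity), div_le_iff₀ (by positivity)] at this
  linarith

lemma res_le_p {k : ℕ} (h : Fin k → ℕ) (p : ℕ) : (res h p).card ≤ p := by
  have : res h p ⊆ Finset.range p := Finset.filter_subset _ _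
  simpa using Finset.card_le_card this

lemma gsum_bound (hEH : HasLevelOfDistribution 1) (κ : ℕ) : ∃ C : ℝ, 0 < C ∧ ∀ z : ℕ, 2 ≤ z → ∀ P ⊆ prs z, ∀ L : ℕ,
    ∀ g : ℕ → ℝ, (∀ p ∈ P, 0 ≤ g p ∧ g p ≤ κ/p) → ∑ S ∈ supL P L, ∏ p ∈ S, g p ≤ C * (Real.log z)^κ := by
  obtain ⟨C, hC, h⟩ := prod_one_add_bound hEH κ
  refine ⟨C, hC, ?_⟩
  intro z hz P hP L g hg
  refine le_trans ?_ (h z hz P hP)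
  calc _ ≤ ∑ S ∈ P.powerset, ∏ p ∈ S, g p := by
        apply Finset.sum_le_sum_of_subset_of_nonneg (Finset.filter_subset _ _)
        intro S hS _
        exact Finset.prod_nonneg fun p hp => (hg p (Finset.mem_powerset.1 hS hp)).1
    _ ≤ _ := by
        apply Finset.sum_le_sum
        intro S hS
        exact Finset.prod_le_prod (fun p hp => (hg p (Finset.mem_powerset.1 hS hp)).1) (fun p hp => (hg p (Finset.mem_powerset.1 hS hp)).2)

lemma card_sum_bound (k z K s : ℕ) (hz : 1 ≤ z) (P : Finset ℕ) (hP : P ⊆ prs z) :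
    ∑ S ∈ supL P (z^s), ∑ _x ∈ prsQ k z (z^K), (k:ℝ)^S.card ≤ ((2^(2*K))^k)^2 * ((z^s)^(k+1) * (z^K)^2) := by
  have h1 := fiber_sum_S k z (z^K) K (z^s) hz le_rfl P hP (fun _ => 1) (fun _ => zero_le_one)
  have h2 : ∀ S ∈ supL P (z^s), (k:ℝ)^S.card ≤ ((z:ℝ)^s)^k := by
    intro S hS
    obtain ⟨hS1, hS2⟩ := Finset.mem_filter.1 hS
    have h3 : 2^S.card ≤ ∏ p ∈ S, p := by
      rw [← Finset.prod_const]
      exact Finset.prod_le_prod' fun p hp => (mem_prs.1 (hP (Finset.mem_powerset.1 hS1 hp))).2.two_le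
    have h4 : k^S.card ≤ (z^s)^k := by
      calc k^S.card ≤ (2^k)^S.card := Nat.pow_le_pow_left (Nat.lt_two_pow_self.le) _
        _ = (2^S.card)^k := by rw [← pow_mul, ← pow_mul, mul_comm]
        _ ≤ _ := Nat.pow_le_pow_left (h3.trans hS2) _
    exact_mod_cast h4
  calc _ ≤ ∑ S ∈ supL P (z^s), ∑ _x ∈ prsQ k z (z^K), ((z:ℝ)^s)^k * 1 := by
        apply Finset.sum_le_sum
        intro S hS
        apply Finset.sum_le_sum
        intro x _
        rw [mul_one]
        exact h2 S hS
    _ = ((z:ℝ)^s)^k * ∑ S ∈ supL P (z^s), ∑ _x ∈ prsQ k z (z^K), 1 := by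
        rw [Finset.mul_sum]
        apply Finset.sum_congr rfl
        intro S _
        rw [Finset.mul_sum]
    _ ≤ ((z:ℝ)^s)^k * (((2^(2*K))^k)^2 * ∑ q ∈ Finset.Icc 1 (z^s*(z^K)^2), 1) := mul_le_mul_of_nonneg_left h1 (by positivity)
    _ = _ := by
        simp only [Finset.sum_const, Nat.card_Icc]
        simp
        ring

lemma log_R_bound (z K : ℕ) (hz : 3 ≤ z) : 1 + Real.log ((z^K)^2+1 : ℕ) ≤ (2*K+2) * Real.log z ∧ 1 ≤ Real.log z := by
  have h1 : 1 ≤ Real.log z := by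
    rw [Real.le_log_iff_exp_le (by positivity)]
    have : (3:ℝ) ≤ z := by exact_mod_cast hz
    linarith [Real.exp_one_lt_d9]
  refine ⟨?_, h1⟩
  have h2 : (z^K)^2+1 ≤ z^(2*K+1) := by
    have : 1 ≤ z^(2*K) := Nat.one_le_pow _ _ (by omega)
    rw [← pow_mul, mul_comm K 2, pow_succ]
    nlinarith
  have h3 : Real.log ((z^K)^2+1 : ℕ) ≤ Real.log ((z^(2*K+1) : ℕ):ℝ) :=
    Real.log_le_log (by positivity) (by exact_mod_cast h2)
  rw [Nat.cast_pow, Real.log_pow] at h3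
  push_cast at h3 ⊢
  nlinarith

lemma inv_le_logpow (a B : ℕ) : ∃ C : ℝ, 0 < C ∧ ∀ z : ℕ, 3 ≤ z → (Real.log z)^a * (1/z) ≤ C / (Real.log z)^B := by
  obtain ⟨C, hC, h⟩ := log_pow_le (a+B)
  refine ⟨C, hC, ?_⟩
  intro z hz
  have h1 := h z (by omega)
  have h2 := (log_R_bound z 0 hz).2
  have hz0 : (0:ℝ) < z := by positivity
  have hl : 0 < Real.log z := by linarith
  rw [le_div_iff₀ (by positivity), mul_one_div, div_mul_eq_mul_div, div_le_iff₀ hz0, ← pow_add]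
  exact h1

set_option maxHeartbeats 1000000 in
lemma err1 (hEH : HasLevelOfDistribution 1) (k K s B : ℕ) : ∃ C : ℝ, 0 < C ∧ ∀ z : ℕ, 3 ≤ z → ∀ N W : ℕ,
    (z^s)^(k+1)*(z^K)^2*z ≤ N → ∀ (P : Finset ℕ) (h : Fin k → ℕ), TupleOK W z P h → ∀ l : Finset ℕ → ℝ, (∀ S, |l S| ≤ 1) →
    ∀ (v : (Fin k → ℕ) × (Fin k → ℕ) → ℝ) (V : ℝ), 0 ≤ V → (∀ x ∈ prsQ k z (z^K), |v x| ≤ V) →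
    |∑ S ∈ supL P (z^s), ∑ x ∈ prsQ k z (z^K), l S * v x * TT N W h (fun _ => 1) S x -
      (N:ℝ)/W * (∑ S ∈ supL P (z^s), l S * ∏ p ∈ S, ((res h p).card:ℝ)/p) * (∑ x ∈ prsQ k z (z^K), v x * (1/(DD x:ℝ)))| ≤
      V * (C * N / (Real.log z)^B) := by
  classical
  obtain ⟨C1, hC1, hg⟩ := gsum_bound hEH k
  obtain ⟨C2, hC2, h2⟩ := inv_le_logpow 0 B
  obtain ⟨C3, hC3, h3⟩ := inv_le_logpow (k+1) B
  obtain ⟨Cf, hCf⟩ : ∃ Cf : ℝ, Cf = ((2^(2*K))^k)^2 := ⟨_, rfl⟩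
  have hCfpos : 0 < Cf := by rw [hCf]; positivity
  refine ⟨Cf * C2 + C1*Cf*(2*K+2)*C3, by positivity, ?_⟩
  intro z hz N W hN P h hT l hl v V hV hv
  have hzpos : (0:ℝ) < z := by positivity
  obtain ⟨hlog, hl1⟩ := log_R_bound z K hz
  have hl0 : 0 < Real.log z := by linarith
  have hW1 : (1:ℝ) ≤ W := by exact_mod_cast hT.W1
  have hNW : (N:ℝ)/W ≤ N := div_le_self (by positivity) hW1
  refine (M_approx (supL P (z^s)) (prsQ k z (z^K)) l hl v V hv (TT N W h (fun _ => 1)) ((N:ℝ)/W) (by positivity)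
    (fun S => ∏ p ∈ S, ((res h p).card:ℝ)/p) (fun S _ => Finset.prod_nonneg fun p _ => by positivity)
    (fun x => if Squarefree (DD x) then 1/(DD x:ℝ) else 0) (fun x => 1/(DD x:ℝ)) (fun S _ => (k:ℝ)^S.card) ?_).trans ?_
  · intro S hS x hx
    have hSP : S ⊆ P := Finset.mem_powerset.1 (Finset.mem_filter.1 hS).1
    by_cases hsq : Squarefree (DD x)
    · rw [if_pos hsq]; exact T1_approx hT hSP hx hsq
    · rw [if_neg hsq, TT_bad hT _ S x hx hsq]; simp
  · apply mul_le_mul_of_nonneg_left _ hV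
    have e1 : ∑ S ∈ supL P (z^s), ∑ _x ∈ prsQ k z (z^K), (k:ℝ)^S.card ≤ Cf * C2 * (N / (Real.log z)^B) := by
      refine (card_sum_bound k z K s (by omega) P hT.Pz).trans ?_
      rw [← hCf]
      have a1 : ((z:ℝ)^s)^(k+1) * ((z:ℝ)^K)^2 ≤ N * (1/z) := by
        rw [mul_one_div, le_div_iff₀ hzpos]
        exact_mod_cast hN
      have a2 := h2 z hz
      rw [pow_zero, one_mul] at a2
      calc _ ≤ Cf * (N * (1/z)) := mul_le_mul_of_nonneg_left a1 hCfpos.le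
        _ ≤ Cf * (N * (C2 / (Real.log z)^B)) := by gcongr
        _ = _ := by ring
    have e2 : ∑ S ∈ supL P (z^s), ∏ p ∈ S, ((res h p).card:ℝ)/p ≤ C1 * (Real.log z)^k := by
      apply hg z (by omega) P hT.Pz
      intro p hp
      refine ⟨by positivity, ?_⟩
      gcongr
      exact_mod_cast res_card_le h p (mem_prs.1 (hT.Pz hp)).2
    have e3 : ∑ x ∈ prsQ k z (z^K), |(if Squarefree (DD x) then 1/(DD x:ℝ) else 0) - 1/(DD x:ℝ)| ≤ Cf * ((1/z) * ((2*K+2)*Real.log z)) := by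
      have := DD_bad_sum k z (z^K) K (by omega) le_rfl (Nat.one_le_pow _ _ (by omega))
      rw [← hCf] at this
      calc _ = ∑ x ∈ (prsQ k z (z^K)).filter (fun x => ¬ Squarefree (DD x)), 1/(DD x:ℝ) := by
            rw [Finset.sum_filter]
            apply Finset.sum_congr rfl
            intro x _
            by_cases hs : Squarefree (DD x)
            · simp [hs]
            · simp [hs]
        _ ≤ _ := this
        _ ≤ _ := by gcongr
    have e4 : (N:ℝ)/W * (∑ S ∈ supL P (z^s), ∏ p ∈ S, ((res h p).card:ℝ)/p) *
        ∑ x ∈ prsQ k z (z^K), |(if Squarefree (DD x) then 1/(DD x:ℝ) else 0) - 1/(DD x:ℝ)| ≤ C1*Cf*(2*K+2)*C3 * (N / (Real.log z)^B) := by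
      calc _ ≤ (N:ℝ) * (C1 * (Real.log z)^k) * (Cf * ((1/z) * ((2*K+2)*Real.log z))) :=
            mul_le_mul (mul_le_mul hNW e2 (Finset.sum_nonneg fun S _ => Finset.prod_nonneg fun p _ => by positivity) (Nat.cast_nonneg _)) e3
              (Finset.sum_nonneg fun x _ => abs_nonneg _) (by positivity)
        _ = C1*Cf*(2*K+2)*N*((Real.log z)^(k+1) * (1/z)) := by ring
        _ ≤ C1*Cf*(2*K+2)*N*(C3 / (Real.log z)^B) := by
            gcongr
            exact h3 z hz
        _ = _ := by ring
    calc _ ≤ Cf * C2 * (N / (Real.log z)^B) + C1*Cf*(2*K+2)*C3 * (N / (Real.log z)^B) := add_le_add e1 e4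
      _ = _ := by ring

lemma resm_bound {k : ℕ} (h : Fin k → ℕ) (m : Fin k) (p : ℕ) (hp : p.Prime) :
    0 ≤ ((resm h m p).card:ℝ)/((p:ℝ)-1) ∧ ((resm h m p).card:ℝ)/((p:ℝ)-1) ≤ ((res h p).card:ℝ)/p := by
  have h1 : ((resm h m p).card:ℝ) + 1 = (res h p).card := by exact_mod_cast resm_card h m p hp
  have h2 : ((res h p).card:ℝ) ≤ p := by exact_mod_cast res_le_p h p
  have h3 : (2:ℝ) ≤ p := by exact_mod_cast hp.two_le
  have h4 : (0:ℝ) < (p:ℝ) - 1 := by linarith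
  refine ⟨by positivity, ?_⟩
  rw [div_le_div_iff₀ h4 (by linarith)]
  nlinarith

lemma phi_diff {z n K : ℕ} (hz : 2*K+2 ≤ z) (h : Rough z n) (hn : n ≠ 0) (hK : n ≤ z^K) :
    |1/(Nat.totient n:ℝ) - 1/(n:ℝ)| ≤ 2*K * (1/z) * (1/n) := by
  have h1 := rough_phi (by omega) h hn hK
  have hz0 : (0:ℝ) < z := by
    have : 0 < z := by omega
    exact_mod_cast this
  have hn0 : (0:ℝ) < n := by exact_mod_cast Nat.pos_of_ne_zero hn
  have hz1 : (2*K+2:ℝ) ≤ z := by exact_mod_cast hz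
  have h2 : (K:ℝ)/z ≤ 1/2 := by rw [div_le_iff₀ hz0]; linarith
  have hle : (Nat.totient n:ℝ) ≤ n := by exact_mod_cast Nat.totient_le n
  have hphi : (n:ℝ)/2 ≤ Nat.totient n := by
    refine le_trans ?_ h1
    nlinarith
  have hphi0 : (0:ℝ) < Nat.totient n := by linarith
  have h3 : 1/(Nat.totient n:ℝ) - 1/(n:ℝ) = (n - Nat.totient n)/(Nat.totient n * n) := by
    field_simp
  rw [h3, abs_of_nonneg (div_nonneg (by linarith) (by positivity)), div_le_iff₀ (by positivity)]
  have h4 : 2*K * (1/(z:ℝ)) * (1/n) * (Nat.totient n * n) = 2*(K/z)*Nat.totient n := by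
    field_simp
  rw [h4]
  have h5 : 0 ≤ (K:ℝ)/z := by positivity
  nlinarith

set_option maxHeartbeats 1000000 in
lemma err2 (hEH : HasLevelOfDistribution 1) (k K s W B : ℕ) (hW : 1 ≤ W) : ∃ C : ℝ, 0 < C ∧ ∀ z : ℕ, 3 ≤ z → 4*K+2 ≤ z → ∀ N : ℕ,
    (W*(z^s*(z^K)^2))^2 ≤ N → z ≤ N → ∀ (P : Finset ℕ) (h : Fin k → ℕ), TupleOK W z P h → ∀ m : Fin k, 
    ∀ l : Finset ℕ → ℝ, (∀ S, |l S| ≤ 1) →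
    ∀ (v : (Fin k → ℕ) × (Fin k → ℕ) → ℝ) (V : ℝ), 0 ≤ V → (∀ x ∈ prsQ k z (z^K), |v x| ≤ V) →
    |∑ S ∈ supL P (z^s), ∑ x ∈ prsQ k z (z^K), l S * v x * TT N W h (fun n => theta (n + h m)) S x -
      (N:ℝ)/(Nat.totient W) * (∑ S ∈ supL P (z^s), l S * ∏ p ∈ S, ((resm h m p).card:ℝ)/((p:ℝ)-1)) *
       (∑ x ∈ prsQ k z (z^K), v x * (if (x.1 m = 1 ∧ x.2 m = 1) then 1/(DD x:ℝ) else 0))| ≤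
      V * (C * N / (Real.log z)^B) := by
  classical
  obtain ⟨C1, hC1, hg⟩ := gsum_bound hEH k
  obtain ⟨C2, hC2, h2⟩ := EH_err hEH k K s W B hW
  obtain ⟨C3, hC3, h3⟩ := inv_le_logpow (k+1) B
  obtain ⟨Cf, hCf⟩ : ∃ Cf : ℝ, Cf = ((2^(2*K))^k)^2 := ⟨_, rfl⟩
  have hCfpos : 0 < Cf := by rw [hCf]; positivity
  refine ⟨C2*5 + C1*(Cf*(2*K+2)*(4*K+1))*C3, by positivity, ?_⟩
  intro z hz hz4 N hN hzN P h hT m l hl v V hV hv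
  have hzpos : (0:ℝ) < z := by positivity
  obtain ⟨hlog, hl1⟩ := log_R_bound z K hz
  have hl0 : 0 < Real.log z := by linarith
  have hW1 : (1:ℝ) ≤ Nat.totient W := by exact_mod_cast Nat.totient_pos.2 hW
  have hNW : (N:ℝ)/(Nat.totient W) ≤ N := div_le_self (by positivity) hW1
  have hRpos : 1 ≤ z^K := Nat.one_le_pow _ _ (by omega)
  have hspos : 1 ≤ z^s := Nat.one_le_pow _ _ (by omega)
  have hR2N : (z^K)^2 ≤ N := by
    refine le_trans ?_ hN
    have : (z^K)^2 ≤ W*(z^s*(z^K)^2) := by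
      calc (z^K)^2 = 1*(1*(z^K)^2) := by ring
        _ ≤ _ := Nat.mul_le_mul hW (Nat.mul_le_mul_right _ hspos)
    refine this.trans (Nat.le_self_pow (by norm_num) _)
  have hRN : z^K ≤ N := (Nat.le_self_pow (by norm_num) _).trans hR2N
  refine (M_approx (supL P (z^s)) (prsQ k z (z^K)) l hl v V hv (TT N W h (fun n => theta (n + h m))) ((N:ℝ)/(Nat.totient W)) (by positivity)
    (fun S => ∏ p ∈ S, ((resm h m p).card:ℝ)/((p:ℝ)-1)) (fun S hS => Finset.prod_nonneg fun p hp =>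
      (resm_bound h m p (mem_prs.1 (hT.Pz (Finset.mem_powerset.1 (Finset.mem_filter.1 hS).1 hp))).2).1)
    (fun x => if (x.1 m = 1 ∧ x.2 m = 1) then (if Squarefree (DD x) then 1/(Nat.totient (DD x):ℝ) else 0) else 0)
    (fun x => if (x.1 m = 1 ∧ x.2 m = 1) then 1/(DD x:ℝ) else 0)
    (fun S x => (k:ℝ)^S.card * Err (2*N+h m) (W*((∏ p ∈ S, p) * DD x)) + (k:ℝ)^S.card * Err (N+h m) (W*((∏ p ∈ S, p) * DD x))) ?_).trans ?_
  · intro S hS x hx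
    have hSP : S ⊆ P := Finset.mem_powerset.1 (Finset.mem_filter.1 hS).1
    have hE0 : 0 ≤ (k:ℝ)^S.card * Err (2*N+h m) (W*((∏ p ∈ S, p) * DD x)) + (k:ℝ)^S.card * Err (N+h m) (W*((∏ p ∈ S, p) * DD x)) := by
      have := Err_nonneg (2*N+h m) (W*((∏ p ∈ S, p) * DD x))
      have := Err_nonneg (N+h m) (W*((∏ p ∈ S, p) * DD x))
      positivity
    by_cases hm : x.1 m = 1 ∧ x.2 m = 1
    · rw [if_pos hm]
      by_cases hsq : Squarefree (DD x)
      · rw [if_pos hsq, ← mul_add]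
        exact T2_approx hT m hR2N hzN hSP hx hsq hm
      · rw [if_neg hsq, TT_bad hT _ S x hx hsq]; simpa using hE0
    · rw [if_neg hm, T2_zero m hRN S hx hm]; simpa using hE0
  · apply mul_le_mul_of_nonneg_left _ hV
    have e0 : ∀ X : ℕ, N ≤ X → ∑ S ∈ supL P (z^s), ∑ x ∈ prsQ k z (z^K), (k:ℝ)^S.card * Err X (W*((∏ p ∈ S, p) * DD x)) ≤ C2 * X / (Real.log z)^B := by
      intro X hX
      refine (h2 z hz P hT.Pz X (hzN.trans hX) (hN.trans hX)).trans ?_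
      have : (z:ℝ) ≤ X := by exact_mod_cast hzN.trans hX
      gcongr
    have e1 : ∑ S ∈ supL P (z^s), ∑ x ∈ prsQ k z (z^K), ((k:ℝ)^S.card * Err (2*N+h m) (W*((∏ p ∈ S, p) * DD x)) + (k:ℝ)^S.card * Err (N+h m) (W*((∏ p ∈ S, p) * DD x)))
        ≤ C2*5*(N / (Real.log z)^B) := by
      simp_rw [Finset.sum_add_distrib]
      have a1 := e0 (2*N+h m) (by omega)
      have a2 := e0 (N+h m) (by omega)
      have hm : (h m:ℝ) ≤ N := by exact_mod_cast (hT.le m).trans hzN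
      calc _ ≤ _ := add_le_add a1 a2
        _ = C2 * (3*N+2*h m) / (Real.log z)^B := by push_cast; ring
        _ ≤ C2 * (5*N) / (Real.log z)^B := by gcongr; linarith
        _ = _ := by ring
    have e2 : ∑ S ∈ supL P (z^s), ∏ p ∈ S, ((resm h m p).card:ℝ)/((p:ℝ)-1) ≤ C1 * (Real.log z)^k := by
      apply hg z (by omega) P hT.Pz
      intro p hp
      have hpp := (mem_prs.1 (hT.Pz hp)).2
      obtain ⟨r1, r2⟩ := resm_bound h m p hpp
      refine ⟨r1, r2.trans ?_⟩
      gcongr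
      exact_mod_cast res_card_le h p hpp
    have e3 : ∑ x ∈ prsQ k z (z^K), |(if (x.1 m = 1 ∧ x.2 m = 1) then (if Squarefree (DD x) then 1/(Nat.totient (DD x):ℝ) else 0) else 0)
          - (if (x.1 m = 1 ∧ x.2 m = 1) then 1/(DD x:ℝ) else 0)| ≤ (Cf * (2*K+2)*(4*K+1)) * ((1/z) * Real.log z) := by
      have b1 := DD_bad_sum k z (z^K) K (by omega) le_rfl hRpos
      have b2 := DD_sum k z (z^K) K (by omega) le_rfl hRpos
      rw [← hCf] at b1 b2
      calc _ ≤ ∑ x ∈ prsQ k z (z^K), ((if ¬ Squarefree (DD x) then 1/(DD x:ℝ) else 0) + (4*K*(1/z))*(1/(DD x:ℝ))) := by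
            apply Finset.sum_le_sum
            intro x hx
            obtain ⟨d1, d2, d3⟩ := DD_props hx
            have hp : 0 ≤ (4*K*(1/(z:ℝ)))*(1/(DD x:ℝ)) := by positivity
            by_cases hm : x.1 m = 1 ∧ x.2 m = 1
            · rw [if_pos hm, if_pos hm]
              by_cases hs : Squarefree (DD x)
              · rw [if_pos hs, if_neg (not_not.2 hs), zero_add]
                have := phi_diff (z := z) (n := DD x) (K := 2*K) (by omega) d3 (by omega) (by rw [mul_comm, pow_mul]; exact d2)
                refine this.trans (le_of_eq ?_)
                push_cast
                ring
              · rw [if_neg hs, if_pos hs, zero_sub, abs_neg, abs_of_nonneg (by positivity)]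
                linarith
            · rw [if_neg hm, if_neg hm, sub_zero, abs_zero]
              positivity
        _ = ∑ x ∈ (prsQ k z (z^K)).filter (fun x => ¬ Squarefree (DD x)), 1/(DD x:ℝ) + (4*K*(1/z)) * ∑ x ∈ prsQ k z (z^K), 1/(DD x:ℝ) := by
            rw [Finset.sum_add_distrib, Finset.sum_filter, Finset.mul_sum]
        _ ≤ Cf * (1/(z:ℝ) * ((2*K+2) * Real.log z)) + (4*K*(1/z)) * (Cf * ((2*K+2) * Real.log z)) := by
            have b3 : 1 + Real.log (((z^K)^2:ℕ):ℝ) ≤ (2*K+2) * Real.log z := by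
              refine le_trans ?_ hlog
              gcongr
              exact Nat.le_succ _
            refine add_le_add (b1.trans ?_) (mul_le_mul_of_nonneg_left (b2.trans ?_) (by positivity))
            · gcongr
            · gcongr
        _ = _ := by ring
    have e4 : (N:ℝ)/(Nat.totient W) * (∑ S ∈ supL P (z^s), ∏ p ∈ S, ((resm h m p).card:ℝ)/((p:ℝ)-1)) *
        ∑ x ∈ prsQ k z (z^K), |(if (x.1 m = 1 ∧ x.2 m = 1) then (if Squarefree (DD x) then 1/(Nat.totient (DD x):ℝ) else 0) else 0)
          - (if (x.1 m = 1 ∧ x.2 m = 1) then 1/(DD x:ℝ) else 0)| ≤ C1*(Cf*(2*K+2)*(4*K+1))*C3 * (N / (Real.log z)^B) := by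
      calc _ ≤ (N:ℝ) * (C1 * (Real.log z)^k) * ((Cf * (2*K+2)*(4*K+1)) * ((1/z) * Real.log z)) :=
            mul_le_mul (mul_le_mul hNW e2 (Finset.sum_nonneg fun S hS => Finset.prod_nonneg fun p hp =>
              (resm_bound h m p (mem_prs.1 (hT.Pz (Finset.mem_powerset.1 (Finset.mem_filter.1 hS).1 hp))).2).1) (Nat.cast_nonneg _)) e3
              (Finset.sum_nonneg fun x _ => abs_nonneg _) (by positivity)
        _ = C1*(Cf*(2*K+2)*(4*K+1))*N*((Real.log z)^(k+1) * (1/z)) := by ring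
        _ ≤ C1*(Cf*(2*K+2)*(4*K+1))*N*(C3 / (Real.log z)^B) := by
            gcongr
            exact h3 z hz
        _ = _ := by ring
    calc _ ≤ C2*5*(N / (Real.log z)^B) + C1*(Cf*(2*K+2)*(4*K+1))*C3 * (N / (Real.log z)^B) := add_le_add e1 e4
      _ = _ := by ring

noncomputable def Wk (k : ℕ) : ℕ := (4*k).factorial
noncomputable def Pk (k z : ℕ) : Finset ℕ := (prs z).filter (fun p => 4*k < p)

lemma Wk_pos (k : ℕ) : 1 ≤ Wk k := Nat.factorial_pos _

lemma mem_Pk {k z p : ℕ} : p ∈ Pk k z ↔ (p ≤ z ∧ p.Prime) ∧ 4*k < p := by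
  rw [Pk, Finset.mem_filter, mem_prs]

lemma Pk_sub (k z : ℕ) : Pk k z ⊆ prs z := Finset.filter_subset _ _

lemma tuple_mk {k k' z : ℕ} (hz : 4*k ≤ z) (h : Fin k' → ℕ) (hinj : Function.Injective h) (hd : ∀ i, Wk k ∣ h i) (hle : ∀ i, h i ≤ z) :
    TupleOK (Wk k) z (Pk k z) h where
  W1 := Wk_pos k
  inj := hinj
  dvd := hd
  le := hle
  Wz := by
    intro p hp hpd
    exact ((Nat.Prime.dvd_factorial hp).1 hpd).trans hz
  Pz := Pk_sub k z
  PW := by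
    intro p hp
    rw [mem_Pk] at hp
    rw [Wk, Nat.Prime.coprime_iff_not_dvd hp.1.2, Nat.Prime.dvd_factorial hp.1.2]
    omega

lemma TP_empty_iff {k k' z n : ℕ} (h : Fin k' → ℕ) (hd : ∀ i, Wk k ∣ h i) (hn : n % Wk k = 1 % Wk k) :
    TP (Pk k z) h n = ∅ ↔ ∀ i, Rough z (n + h i) := by
  unfold TP
  rw [Finset.filter_eq_empty_iff]
  constructor
  · intro H i p hp hpd
    by_contra hle
    by_cases h4 : 4*k < p
    · exact H (mem_Pk.2 ⟨⟨by omega, hp⟩, h4⟩) (hpd.trans (Finset.dvd_prod_of_mem (fun i => n + h i) (Finset.mem_univ i)))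
    · have hpW : p ∣ Wk k := (Nat.Prime.dvd_factorial hp).2 (by omega)
      have h1 : p ∣ n := (Nat.dvd_add_left (hpW.trans (hd i))).1 hpd
      have h2 : n % p = 1 % p := by
        have := congrArg (· % p) hn
        simpa [Nat.mod_mod_of_dvd _ hpW] using this
      rw [Nat.mod_eq_zero_of_dvd h1, Nat.mod_eq_of_lt hp.one_lt] at h2
      omega
  · intro H p hp hpd
    rw [mem_Pk] at hp
    obtain ⟨i, _, hi⟩ := (hp.1.2.prime.dvd_finsetProd_iff _).1 hpd
    have := H i p hp.1.2 hi
    omega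

lemma V_ratio {k k' z : ℕ} (hz : 4*k ≤ z) (h : Fin k' → ℕ) (m : Fin k') :
    (∏ p ∈ Pk k z, (1 - ((resm h m p).card:ℝ)/((p:ℝ)-1))) * (Wk k * Vp z) =
    Nat.totient (Wk k) * ∏ p ∈ Pk k z, (1 - ((res h p).card:ℝ)/p) := by
  have h1 : (Nat.totient (Wk k) : ℝ) = Wk k * ∏ p ∈ (prs z).filter (fun p => ¬ 4*k < p), (1 - 1/(p:ℝ)) := by
    have := congrArg (fun x : ℚ => (x:ℝ)) (Nat.totient_eq_mul_prod_factors (Wk k))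
    push_cast at this
    rw [this]
    congr 1
    have hs : (Wk k).primeFactors = (prs z).filter (fun p => ¬ 4*k < p) := by
      ext p
      rw [Nat.mem_primeFactors_of_ne_zero (by have := Wk_pos k; omega), Finset.mem_filter, mem_prs]
      constructor
      · rintro ⟨hp, hd⟩
        have := (Nat.Prime.dvd_factorial hp).1 hd
        exact ⟨⟨by omega, hp⟩, by omega⟩
      · rintro ⟨⟨_, hp⟩, hl⟩
        exact ⟨hp, (Nat.Prime.dvd_factorial hp).2 (by omega)⟩
    rw [hs]
    apply Finset.prod_congr rfl
    intro p _
    rw [one_div]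
  have h2 : Vp z = (∏ p ∈ Pk k z, (1 - 1/(p:ℝ))) * ∏ p ∈ (prs z).filter (fun p => ¬ 4*k < p), (1 - 1/(p:ℝ)) := by
    unfold Vp Pk
    rw [Finset.prod_filter_mul_prod_filter_not]
  have h3 : ∏ p ∈ Pk k z, (1 - ((res h p).card:ℝ)/p) =
      (∏ p ∈ Pk k z, (1 - ((resm h m p).card:ℝ)/((p:ℝ)-1))) * ∏ p ∈ Pk k z, (1 - 1/(p:ℝ)) := by
    rw [← Finset.prod_mul_distrib]
    apply Finset.prod_congr rfl
    intro p hp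
    have hpp := (mem_Pk.1 hp).1.2
    have h1 : ((resm h m p).card:ℝ) + 1 = (res h p).card := by exact_mod_cast resm_card h m p hpp
    rw [← h1]
    have h3 : (2:ℝ) ≤ p := by exact_mod_cast hpp.two_le
    have h4 : (p:ℝ) - 1 ≠ 0 := by intro hh; linarith
    have h5 : (p:ℝ) ≠ 0 := by intro hh; linarith
    field_simp
    ring
  rw [h1, h2, h3]
  ring

lemma supL_sum (P : Finset ℕ) (L : ℕ) (l g : Finset ℕ → ℝ) (hl : ∀ S, l S ≠ 0 → S ⊆ P ∧ ∏ p ∈ S, p ≤ L) :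
    ∑ S ∈ supL P L, l S * g S = ∑ S ∈ P.powerset, l S * g S := by
  apply Finset.sum_subset (Finset.filter_subset _ _)
  intro S hS hn
  have : l S = 0 := by
    by_contra h0
    exact hn (Finset.mem_filter.2 ⟨hS, (hl S h0).2⟩)
  rw [this, zero_mul]

lemma prsQ_sum1 {k z R : ℕ} (lam : (Fin k → ℕ) → ℝ) (hsupp : ∀ d, lam d ≠ 0 → ∏ i, d i ≤ R) :
    ∑ x ∈ prsQ k z R, lam x.1 * lam x.2 * (1/(DD x:ℝ)) =
    ∑ d ∈ Fintype.piFinset (fun _ : Fin k => Qs z R), ∑ e ∈ Fintype.piFinset (fun _ : Fin k => Qs z R),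
      lam d * lam e / ∏ i, (Nat.lcm (d i) (e i) : ℝ) := by
  rw [← Finset.sum_product', prsQ]
  rw [Finset.sum_filter]
  apply Finset.sum_congr rfl
  intro x _
  have hD : (DD x:ℝ) = ∏ i, (Nat.lcm (x.1 i) (x.2 i) : ℝ) := by unfold DD; push_cast; rfl
  rw [hD, mul_one_div]
  by_cases hc : ∏ i, x.1 i ≤ R ∧ ∏ i, x.2 i ≤ R
  · rw [if_pos hc]
  · rw [if_neg hc]
    have : lam x.1 = 0 ∨ lam x.2 = 0 := by
      by_contra hcon
      push Not at hcon
      exact hc ⟨hsupp _ hcon.1, hsupp _ hcon.2⟩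
    rcases this with h0 | h0 <;> simp [h0]

lemma prsQ_sum2 {k z R : ℕ} (hR : 1 ≤ R) (lam : (Fin k → ℕ) → ℝ) (hsupp : ∀ d, lam d ≠ 0 → ∏ i, d i ≤ R) (m : Fin k) :
    ∑ x ∈ prsQ k z R, lam x.1 * lam x.2 * (if (x.1 m = 1 ∧ x.2 m = 1) then 1/(DD x:ℝ) else 0) =
    ∑ d ∈ Fintype.piFinset (Qm (Qs z R) m), ∑ e ∈ Fintype.piFinset (Qm (Qs z R) m),
      lam d * lam e / ∏ i, (Nat.lcm (d i) (e i) : ℝ) := by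
  classical
  have h1Q : 1 ∈ Qs z R := by
    rw [mem_Qs]
    refine ⟨⟨le_rfl, hR⟩, squarefree_one, ?_⟩
    intro p hp hd
    have := hp.one_lt
    have := Nat.le_of_dvd one_pos hd
    omega
  have hset : Fintype.piFinset (Qm (Qs z R) m) = (Fintype.piFinset (fun _ : Fin k => Qs z R)).filter (fun d => d m = 1) := by
    ext d
    rw [Finset.mem_filter, Fintype.mem_piFinset, Fintype.mem_piFinset]
    constructor
    · intro h
      have hm := h m
      rw [Qm, if_pos rfl, Finset.mem_singleton] at hm
      refine ⟨fun i => ?_, hm⟩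
      have hi := h i
      unfold Qm at hi
      by_cases him : i = m
      · rw [him, hm]; exact h1Q
      · rwa [if_neg him] at hi
    · rintro ⟨h, hm⟩ i
      unfold Qm
      by_cases him : i = m
      · rw [if_pos him, him, Finset.mem_singleton]; exact hm
      · rw [if_neg him]; exact h i
  rw [hset, ← Finset.sum_product', prsQ, ← Finset.filter_product, Finset.sum_filter, Finset.sum_filter]
  apply Finset.sum_congr rfl
  intro x _
  have hD : (DD x:ℝ) = ∏ i, (Nat.lcm (x.1 i) (x.2 i) : ℝ) := by unfold DD; push_cast; rfl
  rw [hD]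
  by_cases hc : ∏ i, x.1 i ≤ R ∧ ∏ i, x.2 i ≤ R
  · rw [if_pos hc]
    by_cases hm : x.1 m = 1 ∧ x.2 m = 1
    · rw [if_pos hm, if_pos hm, mul_one_div]
    · rw [if_neg hm, if_neg hm, mul_zero]
  · rw [if_neg hc]
    have : lam x.1 = 0 ∨ lam x.2 = 0 := by
      by_contra hcon
      push Not at hcon
      exact hc ⟨hsupp _ hcon.1, hsupp _ hcon.2⟩
    rcases this with h0 | h0 <;> simp [h0]

lemma ww_bound {k z R M n : ℕ} (hz : 1 ≤ z) (lam : (Fin k → ℕ) → ℝ) (Λ : ℝ) (hΛ : 0 ≤ Λ)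
    (hlam : ∀ d ∈ Fintype.piFinset (fun _ : Fin k => Qs z R), |lam d| ≤ Λ) (h : Fin k → ℕ)
    (hr : ∀ i, Rough z (n + h i)) (hn : 1 ≤ n) (hle : ∀ i, n + h i ≤ z^M) :
    (ww (Qs z R) lam h n)^2 ≤ (Λ * (2^M)^k)^2 := by
  classical
  have key : |ww (Qs z R) lam h n| ≤ Λ * (2^M)^k := by
    unfold ww
    rw [← Finset.sum_filter]
    refine (Finset.abs_sum_le_sum_abs _ _).trans ?_
    refine (Finset.sum_le_card_nsmul _ _ Λ (fun d hd => hlam d (Finset.mem_filter.1 hd).1)).trans ?_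
    rw [nsmul_eq_mul, mul_comm]
    apply mul_le_mul_of_nonneg_left _ hΛ
    have hsub : (Fintype.piFinset (fun _ : Fin k => Qs z R)).filter (fun d => ∀ i, d i ∣ n + h i) ⊆
        Fintype.piFinset (fun i => (n + h i).divisors) := by
      intro d hd
      rw [Fintype.mem_piFinset]
      intro i
      rw [Nat.mem_divisors]
      exact ⟨(Finset.mem_filter.1 hd).2 i, by omega⟩
    have h1 := Finset.card_le_card hsub
    rw [Fintype.card_piFinset] at h1
    have h2 : ∏ i, (n + h i).divisors.card ≤ (2^M)^k := by
      calc _ ≤ ∏ _i : Fin k, 2^M := Finset.prod_le_prod' fun i _ => rough_divisors z hz M _ (hr i) (by omega) (hle i)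
        _ = _ := by simp
    exact_mod_cast h1.trans h2
  exact sq_le_sq' (abs_le.1 key).1 (abs_le.1 key).2

lemma sieve_up {k L : ℕ} {P : Finset ℕ} {lp lm : Finset ℕ → ℝ} (hS : SieveOK P L lp lm) (N W : ℕ) (h : Fin k → ℕ) (f w : ℕ → ℝ)
    (hf : ∀ n, 0 ≤ f n) (hw : ∀ n, 0 ≤ w n) :
    ∑ n ∈ (NW N W).filter (fun n => TP P h n = ∅), f n * w n ≤ ∑ n ∈ NW N W, f n * w n * ∑ S ∈ (TP P h n).powerset, lp S := by
  rw [Finset.sum_filter]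
  apply Finset.sum_le_sum
  intro n _
  have h1 := hS.upper (TP P h n) (Finset.filter_subset _ _)
  have h2 := mul_le_mul_of_nonneg_left h1 (mul_nonneg (hf n) (hw n))
  refine le_trans (le_of_eq ?_) h2
  split_ifs <;> simp

lemma sieve_lo {k L : ℕ} {P : Finset ℕ} {lp lm : Finset ℕ → ℝ} (hS : SieveOK P L lp lm) (N W : ℕ) (h : Fin k → ℕ) (f w : ℕ → ℝ)
    (hf : ∀ n, 0 ≤ f n) (hw : ∀ n, 0 ≤ w n) :
    ∑ n ∈ NW N W, f n * w n * ∑ S ∈ (TP P h n).powerset, lm S ≤ ∑ n ∈ (NW N W).filter (fun n => TP P h n = ∅), f n * w n := by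
  rw [Finset.sum_filter]
  apply Finset.sum_le_sum
  intro n _
  have h1 := hS.lower (TP P h n) (Finset.filter_subset _ _)
  have h2 := mul_le_mul_of_nonneg_left h1 (mul_nonneg (hf n) (hw n))
  refine le_trans h2 (le_of_eq ?_)
  split_ifs <;> simp

lemma core_ineq {k : ℕ} (A : Finset ℕ) (w : ℕ → ℝ) (hw : ∀ n, 0 ≤ w n) (Wm : ℝ) (hWm : ∀ n ∈ A, w n ≤ Wm) (h : Fin k → ℕ)
    (l : ℝ) (hl0 : 0 ≤ l) (hl : ∀ n ∈ A, ∀ m, Real.log (n + h m : ℕ) ≤ l) (U1 U2 : ℝ)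
    (h1 : ∑ n ∈ A, w n ≤ U1) (h2 : ∀ m, U2 ≤ ∑ n ∈ A, theta (n + h m) * w n) :
    k * U2 - 2 * l * U1 ≤ (A.filter (fun n => 3 ≤ (Finset.univ.filter (fun i => (n + h i).Prime)).card)).card * (Wm * (k * l)) := by
  have e1 : (k:ℝ) * U2 ≤ ∑ n ∈ A, (∑ m, theta (n + h m)) * w n := by
    calc (k:ℝ) * U2 = ∑ _m : Fin k, U2 := by simp
      _ ≤ ∑ m : Fin k, ∑ n ∈ A, theta (n + h m) * w n := Finset.sum_le_sum fun m _ => h2 m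
      _ = _ := by
        rw [Finset.sum_comm]
        apply Finset.sum_congr rfl
        intro n _
        rw [Finset.sum_mul]
  have e2 : 2 * l * ∑ n ∈ A, w n ≤ 2 * l * U1 := mul_le_mul_of_nonneg_left h1 (by positivity)
  have e3 : ∑ n ∈ A, (∑ m, theta (n + h m)) * w n - 2 * l * ∑ n ∈ A, w n ≤
      ∑ n ∈ A, if 3 ≤ (Finset.univ.filter (fun i => (n + h i).Prime)).card then Wm * (k * l) else 0 := by
    rw [Finset.mul_sum, ← Finset.sum_sub_distrib]
    apply Finset.sum_le_sum
    intro n hn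
    have e4 : ∑ m, theta (n + h m) ≤ (Finset.univ.filter (fun i => (n + h i).Prime)).card * l := by
      unfold theta
      rw [← Finset.sum_filter, ← nsmul_eq_mul]
      exact Finset.sum_le_card_nsmul _ _ _ (fun m _ => hl n hn m)
    have hwn := hw n
    split_ifs with hc
    · have hck : ((Finset.univ.filter (fun i => (n + h i).Prime)).card:ℝ) ≤ k := by
        have := Finset.card_le_univ (Finset.univ.filter (fun i => (n + h i).Prime))
        rw [Fintype.card_fin] at this
        exact_mod_cast this
      have e5 : ∑ m, theta (n + h m) ≤ k * l := e4.trans (mul_le_mul_of_nonneg_right hck hl0)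
      have e6 := mul_le_mul_of_nonneg_right e5 hwn
      have e7 := mul_le_mul_of_nonneg_right (hWm n hn) (show (0:ℝ) ≤ k * l by positivity)
      nlinarith
    · have hck : ((Finset.univ.filter (fun i => (n + h i).Prime)).card:ℝ) ≤ 2 := by
        have : (Finset.univ.filter (fun i => (n + h i).Prime)).card ≤ 2 := by omega
        exact_mod_cast this
      have e5 : ∑ m, theta (n + h m) ≤ 2 * l := e4.trans (mul_le_mul_of_nonneg_right hck hl0)
      have e6 := mul_le_mul_of_nonneg_right e5 hwn
      linarith
  rw [← Finset.sum_filter, Finset.sum_const, nsmul_eq_mul] at e3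
  linarith

lemma weights_pkg (hEH : HasLevelOfDistribution 1) : ∃ k : ℕ, 3 ≤ k ∧ ∃ s1 : ℕ, ∀ A : ℕ, s1 ≤ A → 
    ∃ K : ℕ, A * k ≤ K ∧ 1 ≤ K ∧ ∃ c2 : ℝ, 0 < c2 ∧ ∃ Λ : ℝ, 0 < Λ ∧ ∃ z0 : ℕ, ∀ z : ℕ, z0 ≤ z →
    ∃ lam : (Fin k → ℕ) → ℝ, ∃ G1 G2 : ℝ, (∀ d, lam d ≠ 0 → ∏ i, d i ≤ z^K) ∧
      (∀ d ∈ Fintype.piFinset (fun _ : Fin k => Qs z (z^K)), |lam d| ≤ Λ) ∧ c2 ≤ G2 ∧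
      512 * (K:ℝ) * Real.log z * Vp z * G2 ≤ k * G1^2 ∧
      (∑ d ∈ Fintype.piFinset (fun _ : Fin k => Qs z (z^K)), ∑ e ∈ Fintype.piFinset (fun _ : Fin k => Qs z (z^K)),
        lam d * lam e / ∏ i, (Nat.lcm (d i) (e i) : ℝ) ≤ G2^k) ∧
      (0 ≤ ∑ d ∈ Fintype.piFinset (fun _ : Fin k => Qs z (z^K)), ∑ e ∈ Fintype.piFinset (fun _ : Fin k => Qs z (z^K)),
        lam d * lam e / ∏ i, (Nat.lcm (d i) (e i) : ℝ)) ∧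
      ∀ m : Fin k, (1/2) * G1^2 * G2^(k-1) ≤
        ∑ d ∈ Fintype.piFinset (Qm (Qs z (z^K)) m), ∑ e ∈ Fintype.piFinset (Qm (Qs z (z^K)) m),
          lam d * lam e / ∏ i, (Nat.lcm (d i) (e i) : ℝ) := by
  obtain ⟨J, hJ⟩ : ∃ J : ℕ, 13107200 ≤ J := ⟨_, le_rfl⟩
  obtain ⟨s1, hs1⟩ := opt_weights hEH
  obtain ⟨cv, hcv, hV⟩ := Vp_lower hEH
  refine ⟨2^J, ?_, max s1 1, ?_⟩
  · calc 3 ≤ 2^2 := by norm_num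
      _ ≤ 2^J := Nat.pow_le_pow_right (by norm_num) (by omega)
  intro A hA
  have hA1 : 1 ≤ A := (le_max_right _ _).trans hA
  obtain ⟨z1, h1⟩ := hs1 J hJ A ((le_max_left _ _).trans hA) hA1
  have h1k : 1 ≤ 2^J := Nat.one_le_two_pow
  obtain ⟨Λ, hΛ, z2, h2⟩ := lamb_abs_le hEH (160*2^J*J*A) (2^J)
  have hAK : A * 2^J ≤ 160*2^J*J*A := by
    calc A * 2^J = 1*2^J*1*A := by ring
      _ ≤ _ := by gcongr <;> omega
  have hAr : (1:ℝ) ≤ A := by exact_mod_cast hA1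
  refine ⟨160*2^J*J*A, hAK, (Nat.mul_pos hA1 h1k).trans_le hAK, cv/4, by positivity, Λ, hΛ, max (max z1 z2) 3, ?_⟩
  intro z hz
  have hz1 : z1 ≤ z := (le_max_left _ _).trans ((le_max_left _ _).trans hz)
  have hz2 : z2 ≤ z := (le_max_right _ _).trans ((le_max_left _ _).trans hz)
  have hz3 : 3 ≤ z := (le_max_right _ _).trans hz
  obtain ⟨a1, a2, -, a4⟩ := h1 z hz1
  refine ⟨lamb (Qs z (z^(160*2^J*J*A))) (Yw (z^(160*2^J*J*A)) (gw z A J)),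
    ∑ r ∈ Qs z (z^(160*2^J*J*A)), gw z A J r / (Nat.totient r : ℝ),
    ∑ r ∈ Qs z (z^(160*2^J*J*A)), gw z A J r ^ 2 / (Nat.totient r : ℝ), ?_, ?_, ?_, ?_, ?_, ?_, ?_⟩
  · intro d hd
    exact lamb_supp _ _ _ _ _ hd
  · intro d hd
    exact h2 z hz2 _ _ (fun r => ⟨gw_nonneg z A J r, gw_le z A J r (by omega) hA1⟩) d hd
  · refine le_trans ?_ a2
    have hl0 : 0 < Real.log z := by linarith [(log_R_bound z 0 hz3).2]
    have := hV z (by omega)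
    rw [div_le_iff₀ hl0] at this
    have h5 : 0 < Vp z := Vp_pos z
    nlinarith [mul_le_mul_of_nonneg_left hAr (show 0 ≤ Vp z * Real.log z by positivity)]
  · rw [Nat.cast_pow, Nat.cast_ofNat]
    exact a1
  · exact S1_bound _ (Qs_dc _ _) (Qs_sq _ _) _ _
  · rw [diagS1 _ (Qs_dc _ _) (Qs_sq _ _)]
    exact Finset.sum_nonneg fun r _ => by positivity
  · exact a4

lemma final_arith (k K lz D e1 e2 e U1 U2 X Wm : ℝ) (hk : 1 ≤ k) (hK : 1 ≤ K) (hlz : 1 ≤ lz) (hWm : 0 < Wm)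
    (hU1 : U1 ≤ 2*D + e1) (hU2 : 128*K*lz*D - k*e2 ≤ k*U2) (he1 : e1 ≤ e) (he2 : e2 ≤ e)
    (hD : (k+32*K)*e ≤ 32*K*D) (he0 : 0 ≤ e)
    (h : k*U2 - 2*(16*K*lz)*U1 ≤ X*(Wm*(k*(16*K*lz)))) : 2/(Wm*k)*D ≤ X := by
  have hKl : 0 < K*lz := by positivity
  have s1 : 2*(16*K*lz)*U1 ≤ 2*(16*K*lz)*(2*D+e1) := mul_le_mul_of_nonneg_left hU1 (by positivity)
  have s2 : k*e2 ≤ k*e*lz := by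
    have : k*e2 ≤ k*e := mul_le_mul_of_nonneg_left he2 (by linarith)
    have : k*e*1 ≤ k*e*lz := mul_le_mul_of_nonneg_left hlz (by positivity)
    linarith
  have s3 : 32*(K*lz)*e1 ≤ 32*(K*lz)*e := mul_le_mul_of_nonneg_left he1 (by positivity)
  have s4 : lz*((k+32*K)*e) ≤ lz*(32*K*D) := mul_le_mul_of_nonneg_left hD (by linarith)
  have s5 : 32*(K*lz)*D ≤ X*(Wm*(k*(16*K*lz))) := by nlinarith
  rw [div_mul_eq_mul_div, div_le_iff₀ (by positivity)]
  have s6 : (2*D)*(16*(K*lz)) ≤ (X*(Wm*k))*(16*(K*lz)) := by linarith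
  exact le_of_mul_le_mul_right s6 (by positivity)

lemma mem_bound_Pk {k k' z p : ℕ} (hk : k' ≤ 2*k) (h : Fin k' → ℕ) (hp : p ∈ Pk k z) :
    0 ≤ ((res h p).card:ℝ)/p ∧ ((res h p).card:ℝ)/p ≤ (k':ℝ)/p ∧ ((res h p).card:ℝ)/p ≤ 1/2 := by
  obtain ⟨⟨_, hpp⟩, h4⟩ := mem_Pk.1 hp
  have hp0 : (0:ℝ) < p := by exact_mod_cast hpp.pos
  have hc : ((res h p).card:ℝ) ≤ k' := by exact_mod_cast res_card_le h p hpp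
  have h5 : (k':ℝ) ≤ 2*k := by exact_mod_cast hk
  have h6 : (4:ℝ)*k ≤ p := by exact_mod_cast h4.le
  refine ⟨by positivity, by gcongr, ?_⟩
  rw [div_le_iff₀ hp0]
  linarith

set_option maxHeartbeats 1000000 in
theorem per_tuple (hEH : HasLevelOfDistribution 1) : ∃ k : ℕ, 3 ≤ k ∧ ∃ s1 : ℕ, ∀ A : ℕ, s1 ≤ A → 
    ∃ K : ℕ, A * k ≤ K ∧ 1 ≤ K ∧ ∃ c : ℝ, 0 < c ∧ ∃ z0 : ℕ, ∀ z : ℕ, z0 ≤ z → ∀ N : ℕ, z^(8*K) ≤ N → 3*N ≤ z^(16*K) →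
    ∀ h : Fin k → ℕ, Function.Injective h → (∀ i, Wk k ∣ h i) → (∀ i, h i ≤ z) →
    c * N * ∏ p ∈ Pk k z, (1 - ((res h p).card:ℝ)/p) ≤
      (((NW N (Wk k)).filter (fun n => TP (Pk k z) h n = ∅)).filter
        (fun n => 3 ≤ (Finset.univ.filter (fun i => (n + h i).Prime)).card)).card := by
  obtain ⟨k, hk3, s1, hpk⟩ := weights_pkg hEH
  obtain ⟨s, hFL⟩ := FL hEH k (by positivity)
  obtain ⟨c1, hc1, hVl⟩ := V_lower hEH k (by positivity)
  refine ⟨k, hk3, max s1 s, ?_⟩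
  intro A hA
  obtain ⟨K, hAK, hK1, c2, hc2, Λ, hΛ, z1, hz1⟩ := hpk A ((le_max_left _ _).trans hA)
  have hsA : s ≤ A := (le_max_right _ _).trans hA
  have hskK : s*k ≤ K := (Nat.mul_le_mul_right _ hsA).trans hAK
  have hsK : s ≤ K := (Nat.le_mul_of_pos_right _ (by omega)).trans hskK
  obtain ⟨C1, hC1, he1⟩ := err1 hEH k K s (k+1)
  obtain ⟨C2, hC2, he2⟩ := err2 hEH k K s (Wk k) (k+1) (Wk_pos k)
  have hWpos : (0:ℝ) < Wk k := by exact_mod_cast Wk_pos k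
  have hkr : (1:ℝ) ≤ k := by exact_mod_cast (show 1 ≤ k by omega)
  have hKr : (1:ℝ) ≤ K := by exact_mod_cast hK1
  obtain ⟨Wm, hWm⟩ : ∃ Wm : ℝ, Wm = (Λ * (2^(16*K))^k)^2 := ⟨_, rfl⟩
  have hWmpos : 0 < Wm := by rw [hWm]; positivity
  obtain ⟨Z, hZ⟩ : ∃ Z : ℝ, Z = (k+32*K)*(Λ^2*(C1+C2))*Wk k/(32*K*c1*c2^k) := ⟨_, rfl⟩
  obtain ⟨z2, hz2⟩ := exists_nat_ge (Real.exp Z)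
  refine ⟨K, hAK, hK1, 2/(Wm*k)*(c2^k/Wk k), by positivity, z1 + z2 + 3 + (4*K+2) + Wk k + 4*k, ?_⟩
  intro z hz N hN1 hN2 h hinj hd hle
  have hz3 : 3 ≤ z := by omega
  have hT : TupleOK (Wk k) z (Pk k z) h := tuple_mk (by omega) h hinj hd hle
  obtain ⟨lam, G1, G2, hsupp, habs, hG2, hG1, hs1, hs10, hs2⟩ := hz1 z (by omega)
  obtain ⟨lp, lm, hS, hmain⟩ := hFL z (by omega) (Pk k z) (Pk_sub k z)
  obtain ⟨-, hlz1⟩ := log_R_bound z 0 hz3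
  obtain ⟨lz, hlz⟩ : ∃ lz : ℝ, lz = Real.log z := ⟨_, rfl⟩
  rw [← hlz] at hlz1
  have hlz0 : 0 < lz := by linarith
  have hG2pos : 0 < G2 := by linarith
  have hzN : z ≤ N := (Nat.le_self_pow (by omega) z).trans hN1
  have hN0 : (0:ℝ) < N := by exact_mod_cast (show 0 < N by omega)
  -- conditions on size
  have hcond1 : (z^s)^(k+1)*(z^K)^2*z ≤ N := by
    refine le_trans ?_ hN1
    rw [← pow_mul, ← pow_mul, ← pow_add, ← pow_succ]
    apply Nat.pow_le_pow_right (by omega)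
    have : s*(k+1) = s*k + s := by ring
    omega
  have hcond2 : (Wk k*(z^s*(z^K)^2))^2 ≤ N := by
    refine le_trans ?_ hN1
    calc (Wk k*(z^s*(z^K)^2))^2 ≤ (z*(z^s*(z^K)^2))^2 := by
          apply Nat.pow_le_pow_left
          apply Nat.mul_le_mul_right
          omega
      _ = z^(2*(1+s+2*K)) := by rw [← pow_mul, ← pow_add, ← pow_succ', ← pow_mul]; congr 1; ring
      _ ≤ _ := Nat.pow_le_pow_right (by omega) (by omega)
  -- bounds for v
  have hv : ∀ x ∈ prsQ k z (z^K), |lam x.1 * lam x.2| ≤ Λ^2 := by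
    intro x hx
    rw [mem_prsQ] at hx
    rw [abs_mul, sq]
    exact mul_le_mul (habs _ (Fintype.mem_piFinset.2 hx.1.1)) (habs _ (Fintype.mem_piFinset.2 hx.1.2)) (abs_nonneg _) hΛ.le
  obtain ⟨Vv, hVv⟩ : ∃ Vv : ℝ, Vv = ∏ p ∈ Pk k z, (1 - ((res h p).card:ℝ)/p) := ⟨_, rfl⟩
  have hbP : ∀ p ∈ Pk k z, 0 ≤ ((res h p).card:ℝ)/p ∧ ((res h p).card:ℝ)/p ≤ (k:ℝ)/p ∧ ((res h p).card:ℝ)/p ≤ 1/2 :=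
    fun p hp => mem_bound_Pk (by omega) h hp
  have hVlow : c1 / lz^k ≤ Vv := by
    have := hVl z (by omega) (Pk k z) (Pk_sub k z) (fun p => ((res h p).card:ℝ)/p) hbP
    rw [hVv]
    refine le_trans (le_of_eq ?_) this
    rw [Real.exp_neg, mul_comm (k:ℝ), Real.exp_mul, ← hlz, Real.exp_log hlz0, Real.rpow_natCast, div_eq_mul_inv]
  have hVpos : 0 < Vv := lt_of_lt_of_le (by positivity) hVlow
  -- the sums
  obtain ⟨w, hw⟩ : ∃ w : ℕ → ℝ, w = fun n => (ww (Qs z (z^K)) lam h n)^2 := ⟨_, rfl⟩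
  have hw0 : ∀ n, 0 ≤ w n := fun n => by rw [hw]; positivity
  obtain ⟨E1, hE1⟩ : ∃ E1 : ℝ, E1 = Λ^2 * (C1 * N / lz^(k+1)) := ⟨_, rfl⟩
  obtain ⟨E2, hE2⟩ : ∃ E2 : ℝ, E2 = Λ^2 * (C2 * N / lz^(k+1)) := ⟨_, rfl⟩
  have hE10 : 0 ≤ E1 := by rw [hE1]; positivity
  have hE20 : 0 ≤ E2 := by rw [hE2]; positivity
  have hU1 : ∑ n ∈ (NW N (Wk k)).filter (fun n => TP (Pk k z) h n = ∅), w n ≤ 2*((N:ℝ)/Wk k * Vv * G2^k) + E1 := by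
    have a1 := sieve_up hS N (Wk k) h (fun _ => 1) w (fun _ => zero_le_one) hw0
    have a2 := M_expand (z := z) (N := N) (W := Wk k) (Pk k z) h (fun _ => (1:ℝ)) lam hsupp lp hS.supp_p
    have hw' : ∀ n, (ww (Qs z (z^K)) lam h n)^2 = w n := fun n => by rw [hw]
    simp only [hw'] at a2
    have a3 := he1 z hz3 N (Wk k) hcond1 (Pk k z) h hT lp hS.abs_p (fun x => lam x.1 * lam x.2) (Λ^2) (by positivity) hv
    rw [prsQ_sum1 lam hsupp, supL_sum _ _ lp _ hS.supp_p, ← hlz, ← hE1] at a3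
    have a4 := (abs_le.1 a3).2
    have a5 := (hmain (fun p => ((res h p).card:ℝ)/p) hbP).1
    rw [← hVv] at a5
    rw [a2] at a1
    simp only [one_mul] at a1
    have a6 := mul_le_mul a5 hs1 hs10 (by positivity)
    have a7 := mul_le_mul_of_nonneg_left a6 (show 0 ≤ (N:ℝ)/Wk k by positivity)
    linarith
  have hU2 : ∀ m, (N:ℝ)/(Nat.totient (Wk k)) * ((1/2) * ∏ p ∈ Pk k z, (1 - ((resm h m p).card:ℝ)/((p:ℝ)-1))) * ((1/2) * G1^2 * G2^(k-1)) - E2 ≤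
      ∑ n ∈ (NW N (Wk k)).filter (fun n => TP (Pk k z) h n = ∅), theta (n + h m) * w n := by
    intro m
    have a1 := sieve_lo hS N (Wk k) h (fun n => theta (n + h m)) w (fun _ => theta_nonneg _) hw0
    have a2 := M_expand (z := z) (N := N) (W := Wk k) (Pk k z) h (fun n => theta (n + h m)) lam hsupp lm hS.supp_m
    have hw' : ∀ n, (ww (Qs z (z^K)) lam h n)^2 = w n := fun n => by rw [hw]
    simp only [hw'] at a2
    have a3 := he2 z hz3 (by omega) N hcond2 hzN (Pk k z) h hT m lm hS.abs_m (fun x => lam x.1 * lam x.2) (Λ^2) (by positivity) hv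
    rw [prsQ_sum2 (Nat.one_le_pow _ _ (by omega)) lam hsupp, supL_sum _ _ lm _ hS.supp_m, ← hlz, ← hE2] at a3
    have a4 := (abs_le.1 a3).1
    have hbm : ∀ p ∈ Pk k z, 0 ≤ ((resm h m p).card:ℝ)/((p:ℝ)-1) ∧ ((resm h m p).card:ℝ)/((p:ℝ)-1) ≤ (k:ℝ)/p ∧ ((resm h m p).card:ℝ)/((p:ℝ)-1) ≤ 1/2 := by
      intro p hp
      obtain ⟨r1, r2⟩ := resm_bound h m p (mem_Pk.1 hp).1.2
      obtain ⟨b1, b2, b3⟩ := hbP p hp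
      exact ⟨r1, r2.trans b2, r2.trans b3⟩
    have a5 := (hmain (fun p => ((resm h m p).card:ℝ)/((p:ℝ)-1)) hbm).2
    have a5' : 0 ≤ ∏ p ∈ Pk k z, (1 - ((resm h m p).card:ℝ)/((p:ℝ)-1)) :=
      Finset.prod_nonneg fun p hp => by linarith [(hbm p hp).2.2]
    rw [a2] at a1
    have a6 := mul_le_mul a5 (hs2 m) (by positivity) (le_trans (by positivity) a5)
    have a7 := mul_le_mul_of_nonneg_left a6 (show 0 ≤ (N:ℝ)/(Nat.totient (Wk k)) by positivity)
    linarith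
  have hphi : (0:ℝ) < Nat.totient (Wk k) := by exact_mod_cast Nat.totient_pos.2 (Wk_pos k)
  have hVp : 0 < Vp z := Vp_pos z
  -- unify U2
  have hU2' : ∀ m, (N:ℝ)/Wk k * Vv/Vp z * ((1/4) * G1^2 * G2^(k-1)) - E2 ≤
      ∑ n ∈ (NW N (Wk k)).filter (fun n => TP (Pk k z) h n = ∅), theta (n + h m) * w n := by
    intro m
    refine le_trans (le_of_eq ?_) (hU2 m)
    have := V_ratio (k := k) (show 4*k ≤ z by omega) h m
    rw [← hVv] at this
    have h6 : Vv = (∏ p ∈ Pk k z, (1 - ((resm h m p).card:ℝ)/((p:ℝ)-1))) * (Wk k * Vp z) / Nat.totient (Wk k) := by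
      rw [this]; field_simp
    rw [h6]
    field_simp
    ring
  have hl : ∀ n ∈ (NW N (Wk k)).filter (fun n => TP (Pk k z) h n = ∅), (∀ m, n + h m ≤ z^(16*K)) ∧ 1 ≤ n ∧ ∀ m, Rough z (n + h m) := by
    intro n hn
    rw [Finset.mem_filter, NW, Finset.mem_filter, Finset.mem_Ioc] at hn
    refine ⟨fun m => ?_, by omega, (TP_empty_iff h hd hn.1.2).1 hn.2⟩
    have := hle m
    omega
  have hcore := core_ineq ((NW N (Wk k)).filter (fun n => TP (Pk k z) h n = ∅)) w hw0 Wm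
    (fun n hn => by
      rw [hw, hWm]
      obtain ⟨b1, b2, b3⟩ := hl n hn
      exact ww_bound (by omega) lam Λ hΛ.le habs h b3 b2 b1) h (16*K*lz) (by positivity)
    (fun n hn m => by
      obtain ⟨b1, b2, b3⟩ := hl n hn
      have : Real.log (n + h m : ℕ) ≤ Real.log ((z^(16*K) : ℕ):ℝ) := Real.log_le_log (by exact_mod_cast (show 0 < n + h m by omega)) (by exact_mod_cast b1 m)
      rw [Nat.cast_pow, Real.log_pow, ← hlz] at this
      push_cast at this ⊢
      exact this) _ _ hU1 hU2'
  have hlogZ : Z ≤ lz := by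
    rw [hlz, Real.le_log_iff_exp_le (by positivity)]
    refine hz2.trans ?_
    exact_mod_cast (show z2 ≤ z by omega)
  have hfin := final_arith k K lz ((N:ℝ)/Wk k * Vv * G2^k) E1 E2 (Λ^2 * ((C1+C2) * N / lz^(k+1))) _ _ _ Wm hkr hKr hlz1 hWmpos le_rfl
    ?_ ?_ ?_ ?_ (by positivity) hcore
  · refine le_trans ?_ hfin
    rw [← hVv]
    have : c2^k ≤ G2^k := pow_le_pow_left₀ hc2.le hG2 k
    calc 2/(Wm*k)*(c2^k/Wk k) * N * Vv = 2/(Wm*k)*((N:ℝ)/Wk k * Vv * c2^k) := by ring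
      _ ≤ _ := by gcongr
  · have h7 : G2^k = G2 * G2^(k-1) := by rw [← pow_succ']; congr 1; omega
    rw [← hlz] at hG1
    have h8 := mul_le_mul_of_nonneg_left hG1 (show 0 ≤ (N:ℝ)/Wk k * Vv/Vp z * ((1/4) * G2^(k-1)) by positivity)
    have h9 : (N:ℝ)/Wk k * Vv/Vp z * ((1/4) * G2^(k-1)) * (512 * (K:ℝ) * lz * Vp z * G2) = 128*K*lz*((N:ℝ)/Wk k * Vv * G2^k) := by
      rw [h7]; field_simp; ring
    rw [h9] at h8
    linarith
  · rw [hE1]; gcongr; linarith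
  · rw [hE2]; gcongr; linarith
  · have h7 : c2^k ≤ G2^k := pow_le_pow_left₀ hc2.le hG2 k
    have h8 : (N:ℝ)/Wk k * (c1/lz^k) * c2^k ≤ (N:ℝ)/Wk k * Vv * G2^k := by gcongr
    have h9 : (k+32*K)*(Λ^2 * ((C1+C2) * N / lz^(k+1))) ≤ 32*K*((N:ℝ)/Wk k * (c1/lz^k) * c2^k) := by
      have h10 : (k+32*K)*(Λ^2 * ((C1+C2) * N / lz^(k+1))) = (N:ℝ)/lz^(k+1) * (32*K*c1*c2^k/Wk k) * Z := by
        rw [hZ]; field_simp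
      have h11 : 32*K*((N:ℝ)/Wk k * (c1/lz^k) * c2^k) = (N:ℝ)/lz^(k+1) * (32*K*c1*c2^k/Wk k) * lz := by
        rw [pow_succ]; field_simp
      rw [h10, h11]
      gcongr
    have h12 := mul_le_mul_of_nonneg_left h8 (show (0:ℝ) ≤ 32*K by positivity)
    linarith

lemma Qs_one (z : ℕ) : Qs z (z^0) = {1} := by
  ext r
  rw [mem_Qs, Finset.mem_singleton, pow_zero]
  constructor
  · rintro ⟨⟨h1, h2⟩, _⟩; omega
  · rintro rfl
    refine ⟨⟨le_rfl, le_rfl⟩, squarefree_one, ?_⟩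
    intro p hp hd
    exact absurd (Nat.dvd_one.1 hd) hp.one_lt.ne'

lemma piQs_one (k z : ℕ) : Fintype.piFinset (fun _ : Fin k => Qs z (z^0)) = {fun _ => 1} := by
  rw [Qs_one]
  exact Fintype.piFinset_singleton (fun _ : Fin k => 1)

theorem up_tuple (hEH : HasLevelOfDistribution 1) (k k' : ℕ) (hk : k' ≤ 2*k) : ∃ s : ℕ, ∃ C : ℝ, 0 < C ∧ ∃ z0 : ℕ,
    ∀ z : ℕ, z0 ≤ z → ∀ N : ℕ, z^(s*(k'+1)+1) ≤ N →
    ∀ h : Fin k' → ℕ, Function.Injective h → (∀ i, Wk k ∣ h i) → (∀ i, h i ≤ z) →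
      ((((NW N (Wk k)).filter (fun n => TP (Pk k z) h n = ∅)).card:ℕ):ℝ) ≤ C * N * ∏ p ∈ Pk k z, (1 - ((res h p).card:ℝ)/p) := by
  obtain ⟨s, hFL⟩ := FL hEH k' (by positivity)
  obtain ⟨c1, hc1, hVl⟩ := V_lower hEH k' (by positivity)
  obtain ⟨C1, hC1, he1⟩ := err1 hEH k' 0 s k'
  refine ⟨s, 2 + C1/c1, by positivity, 3 + 4*k, ?_⟩
  intro z hz N hN h hinj hd hle
  have hz3 : 3 ≤ z := by omega
  have hT : TupleOK (Wk k) z (Pk k z) h := tuple_mk (by omega) h hinj hd hle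
  obtain ⟨lp, lm, hS, hmain⟩ := hFL z (by omega) (Pk k z) (Pk_sub k z)
  obtain ⟨-, hlz1⟩ := log_R_bound z 0 hz3
  obtain ⟨lz, hlz⟩ : ∃ lz : ℝ, lz = Real.log z := ⟨_, rfl⟩
  rw [← hlz] at hlz1
  have hlz0 : 0 < lz := by linarith
  have hcond1 : (z^s)^(k'+1)*(z^0)^2*z ≤ N := by
    refine le_trans (le_of_eq ?_) hN
    rw [← pow_mul, pow_zero, one_pow, mul_one, ← pow_succ]
  obtain ⟨lam, hlam⟩ : ∃ lam : (Fin k' → ℕ) → ℝ, lam = fun d => if d = (fun _ => 1) then 1 else 0 := ⟨_, rfl⟩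
  have hsupp : ∀ d, lam d ≠ 0 → ∏ i, d i ≤ z^0 := by
    intro d hd0
    by_cases hd1 : d = fun _ => 1
    · rw [hd1]; simp
    · rw [hlam] at hd0; simp [hd1] at hd0
  have hlam1 : lam (fun _ => 1) = 1 := by rw [hlam]; simp
  have hv : ∀ x ∈ prsQ k' z (z^0), |lam x.1 * lam x.2| ≤ 1 := by
    intro x _
    rw [hlam]
    dsimp only
    split_ifs <;> simp
  obtain ⟨Vv, hVv⟩ : ∃ Vv : ℝ, Vv = ∏ p ∈ Pk k z, (1 - ((res h p).card:ℝ)/p) := ⟨_, rfl⟩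
  have hbP : ∀ p ∈ Pk k z, 0 ≤ ((res h p).card:ℝ)/p ∧ ((res h p).card:ℝ)/p ≤ (k':ℝ)/p ∧ ((res h p).card:ℝ)/p ≤ 1/2 :=
    fun p hp => mem_bound_Pk hk h hp
  have hVlow : c1 / lz^k' ≤ Vv := by
    have := hVl z (by omega) (Pk k z) (Pk_sub k z) (fun p => ((res h p).card:ℝ)/p) hbP
    rw [hVv]
    refine le_trans (le_of_eq ?_) this
    rw [Real.exp_neg, mul_comm (k':ℝ), Real.exp_mul, ← hlz, Real.exp_log hlz0, Real.rpow_natCast, div_eq_mul_inv]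
  have hVpos : 0 < Vv := lt_of_lt_of_le (by positivity) hVlow
  have hww : ∀ n, (ww (Qs z (z^0)) lam h n)^2 = 1 := by
    intro n
    rw [ww, piQs_one, Finset.sum_singleton, hlam1]
    simp
  have a1 := sieve_up hS N (Wk k) h (fun _ => 1) (fun _ => 1) (fun _ => zero_le_one) (fun _ => zero_le_one)
  have a2 := M_expand (z := z) (N := N) (W := Wk k) (Pk k z) h (fun _ => (1:ℝ)) lam hsupp lp hS.supp_p
  simp only [hww] at a2
  have a3 := he1 z hz3 N (Wk k) hcond1 (Pk k z) h hT lp hS.abs_p (fun x => lam x.1 * lam x.2) 1 zero_le_one hv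
  rw [prsQ_sum1 lam hsupp, supL_sum _ _ lp _ hS.supp_p, ← hlz, piQs_one, Finset.sum_singleton, Finset.sum_singleton, hlam1] at a3
  have a4 := (abs_le.1 a3).2
  have a5 := (hmain (fun p => ((res h p).card:ℝ)/p) hbP).1
  rw [← hVv] at a5 ⊢
  rw [a2] at a1
  have hW1 : (1:ℝ) ≤ Wk k := by exact_mod_cast Wk_pos k
  have hNW : (N:ℝ)/Wk k ≤ N := div_le_self (by positivity) hW1
  have a7 := mul_le_mul_of_nonneg_left a5 (show 0 ≤ (N:ℝ)/Wk k by positivity)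
  have a8 := mul_le_mul_of_nonneg_right hNW (show 0 ≤ 2*Vv by positivity)
  have a9 : C1 * N / lz^k' ≤ C1/c1*N*Vv := by
    have := mul_le_mul_of_nonneg_left hVlow (show 0 ≤ C1/c1*N by positivity)
    refine le_trans (le_of_eq ?_) this
    field_simp
  simp only [one_mul, mul_one, Nat.lcm_self, Nat.cast_one, Finset.prod_const_one, div_one, Finset.sum_const, nsmul_eq_mul] at a1 a4
  linarith

noncomputable def FF (P : Finset ℕ) (D : ℝ) (m : ℕ) : ℝ := ∏ p ∈ P.filter (fun p => p ∣ m), (1 + D/(p:ℝ))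

lemma FF_ge_one (P : Finset ℕ) (D : ℝ) (hD : 0 ≤ D) (m : ℕ) : 1 ≤ FF P D m := by
  unfold FF
  refine le_trans (le_of_eq (Finset.prod_const_one (s := P.filter (fun p => p ∣ m))).symm) ?_
  apply Finset.prod_le_prod (fun _ _ => zero_le_one)
  intro p _
  have : 0 ≤ D/(p:ℝ) := by positivity
  linarith

lemma FF_sum (z : ℕ) (P : Finset ℕ) (hP : P ⊆ prs z) (D : ℝ) (hD : 0 ≤ D) (G : ℕ) :
    ∑ m ∈ Finset.Icc 1 G, FF P D m ≤ G * Real.exp D := by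
  classical
  have h1 : ∀ m, FF P D m = ∑ S ∈ P.powerset, if (∀ p ∈ S, p ∣ m) then ∏ p ∈ S, D/(p:ℝ) else 0 := by
    intro m
    unfold FF
    rw [Finset.prod_one_add, ← Finset.sum_filter]
    apply Finset.sum_congr _ (fun _ _ => rfl)
    ext S
    simp only [Finset.mem_powerset, Finset.mem_filter]
    constructor
    · intro h
      exact ⟨fun p hp => (Finset.mem_filter.1 (h hp)).1, fun p hp => (Finset.mem_filter.1 (h hp)).2⟩
    · rintro ⟨h1, h2⟩ p hp
      exact Finset.mem_filter.2 ⟨h1 hp, h2 p hp⟩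
  simp only [h1]
  rw [Finset.sum_comm]
  have h2 : ∀ S ∈ P.powerset, ∑ m ∈ Finset.Icc 1 G, (if (∀ p ∈ S, p ∣ m) then ∏ p ∈ S, D/(p:ℝ) else 0) ≤
      G * ∏ p ∈ S, (D/(p:ℝ)^2) := by
    intro S hS
    rw [Finset.mem_powerset] at hS
    have hpr : ∀ p ∈ S, p.Prime := fun p hp => (mem_prs.1 (hP (hS hp))).2
    rw [← Finset.sum_filter, Finset.sum_const, nsmul_eq_mul]
    have hdpos : 0 < ∏ p ∈ S, p := Finset.prod_pos fun p hp => (hpr p hp).pos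
    have hc : (((Finset.Icc 1 G).filter (fun m => ∀ p ∈ S, p ∣ m)).card : ℝ) ≤ G / ((∏ p ∈ S, p : ℕ):ℝ) := by
      have : ((Finset.Icc 1 G).filter (fun m => ∀ p ∈ S, p ∣ m)).card ≤ G / ∏ p ∈ S, p := by
        rw [← Nat.Ioc_filter_dvd_card_eq_div]
        apply Finset.card_le_card
        intro m hm
        rw [Finset.mem_filter, Finset.mem_Icc] at hm
        rw [Finset.mem_filter, Finset.mem_Ioc]
        refine ⟨by omega, ?_⟩
        exact Finset.prod_primes_dvd m (fun p hp => (hpr p hp).prime) hm.2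
      calc _ ≤ ((G / ∏ p ∈ S, p : ℕ):ℝ) := by exact_mod_cast this
        _ ≤ _ := Nat.cast_div_le
    have h3 : 0 ≤ ∏ p ∈ S, D/(p:ℝ) := Finset.prod_nonneg fun p _ => by positivity
    refine (mul_le_mul_of_nonneg_right hc h3).trans (le_of_eq ?_)
    rw [Nat.cast_prod, div_mul_eq_mul_div, mul_div_assoc, ← Finset.prod_div_distrib]
    congr 1
    apply Finset.prod_congr rfl
    intro p _
    rw [div_div, sq]
  refine (Finset.sum_le_sum h2).trans ?_
  rw [← Finset.mul_sum, ← Finset.prod_one_add]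
  apply mul_le_mul_of_nonneg_left _ (by positivity)
  calc ∏ p ∈ P, (1 + D/(p:ℝ)^2) ≤ ∏ p ∈ P, Real.exp (D/(p:ℝ)^2) := by
        apply Finset.prod_le_prod
        · intro p _; positivity
        · intro p _; rw [add_comm]; exact Real.add_one_le_exp _
    _ = Real.exp (∑ p ∈ P, D/(p:ℝ)^2) := (Real.exp_sum _ _).symm
    _ ≤ _ := by
      apply Real.exp_le_exp.2
      calc ∑ p ∈ P, D/(p:ℝ)^2 ≤ ∑ p ∈ prs z, D/(p:ℝ)^2 := Finset.sum_le_sum_of_subset_of_nonneg hP (fun _ _ _ => by positivity)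
        _ = D * ∑ p ∈ prs z, 1/(p:ℝ)^2 := by rw [Finset.mul_sum]; apply Finset.sum_congr rfl; intros; ring
        _ ≤ D * 1 := mul_le_mul_of_nonneg_left (sum_inv_sq_prs z) hD
        _ = D := mul_one D

lemma one_add_pow_le (k : ℕ) (x : ℝ) (h0 : 0 ≤ x) (h1 : x ≤ 1) : (1+2*x)^k ≤ 1 + (3^k-1)*x := by
  induction k with
  | zero => simp
  | succ k ih =>
    have h3 : (1:ℝ) ≤ 3^k := one_le_pow₀ (by norm_num)
    rw [pow_succ]
    have := mul_le_mul_of_nonneg_right ih (show 0 ≤ 1+2*x by linarith)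
    refine this.trans ?_
    have h5 : x*x ≤ x := by nlinarith
    have h4 := mul_le_mul_of_nonneg_left h5 (show (0:ℝ) ≤ 2*(3^k-1) by linarith)
    rw [pow_succ]
    nlinarith

lemma FF_pow (z : ℕ) (P : Finset ℕ) (hP : P ⊆ prs z) (k m : ℕ) : (FF P 2 m)^k ≤ FF P (3^k) m := by
  unfold FF
  rw [← Finset.prod_pow]
  apply Finset.prod_le_prod
  · intro p _; positivity
  · intro p hp
    have hpp := (mem_prs.1 (hP (Finset.mem_filter.1 hp).1)).2
    have hp1 : (1:ℝ) ≤ p := by exact_mod_cast hpp.one_le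
    have h1 : 1/(p:ℝ) ≤ 1 := by rw [div_le_one (by linarith)]; exact hp1
    have := one_add_pow_le k (1/(p:ℝ)) (by positivity) h1
    have h0 : 0 ≤ 1/(p:ℝ) := by positivity
    calc (1 + 2/(p:ℝ))^k = (1+2*(1/(p:ℝ)))^k := by ring
      _ ≤ _ := this
      _ ≤ 1 + 3^k*(1/(p:ℝ)) := by nlinarith
      _ = _ := by ring

lemma prod_le_sum_pow {k : ℕ} (hk : 1 ≤ k) (f : Fin k → ℝ) (hf : ∀ i, 0 ≤ f i) : ∏ i, f i ≤ ∑ i, f i ^ k := by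
  have : Nonempty (Fin k) := ⟨⟨0, by omega⟩⟩
  obtain ⟨i0, _, h⟩ := Finset.exists_max_image (Finset.univ : Finset (Fin k)) f Finset.univ_nonempty
  calc ∏ i, f i ≤ ∏ _i : Fin k, f i0 := Finset.prod_le_prod (fun i _ => hf i) (fun i hi => h i hi)
    _ = f i0 ^ k := by simp
    _ ≤ _ := Finset.single_le_sum (f := fun i => f i ^ k) (fun i _ => pow_nonneg (hf i) k) (Finset.mem_univ i0)

lemma dist_sum (F : ℕ → ℝ) (hF : ∀ m, 0 ≤ F m) (G t : ℕ) (ht : t ∈ Finset.Icc 1 G) :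
    ∑ g ∈ (Finset.Icc 1 G).filter (fun g => g ≠ t), F (Nat.dist g t) ≤ 2 * ∑ m ∈ Finset.Icc 1 G, F m := by
  rw [Finset.mem_Icc] at ht
  have hmap : ∀ g ∈ (Finset.Icc 1 G).filter (fun g => g ≠ t), Nat.dist g t ∈ Finset.Icc 1 G := by
    intro g hg
    rw [Finset.mem_filter, Finset.mem_Icc] at hg
    rw [Finset.mem_Icc, Nat.dist]
    omega
  rw [← Finset.sum_fiberwise_of_maps_to hmap, Finset.mul_sum]
  apply Finset.sum_le_sum
  intro m _
  have h1 : ∀ g ∈ (((Finset.Icc 1 G).filter (fun g => g ≠ t)).filter (fun g => Nat.dist g t = m)), F (Nat.dist g t) = F m := by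
    intro g hg
    rw [(Finset.mem_filter.1 hg).2]
  rw [Finset.sum_congr rfl h1, Finset.sum_const, nsmul_eq_mul]
  apply mul_le_mul_of_nonneg_right _ (hF m)
  have h2 : (((Finset.Icc 1 G).filter (fun g => g ≠ t)).filter (fun g => Nat.dist g t = m)) ⊆ {t - m, t + m} := by
    intro g hg
    have := (Finset.mem_filter.1 hg).2
    rw [Nat.dist] at this
    simp only [Finset.mem_insert, Finset.mem_singleton]
    omega
  exact_mod_cast (Finset.card_le_card h2).trans Finset.card_le_two

lemma Pk_prod_upper (hEH : HasLevelOfDistribution 1) (k : ℕ) : ∃ C : ℝ, 0 < C ∧ ∀ z : ℕ, 2 ≤ z →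
    ∏ p ∈ Pk k z, (1 - 1/(p:ℝ)) ≤ C / Real.log z := by
  obtain ⟨C, hC, hm⟩ := mertens2 hEH
  refine ⟨Real.exp (C + (4*k+1)), Real.exp_pos _, fun z hz => ?_⟩
  have hlog : 0 < Real.log z := Real.log_pos (by exact_mod_cast hz)
  have h1 := (abs_le.1 (hm z hz)).1
  have h2 : ∑ p ∈ prs z, 1/(p:ℝ) = ∑ p ∈ Pk k z, 1/(p:ℝ) + ∑ p ∈ (prs z).filter (fun p => ¬ 4*k < p), 1/(p:ℝ) := by
    rw [Pk, Finset.sum_filter_add_sum_filter_not]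
  have h3 : ∑ p ∈ (prs z).filter (fun p => ¬ 4*k < p), 1/(p:ℝ) ≤ 4*k+1 := by
    calc _ ≤ ∑ p ∈ (prs z).filter (fun p => ¬ 4*k < p), (1:ℝ) := by
          apply Finset.sum_le_sum
          intro p hp
          have hpp := (mem_prs.1 (Finset.mem_filter.1 hp).1).2
          have hp1 : (1:ℝ) ≤ p := by exact_mod_cast hpp.one_le
          rw [div_le_one (by linarith)]; exact hp1
      _ = (((prs z).filter (fun p => ¬ 4*k < p)).card : ℝ) := by simp
      _ ≤ ((Finset.range (4*k+1)).card : ℝ) := by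
          norm_cast
          apply Finset.card_le_card
          intro p hp
          have := (Finset.mem_filter.1 hp).2
          rw [Finset.mem_range]; omega
      _ = _ := by simp
  calc ∏ p ∈ Pk k z, (1 - 1/(p:ℝ)) ≤ ∏ p ∈ Pk k z, Real.exp (-(1/(p:ℝ))) := by
        apply Finset.prod_le_prod
        · intro p hp
          have hpp := (mem_Pk.1 hp).1.2
          have hp1 : (1:ℝ) ≤ p := by exact_mod_cast hpp.one_le
          have : 1/(p:ℝ) ≤ 1 := by rw [div_le_one (by linarith)]; exact hp1
          linarith
        · intro p _
          linarith [Real.add_one_le_exp (-(1/(p:ℝ)))]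
    _ = Real.exp (∑ p ∈ Pk k z, -(1/(p:ℝ))) := (Real.exp_sum _ _).symm
    _ ≤ Real.exp ((C + (4*k+1)) - Real.log (Real.log z)) := by
        apply Real.exp_le_exp.2
        rw [Finset.sum_neg_distrib]
        linarith
    _ = _ := by rw [Real.exp_sub, Real.exp_log hlog]

lemma res_cons {k : ℕ} (h : Fin k → ℕ) (a p : ℕ) (hp : p.Prime) :
    (res h p) ⊆ res (Fin.cons a h : Fin (k+1) → ℕ) p ∧
    ((∀ i, ¬ p ∣ Nat.dist a (h i)) → (res h p).card + 1 ≤ (res (Fin.cons a h : Fin (k+1) → ℕ) p).card) := by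
  classical
  have hsub : (res h p) ⊆ res (Fin.cons a h : Fin (k+1) → ℕ) p := by
    intro r hr
    simp only [res, Finset.mem_filter] at hr ⊢
    refine ⟨hr.1, ?_⟩
    rw [Fin.prod_univ_succ]
    simp only [Fin.cons_succ]
    exact Dvd.dvd.mul_left hr.2 _
  refine ⟨hsub, fun hn => ?_⟩
  have hp0 := hp.pos
  obtain ⟨r, hr⟩ : ∃ r, r = (p - a % p) % p := ⟨_, rfl⟩
  have hrp : r < p := by rw [hr]; exact Nat.mod_lt _ hp0
  have hra : p ∣ r + a := by
    rw [hr, dvd_mod_add]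
    have h1 := Nat.mod_lt a hp0
    have h2 := Nat.div_add_mod a p
    refine ⟨1 + a / p, ?_⟩
    rw [mul_add, mul_one]
    omega
  have hrn : r ∉ res h p := by
    intro hr'
    simp only [res, Finset.mem_filter] at hr'
    rw [hp.prime.dvd_finsetProd_iff] at hr'
    obtain ⟨_, i, _, hi⟩ := hr'
    apply hn i
    rw [Nat.dist]
    rcases le_total a (h i) with hle | hle
    · rw [Nat.sub_eq_zero_of_le hle, zero_add]
      have := Nat.dvd_sub hi hra
      rwa [Nat.add_sub_add_left] at this
    · rw [Nat.sub_eq_zero_of_le hle, add_zero]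
      have := Nat.dvd_sub hra hi
      rwa [Nat.add_sub_add_left] at this
  rw [← Finset.card_insert_of_notMem hrn]
  apply Finset.card_le_card
  apply Finset.insert_subset _ hsub
  simp only [res, Finset.mem_filter, Finset.mem_range]
  refine ⟨hrp, ?_⟩
  rw [Fin.prod_univ_succ]
  simp only [Fin.cons_zero]
  exact Dvd.dvd.mul_right hra _

lemma V_cons {k z : ℕ} (hk : 1 ≤ k) (t : Fin k → ℕ) (g : ℕ) :
    ∏ p ∈ Pk k z, (1 - ((res (Fin.cons (Wk k * g) (fun i => Wk k * t i) : Fin (k+1) → ℕ) p).card:ℝ)/p) ≤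
    (∏ p ∈ Pk k z, (1 - ((res (fun i => Wk k * t i) p).card:ℝ)/p)) * (∏ p ∈ Pk k z, (1 - 1/(p:ℝ))) *
      ∏ i, FF (Pk k z) 2 (Nat.dist g (t i)) := by
  have h1 : ∏ i, FF (Pk k z) 2 (Nat.dist g (t i)) = ∏ p ∈ Pk k z, ∏ i, (if p ∣ Nat.dist g (t i) then 1 + 2/(p:ℝ) else 1) := by
    rw [Finset.prod_comm]
    apply Finset.prod_congr rfl
    intro i _
    rw [FF, Finset.prod_filter]
  rw [h1, ← Finset.prod_mul_distrib, ← Finset.prod_mul_distrib]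
  apply Finset.prod_le_prod
  · intro p hp
    have := (mem_bound_Pk (k := k) (show k+1 ≤ 2*k by omega) (Fin.cons (Wk k * g) (fun i => Wk k * t i) : Fin (k+1) → ℕ) hp).2.2
    linarith
  intro p hp
  obtain ⟨⟨_, hpp⟩, h4⟩ := mem_Pk.1 hp
  have hp2 : (2:ℝ) ≤ p := by exact_mod_cast hpp.two_le
  have hp0 : (0:ℝ) < p := by linarith
  obtain ⟨b0, _, b1⟩ := mem_bound_Pk (k := k) (show k ≤ 2*k by omega) (fun i => Wk k * t i) hp
  obtain ⟨r1, r2⟩ := res_cons (fun i => Wk k * t i) (Wk k * g) p hpp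
  obtain ⟨x, hx⟩ : ∃ x : ℝ, x = ((res (fun i => Wk k * t i) p).card:ℝ)/p := ⟨_, rfl⟩
  rw [← hx] at b0 b1 ⊢
  by_cases hd : ∃ i, p ∣ Nat.dist g (t i)
  · obtain ⟨i, hi⟩ := hd
    have c1 : x ≤ ((res (Fin.cons (Wk k * g) (fun i => Wk k * t i) : Fin (k+1) → ℕ) p).card:ℝ)/p := by
      rw [hx]
      have : ((res (fun i => Wk k * t i) p).card:ℝ) ≤ ((res (Fin.cons (Wk k * g) (fun i => Wk k * t i) : Fin (k+1) → ℕ) p).card:ℝ) := by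
        exact_mod_cast Finset.card_le_card r1
      gcongr
    have c2 : 1 + 2/(p:ℝ) ≤ ∏ i, (if p ∣ Nat.dist g (t i) then 1 + 2/(p:ℝ) else 1) := by
      have e1 : ∀ j, (1:ℝ) ≤ if p ∣ Nat.dist g (t j) then 1 + 2/(p:ℝ) else 1 := by
        intro j
        have : 0 ≤ 2/(p:ℝ) := by positivity
        split_ifs <;> linarith
      rw [← Finset.mul_prod_erase _ _ (Finset.mem_univ i), if_pos hi]
      have e2 : (1:ℝ) ≤ ∏ j ∈ Finset.univ.erase i, (if p ∣ Nat.dist g (t j) then 1 + 2/(p:ℝ) else 1) := by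
        refine le_trans (le_of_eq (Finset.prod_const_one (s := Finset.univ.erase i)).symm) ?_
        exact Finset.prod_le_prod (fun _ _ => zero_le_one) (fun j _ => e1 j)
      exact le_mul_of_one_le_right (by positivity) e2
    have c3 : 1 ≤ (1 - 1/(p:ℝ)) * (1 + 2/(p:ℝ)) := by
      have : (1 - 1/(p:ℝ)) * (1 + 2/(p:ℝ)) = 1 + ((p:ℝ)-2)/(p:ℝ)^2 := by field_simp; ring
      rw [this]
      have : 0 ≤ ((p:ℝ)-2)/(p:ℝ)^2 := div_nonneg (by linarith) (by positivity)
      linarith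
    have c4 : 0 ≤ 1 - 1/(p:ℝ) := by
      have : 1/(p:ℝ) ≤ 1 := by rw [div_le_one hp0]; linarith
      linarith
    have c5 := mul_le_mul_of_nonneg_left c2 c4
    have c6 := mul_le_mul_of_nonneg_left (c3.trans c5) (show 0 ≤ 1 - x by linarith)
    rw [mul_assoc]
    linarith
  · push Not at hd
    have hn : ∀ i, ¬ p ∣ Nat.dist (Wk k * g) (Wk k * t i) := by
      intro i hi
      rw [Nat.dist_mul_left, hpp.dvd_mul] at hi
      rcases hi with hi | hi
      · rw [Wk, hpp.dvd_factorial] at hi; omega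
      · exact hd i hi
    have c1 := r2 hn
    have c2 : ∏ i, (if p ∣ Nat.dist g (t i) then 1 + 2/(p:ℝ) else 1) = 1 := by
      apply Finset.prod_eq_one
      intro i _
      rw [if_neg (hd i)]
    rw [c2, mul_one]
    have c3 : x + 1/(p:ℝ) ≤ ((res (Fin.cons (Wk k * g) (fun i => Wk k * t i) : Fin (k+1) → ℕ) p).card:ℝ)/p := by
      rw [hx, ← add_div]
      have : ((res (fun i => Wk k * t i) p).card:ℝ) + 1 ≤ ((res (Fin.cons (Wk k * g) (fun i => Wk k * t i) : Fin (k+1) → ℕ) p).card:ℝ) := by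
        exact_mod_cast c1
      gcongr
    have : 0 ≤ x * (1/(p:ℝ)) := by positivity
    nlinarith

theorem V_sum (hEH : HasLevelOfDistribution 1) (k : ℕ) (hk : 1 ≤ k) : ∃ C : ℝ, 0 < C ∧ ∀ z : ℕ, 2 ≤ z → ∀ G : ℕ,
    ∀ t : Fin k → ℕ, (∀ i, t i ∈ Finset.Icc 1 G) →
    ∑ g ∈ (Finset.Icc 1 G).filter (fun g => ∀ i, g ≠ t i),
      ∏ p ∈ Pk k z, (1 - ((res (Fin.cons (Wk k * g) (fun i => Wk k * t i) : Fin (k+1) → ℕ) p).card:ℝ)/p) ≤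
    C * (G / Real.log z) * ∏ p ∈ Pk k z, (1 - ((res (fun i => Wk k * t i) p).card:ℝ)/p) := by
  obtain ⟨C, hC, hP⟩ := Pk_prod_upper hEH k
  refine ⟨C * (k * (2 * Real.exp (3^k))), by positivity, ?_⟩
  intro z hz G t ht
  have hlog : 0 < Real.log z := Real.log_pos (by exact_mod_cast hz)
  obtain ⟨Vv, hVv⟩ : ∃ Vv : ℝ, Vv = ∏ p ∈ Pk k z, (1 - ((res (fun i => Wk k * t i) p).card:ℝ)/p) := ⟨_, rfl⟩
  have hV0 : 0 ≤ Vv := by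
    rw [hVv]
    apply Finset.prod_nonneg
    intro p hp
    linarith [(mem_bound_Pk (k := k) (show k ≤ 2*k by omega) (fun i => Wk k * t i) hp).2.2]
  have h1 : ∀ g ∈ (Finset.Icc 1 G).filter (fun g => ∀ i, g ≠ t i),
      ∏ p ∈ Pk k z, (1 - ((res (Fin.cons (Wk k * g) (fun i => Wk k * t i) : Fin (k+1) → ℕ) p).card:ℝ)/p) ≤
      Vv * (C/Real.log z) * ∑ i, FF (Pk k z) (3^k) (Nat.dist g (t i)) := by
    intro g _
    refine (V_cons hk t g).trans ?_
    rw [← hVv]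
    have a1 := mul_le_mul_of_nonneg_left (hP z hz) hV0
    have a2 : ∏ i, FF (Pk k z) 2 (Nat.dist g (t i)) ≤ ∑ i, FF (Pk k z) (3^k) (Nat.dist g (t i)) := by
      refine (prod_le_sum_pow hk _ (fun i => zero_le_one.trans (FF_ge_one _ _ (by norm_num) _))).trans ?_
      apply Finset.sum_le_sum
      intro i _
      exact FF_pow z _ (Pk_sub k z) k _
    exact mul_le_mul a1 a2 (Finset.prod_nonneg fun i _ => zero_le_one.trans (FF_ge_one _ _ (by norm_num) _)) (by positivity)
  refine (Finset.sum_le_sum h1).trans ?_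
  rw [← hVv, ← Finset.mul_sum, Finset.sum_comm]
  have h2 : ∀ i ∈ (Finset.univ : Finset (Fin k)), ∑ g ∈ (Finset.Icc 1 G).filter (fun g => ∀ i, g ≠ t i), FF (Pk k z) (3^k) (Nat.dist g (t i)) ≤
      2 * (G * Real.exp (3^k)) := by
    intro i _
    have hF : ∀ m, 0 ≤ FF (Pk k z) (3^k) m := fun m => zero_le_one.trans (FF_ge_one _ _ (by positivity) _)
    refine le_trans ?_ ((dist_sum (FF (Pk k z) (3^k)) hF G (t i) (ht i)).trans ?_)
    · apply Finset.sum_le_sum_of_subset_of_nonneg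
      · intro g hg
        rw [Finset.mem_filter] at hg ⊢
        exact ⟨hg.1, hg.2 i⟩
      · intro g _ _
        exact hF _
    · exact mul_le_mul_of_nonneg_left (FF_sum z _ (Pk_sub k z) (3^k) (by positivity) G) (by norm_num)
  have h3 := Finset.sum_le_sum h2
  refine (mul_le_mul_of_nonneg_left h3 (by positivity)).trans (le_of_eq ?_)
  simp only [Finset.sum_const, Finset.card_univ, Fintype.card_fin, nsmul_eq_mul]
  ring

noncomputable def rset (z W G n : ℕ) : Finset ℕ := (Finset.Icc 1 G).filter (fun g => Rough z (n + W*g))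

noncomputable def pset (W G n : ℕ) : Finset ℕ := (Finset.Icc 1 G).filter (fun g => (n + W*g).Prime)

lemma trunc_count {α : Type*} (s : Finset α) (r : α → ℕ) (M : ℕ) (X B : ℝ) (hs : X ≤ s.card) (hB : (∑ n ∈ s, (r n:ℝ)) ≤ B)
    (hM : 2*B ≤ M*X) (hM0 : 0 < M) : X/2 ≤ (s.filter (fun n => r n ≤ M)).card := by
  have h1 : ((s.filter (fun n => r n ≤ M)).card : ℝ) + ((s.filter (fun n => ¬ r n ≤ M)).card : ℝ) = s.card := by
    exact_mod_cast Finset.card_filter_add_card_filter_not (s := s) (fun n => r n ≤ M)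
  have h2 : (M:ℝ) * ((s.filter (fun n => ¬ r n ≤ M)).card : ℝ) ≤ B := by
    refine le_trans ?_ hB
    calc (M:ℝ) * ((s.filter (fun n => ¬ r n ≤ M)).card : ℝ) = ∑ n ∈ s.filter (fun n => ¬ r n ≤ M), (M:ℝ) := by
          rw [Finset.sum_const, nsmul_eq_mul, mul_comm]
      _ ≤ ∑ n ∈ s.filter (fun n => ¬ r n ≤ M), (r n:ℝ) := by
          apply Finset.sum_le_sum
          intro n hn
          have := (Finset.mem_filter.1 hn).2
          exact_mod_cast (show M ≤ r n by omega)
      _ ≤ _ := Finset.sum_le_sum_of_subset_of_nonneg (Finset.filter_subset _ _) (fun _ _ _ => by positivity)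
  have hMr : (0:ℝ) < M := by exact_mod_cast hM0
  have h3 : ((s.filter (fun n => ¬ r n ≤ M)).card : ℝ) ≤ X/2 := by
    have : (M:ℝ) * ((s.filter (fun n => ¬ r n ≤ M)).card : ℝ) ≤ M * (X/2) := by linarith
    exact le_of_mul_le_mul_left this hMr
  linarith

set_option maxHeartbeats 1000000 in
theorem trunc (hEH : HasLevelOfDistribution 1) : ∃ k : ℕ, 3 ≤ k ∧ ∃ K : ℕ, 1 ≤ K ∧ ∃ c : ℝ, 0 < c ∧ ∃ M z0 : ℕ,
    ∀ z : ℕ, z0 ≤ z → ∀ N : ℕ, z^(8*K) ≤ N → 3*N ≤ z^(16*K) → ∀ G : ℕ, (G:ℝ) ≤ 16*K*Real.log z → Wk k * G ≤ z →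
    ∀ t : Fin k → ℕ, Function.Injective t → (∀ i, t i ∈ Finset.Icc 1 G) →
    c * N / (Real.log z)^k ≤ (((Finset.Ioc N (2*N)).filter (fun n =>
      (∀ i, t i ∈ rset z (Wk k) G n) ∧ (rset z (Wk k) G n).card ≤ M ∧ 3 ≤ (pset (Wk k) G n).card)).card : ℝ) := by
  classical
  obtain ⟨k, hk3, s1, hpt⟩ := per_tuple hEH
  obtain ⟨sa, Ca, hCa, za, hua⟩ := up_tuple hEH k k (by omega)
  obtain ⟨sb, Cb, hCb, zb, hub⟩ := up_tuple hEH k (k+1) (by omega)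
  obtain ⟨Cs, hCs, hVs⟩ := V_sum hEH k (by omega)
  obtain ⟨cl, hcl, hVl⟩ := V_lower hEH k (by positivity)
  obtain ⟨K, hAK, hK1, c, hc, z0, hgood⟩ := hpt (max s1 (max sa sb)) (le_max_left _ _)
  have hsa : sa * k ≤ K := (Nat.mul_le_mul_right _ ((le_max_left _ _).trans (le_max_right _ _))).trans hAK
  have hsb : sb * k ≤ K := (Nat.mul_le_mul_right _ ((le_max_right _ _).trans (le_max_right _ _))).trans hAK
  obtain ⟨C4, hC4⟩ : ∃ C4 : ℝ, C4 = Cb*(Cs*(16*K)) + k*Ca := ⟨_, rfl⟩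
  have hC40 : 0 < C4 := by rw [hC4]; positivity
  obtain ⟨M, hM⟩ := exists_nat_ge (2*C4/c)
  refine ⟨k, hk3, K, hK1, c*cl/2, by positivity, M+1, z0+za+zb+3, ?_⟩
  intro z hz N hN1 hN2 G hG hWG t hinj ht
  have hW1 := Wk_pos k
  obtain ⟨h, hh⟩ : ∃ h : Fin k → ℕ, h = fun i => Wk k * t i := ⟨_, rfl⟩
  have hhinj : Function.Injective h := by
    intro i j hij
    rw [hh] at hij
    exact hinj (Nat.eq_of_mul_eq_mul_left hW1 hij)
  have hhd : ∀ i, Wk k ∣ h i := fun i => by rw [hh]; exact Dvd.intro _ rfl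
  have hWle : ∀ g ∈ Finset.Icc 1 G, Wk k * g ≤ z := fun g hg => (Nat.mul_le_mul_left _ (Finset.mem_Icc.1 hg).2).trans hWG
  have hhle : ∀ i, h i ≤ z := fun i => by rw [hh]; exact hWle _ (ht i)
  have hN0 : (0:ℝ) ≤ N := by positivity
  have hlz1 := (log_R_bound z 0 (by omega)).2
  obtain ⟨lz, hlz⟩ : ∃ lz : ℝ, lz = Real.log z := ⟨_, rfl⟩
  have a1 := hgood z (by omega) N hN1 hN2 h hhinj hhd hhle
  have a2 := hua z (by omega) N ((Nat.pow_le_pow_right (by omega) (by nlinarith)).trans hN1) h hhinj hhd hhle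
  have a3 := hVs z (by omega) G t ht
  rw [← hh] at a3
  rw [← hlz] at hlz1 a3 hG ⊢
  have hlz0 : 0 < lz := by linarith
  obtain ⟨Vv, hVv⟩ : ∃ Vv : ℝ, Vv = ∏ p ∈ Pk k z, (1 - ((res h p).card:ℝ)/p) := ⟨_, rfl⟩
  have hVlow : cl / lz^k ≤ Vv := by
    have := hVl z (by omega) (Pk k z) (Pk_sub k z) (fun p => ((res h p).card:ℝ)/p) (fun p hp => mem_bound_Pk (by omega) h hp)
    rw [hVv]
    refine le_trans (le_of_eq ?_) this
    rw [Real.exp_neg, mul_comm (k:ℝ), Real.exp_mul, ← hlz, Real.exp_log hlz0, Real.rpow_natCast, div_eq_mul_inv]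
  have hVpos : 0 < Vv := lt_of_lt_of_le (by positivity) hVlow
  rw [← hVv] at a1 a2 a3
  obtain ⟨Aset, hA⟩ : ∃ Aset, Aset = (NW N (Wk k)).filter (fun n => TP (Pk k z) h n = ∅) := ⟨_, rfl⟩
  rw [← hA] at a1 a2
  obtain ⟨Gd, hGd⟩ : ∃ Gd, Gd = Aset.filter (fun n => 3 ≤ (Finset.univ.filter (fun i => (n + h i).Prime)).card) := ⟨_, rfl⟩
  rw [← hGd] at a1
  have hGdA : Gd ⊆ Aset := by rw [hGd]; exact Finset.filter_subset _ _
  -- sum of the rough counts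
  have hB : ∑ n ∈ Gd, ((rset z (Wk k) G n).card:ℝ) ≤ C4 * N * Vv := by
    have b1 : ∑ n ∈ Gd, ((rset z (Wk k) G n).card:ℝ) = ∑ g ∈ Finset.Icc 1 G, ((Gd.filter (fun n => Rough z (n + Wk k * g))).card : ℝ) := by
      have : ∀ n, ((rset z (Wk k) G n).card:ℝ) = ∑ g ∈ Finset.Icc 1 G, if Rough z (n + Wk k * g) then (1:ℝ) else 0 := by
        intro n
        rw [rset, Finset.card_filter]; push_cast; rfl
      simp only [this]
      rw [Finset.sum_comm]
      apply Finset.sum_congr rfl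
      intro g _
      rw [Finset.card_filter]; push_cast; rfl
    rw [b1, ← Finset.sum_filter_add_sum_filter_not (Finset.Icc 1 G) (fun g => ∀ i, g ≠ t i)]
    have b2 : ∑ g ∈ (Finset.Icc 1 G).filter (fun g => ∀ i, g ≠ t i), ((Gd.filter (fun n => Rough z (n + Wk k * g))).card : ℝ) ≤ Cb * N * (Cs*(16*K)*Vv) := by
      have b3 : ∀ g ∈ (Finset.Icc 1 G).filter (fun g => ∀ i, g ≠ t i), ((Gd.filter (fun n => Rough z (n + Wk k * g))).card : ℝ) ≤
          Cb * N * ∏ p ∈ Pk k z, (1 - ((res (Fin.cons (Wk k * g) h : Fin (k+1) → ℕ) p).card:ℝ)/p) := by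
        intro g hg
        rw [Finset.mem_filter] at hg
        have hd' : ∀ i, Wk k ∣ (Fin.cons (Wk k * g) h : Fin (k+1) → ℕ) i := by
          intro i
          refine Fin.cases ?_ (fun j => ?_) i
          · rw [Fin.cons_zero]; exact Dvd.intro _ rfl
          · rw [Fin.cons_succ]; exact hhd j
        have hle' : ∀ i, (Fin.cons (Wk k * g) h : Fin (k+1) → ℕ) i ≤ z := by
          intro i
          refine Fin.cases ?_ (fun j => ?_) i
          · rw [Fin.cons_zero]; exact hWle g hg.1
          · rw [Fin.cons_succ]; exact hhle j
        have hinj' : Function.Injective (Fin.cons (Wk k * g) h : Fin (k+1) → ℕ) := by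
          rw [Fin.cons_injective_iff]
          refine ⟨?_, hhinj⟩
          rintro ⟨i, hi⟩
          rw [hh] at hi
          exact hg.2 i (Nat.eq_of_mul_eq_mul_left hW1 hi).symm
        refine le_trans ?_ (hub z (by omega) N ((Nat.pow_le_pow_right (by omega) (by nlinarith)).trans hN1) _ hinj' hd' hle')
        have hsub : Gd.filter (fun n => Rough z (n + Wk k * g)) ⊆ (NW N (Wk k)).filter (fun n => TP (Pk k z) (Fin.cons (Wk k * g) h : Fin (k+1) → ℕ) n = ∅) := by
          intro n hn
          rw [Finset.mem_filter] at hn ⊢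
          have hnA := hGdA hn.1
          rw [hA, Finset.mem_filter] at hnA
          refine ⟨hnA.1, ?_⟩
          have hn1 : n % Wk k = 1 % Wk k := (Finset.mem_filter.1 hnA.1).2
          rw [TP_empty_iff _ hd' hn1]
          intro i
          refine Fin.cases ?_ (fun j => ?_) i
          · rw [Fin.cons_zero]; exact hn.2
          · rw [Fin.cons_succ]; exact (TP_empty_iff h hhd hn1).1 hnA.2 j
        exact_mod_cast Finset.card_le_card hsub
      refine (Finset.sum_le_sum b3).trans ?_
      rw [← Finset.mul_sum]
      apply mul_le_mul_of_nonneg_left _ (by positivity)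
      refine a3.trans ?_
      have : (G:ℝ)/lz ≤ 16*K := by rw [div_le_iff₀ hlz0]; exact hG
      gcongr
    have b4 : ∑ g ∈ (Finset.Icc 1 G).filter (fun g => ¬ ∀ i, g ≠ t i), ((Gd.filter (fun n => Rough z (n + Wk k * g))).card : ℝ) ≤ k * (Ca * N * Vv) := by
      have b5 : ∀ g ∈ (Finset.Icc 1 G).filter (fun g => ¬ ∀ i, g ≠ t i), ((Gd.filter (fun n => Rough z (n + Wk k * g))).card : ℝ) ≤ Ca * N * Vv := by
        intro g _
        refine le_trans ?_ a2
        exact_mod_cast Finset.card_le_card ((Finset.filter_subset _ _).trans hGdA)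
      refine (Finset.sum_le_sum b5).trans ?_
      rw [Finset.sum_const, nsmul_eq_mul]
      apply mul_le_mul_of_nonneg_right _ (by positivity)
      have : ((Finset.Icc 1 G).filter (fun g => ¬ ∀ i, g ≠ t i)) ⊆ Finset.univ.image t := by
        intro g hg
        have := (Finset.mem_filter.1 hg).2
        push Not at this
        obtain ⟨i, hi⟩ := this
        exact Finset.mem_image.2 ⟨i, Finset.mem_univ _, hi.symm⟩
      have := (Finset.card_le_card this).trans Finset.card_image_le
      rw [Finset.card_univ, Fintype.card_fin] at this
      exact_mod_cast this
    rw [hC4]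
    linarith
  have hfin := trunc_count Gd (fun n => (rset z (Wk k) G n).card) (M+1) (c*N*Vv) (C4*N*Vv) a1 hB (by
    rw [div_le_iff₀ hc] at hM
    have : 2*C4 ≤ ((M+1:ℕ):ℝ)*c := by push_cast; linarith
    have := mul_le_mul_of_nonneg_right this (show 0 ≤ N*Vv by positivity)
    linarith) (by omega)
  have hlow : c*cl/2*N/lz^k ≤ c*N*Vv/2 := by
    have := mul_le_mul_of_nonneg_left hVlow (show 0 ≤ c*N/2 by positivity)
    calc c*cl/2*N/lz^k = c*N/2*(cl/lz^k) := by ring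
      _ ≤ _ := this
      _ = _ := by ring
  refine hlow.trans (hfin.trans ?_)
  have hsub : Gd.filter (fun n => (rset z (Wk k) G n).card ≤ M+1) ⊆ (Finset.Ioc N (2*N)).filter (fun n =>
      (∀ i, t i ∈ rset z (Wk k) G n) ∧ (rset z (Wk k) G n).card ≤ M+1 ∧ 3 ≤ (pset (Wk k) G n).card) := by
    intro n hn
    rw [Finset.mem_filter] at hn ⊢
    have hnA := hGdA hn.1
    rw [hA, Finset.mem_filter] at hnA
    have hnN := Finset.mem_filter.1 hnA.1
    refine ⟨hnN.1, fun i => ?_, hn.2, ?_⟩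
    · rw [rset, Finset.mem_filter]
      refine ⟨ht i, ?_⟩
      have := (TP_empty_iff h hhd hnN.2).1 hnA.2 i
      rw [hh] at this
      exact this
    · have h3 := hn.1
      rw [hGd, Finset.mem_filter] at h3
      refine h3.2.trans ?_
      apply Finset.card_le_card_of_injOn t
      · intro i hi
        have := (Finset.mem_filter.1 (Finset.mem_coe.1 hi)).2
        rw [hh] at this
        rw [Finset.mem_coe, pset, Finset.mem_filter]
        exact ⟨ht i, this⟩
      · exact hinj.injOn
  exact_mod_cast Finset.card_le_card hsub

theorem many_z (hEH : HasLevelOfDistribution 1) : ∃ k : ℕ, 3 ≤ k ∧ ∃ K : ℕ, 1 ≤ K ∧ ∃ c : ℝ, 0 < c ∧ ∃ z0 : ℕ,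
    ∀ z : ℕ, z0 ≤ z → ∀ N : ℕ, z^(8*K) ≤ N → 3*N ≤ z^(16*K) → ∀ G : ℕ, 2*k ≤ G → (G:ℝ) ≤ 16*K*Real.log z → Wk k * G ≤ z →
    c * N * (G / Real.log z)^k ≤ (((Finset.Ioc N (2*N)).filter (fun n => 3 ≤ (pset (Wk k) G n).card)).card : ℝ) := by
  classical
  obtain ⟨k, hk3, K, hK1, c, hc, M, z0, ht⟩ := trunc hEH
  refine ⟨k, hk3, K, hK1, c/(2^k*k.factorial*2^M), by positivity, z0+3, ?_⟩
  intro z hz N hN1 hN2 G hG hG2 hWG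
  have hlz1 := (log_R_bound z 0 (by omega)).2
  have hlz0 : 0 < Real.log z := by linarith
  obtain ⟨S, hS⟩ : ∃ S, S = (Finset.Ioc N (2*N)).filter (fun n => 3 ≤ (pset (Wk k) G n).card) := ⟨_, rfl⟩
  have h1 : ∀ T ∈ (Finset.Icc 1 G).powersetCard k, c * N / (Real.log z)^k ≤
      ((S.filter (fun n => T ⊆ rset z (Wk k) G n ∧ (rset z (Wk k) G n).card ≤ M)).card : ℝ) := by
    intro T hT
    rw [Finset.mem_powersetCard] at hT
    have hmem : ∀ i, T.orderEmbOfFin hT.2 i ∈ T := fun i => Finset.orderEmbOfFin_mem T hT.2 i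
    refine (ht z (by omega) N hN1 hN2 G hG2 hWG (T.orderEmbOfFin hT.2) (T.orderEmbOfFin hT.2).injective
      (fun i => hT.1 (hmem i))).trans ?_
    have hsub : (Finset.Ioc N (2*N)).filter (fun n =>
      (∀ i, T.orderEmbOfFin hT.2 i ∈ rset z (Wk k) G n) ∧ (rset z (Wk k) G n).card ≤ M ∧ 3 ≤ (pset (Wk k) G n).card) ⊆
      S.filter (fun n => T ⊆ rset z (Wk k) G n ∧ (rset z (Wk k) G n).card ≤ M) := by
      intro n hn
      rw [Finset.mem_filter] at hn
      rw [Finset.mem_filter, hS, Finset.mem_filter]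
      refine ⟨⟨hn.1, hn.2.2.2⟩, ?_, hn.2.2.1⟩
      intro x hx
      have : x ∈ Set.range (T.orderEmbOfFin hT.2) := by rw [Finset.range_orderEmbOfFin]; exact hx
      obtain ⟨i, hi⟩ := this
      rw [← hi]; exact hn.2.1 i
    exact_mod_cast Finset.card_le_card hsub
  have h2 := Finset.sum_le_sum h1
  rw [Finset.sum_const, Finset.card_powersetCard, Nat.card_Icc, Nat.add_sub_cancel, nsmul_eq_mul] at h2
  have h3 : ∑ T ∈ (Finset.Icc 1 G).powersetCard k, ((S.filter (fun n => T ⊆ rset z (Wk k) G n ∧ (rset z (Wk k) G n).card ≤ M)).card : ℝ) ≤ S.card * 2^M := by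
    have e1 : ∀ T, ((S.filter (fun n => T ⊆ rset z (Wk k) G n ∧ (rset z (Wk k) G n).card ≤ M)).card : ℝ) =
      ∑ n ∈ S, if (T ⊆ rset z (Wk k) G n ∧ (rset z (Wk k) G n).card ≤ M) then (1:ℝ) else 0 := by
      intro T
      rw [Finset.card_filter]; push_cast; rfl
    simp only [e1]
    rw [Finset.sum_comm]
    have e2 : ∀ n ∈ S, ∑ T ∈ (Finset.Icc 1 G).powersetCard k, (if (T ⊆ rset z (Wk k) G n ∧ (rset z (Wk k) G n).card ≤ M) then (1:ℝ) else 0) ≤ 2^M := by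
      intro n _
      by_cases hm : (rset z (Wk k) G n).card ≤ M
      · rw [← Finset.sum_filter, Finset.sum_const, nsmul_eq_mul, mul_one]
        have : ((Finset.Icc 1 G).powersetCard k).filter (fun T => T ⊆ rset z (Wk k) G n ∧ (rset z (Wk k) G n).card ≤ M) ⊆ (rset z (Wk k) G n).powerset := by
          intro T hT
          rw [Finset.mem_powerset]
          exact (Finset.mem_filter.1 hT).2.1
        have := Finset.card_le_card this
        rw [Finset.card_powerset] at this
        have := this.trans (Nat.pow_le_pow_right (by norm_num) hm)
        exact_mod_cast this
      · have : ∀ T ∈ (Finset.Icc 1 G).powersetCard k, (if (T ⊆ rset z (Wk k) G n ∧ (rset z (Wk k) G n).card ≤ M) then (1:ℝ) else 0) = 0 := by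
          intro T _
          rw [if_neg]
          exact fun hh => hm hh.2
        rw [Finset.sum_eq_zero this]
        positivity
    refine (Finset.sum_le_sum e2).trans ?_
    rw [Finset.sum_const, nsmul_eq_mul]
  have h4 : ((G:ℝ)/2)^k / k.factorial ≤ (G.choose k : ℝ) := by
    refine le_trans ?_ (Nat.pow_le_choose k G)
    have : (G:ℝ)/2 ≤ ((G+1-k:ℕ):ℝ) := by
      rw [div_le_iff₀ (by norm_num)]
      exact_mod_cast (show G ≤ (G+1-k)*2 by omega)
    gcongr
  rw [← hS]
  have h5 := mul_le_mul_of_nonneg_right h4 (show 0 ≤ c*N/(Real.log z)^k by positivity)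
  have h6 := (h5.trans h2).trans h3
  have h7 : c/(2^k*k.factorial*2^M) * N * (G / Real.log z)^k = ((G:ℝ)/2)^k / k.factorial * (c*N/(Real.log z)^k) / 2^M := by
    rw [div_pow, div_pow]; field_simp
  rw [h7, div_le_iff₀ (by positivity)]
  exact h6

theorem many_N (hEH : HasLevelOfDistribution 1) : ∃ k W : ℕ, 3 ≤ k ∧ 1 ≤ W ∧ ∃ c : ℝ, 0 < c ∧ ∀ η : ℝ, 0 < η → η ≤ 1 →
    ∃ N0 : ℕ, ∀ N : ℕ, N0 ≤ N → ∃ G : ℕ, ((W * G : ℕ):ℝ) ≤ η * Real.log N ∧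
      c * η^k * N ≤ (((Finset.Ioc N (2*N)).filter (fun n => 3 ≤ (pset W G n).card)).card : ℝ) := by
  obtain ⟨k, hk3, K, hK1, c, hc, z0, hz⟩ := many_z hEH
  have hWp : (1:ℝ) ≤ Wk k := by exact_mod_cast Wk_pos k
  refine ⟨k, Wk k, hk3, Wk_pos k, c/(2*Wk k)^k, by positivity, ?_⟩
  intro η hη hη1
  have hKr : (1:ℝ) ≤ K := by exact_mod_cast hK1
  -- log z small against z
  have hlo : ∀ᶠ z : ℕ in Filter.atTop, 16*K*Real.log z ≤ z := by
    have h1 := Real.isLittleO_log_id_atTop.comp_tendsto tendsto_natCast_atTop_atTop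
    have h2 := h1.bound (show (0:ℝ) < 1/(16*K) by positivity)
    filter_upwards [h2, Filter.eventually_ge_atTop 1] with z hz hz1
    simp only [Function.comp_apply, id_eq, Real.norm_eq_abs, Nat.abs_cast] at hz
    have h3 := (le_abs_self _).trans hz
    calc 16*K*Real.log z ≤ 16*K*(1/(16*K)*z) := mul_le_mul_of_nonneg_left h3 (by positivity)
      _ = z := by field_simp
  obtain ⟨z1, hz1⟩ := Filter.eventually_atTop.1 hlo
  obtain ⟨N1, hN1⟩ := exists_nat_ge (Real.exp (Wk k * (2*k+2)/η))
  obtain ⟨zm, hzm⟩ : ∃ zm, zm = z0+z1+6 := ⟨_, rfl⟩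
  refine ⟨N1 + zm^(8*K) + 3, ?_⟩
  intro N hN
  obtain ⟨z, hzdef⟩ : ∃ z, z = Nat.findGreatest (fun z => z^(8*K) ≤ N) N := ⟨_, rfl⟩
  have hzz : zm ≤ z := by
    rw [hzdef]
    apply Nat.le_findGreatest
    · have := Nat.le_self_pow (show 8*K ≠ 0 by omega) zm
      omega
    · omega
  have hzN : z^(8*K) ≤ N := by
    have := Nat.findGreatest_spec (P := fun z => z^(8*K) ≤ N) (n := N) (m := 0) (by omega) (by
      rw [zero_pow (by omega)]; omega)
    rw [hzdef]; exact this
  have hzN2 : N < (z+1)^(8*K) := by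
    by_contra hcon
    push Not at hcon
    have h1 : z + 1 ≤ N := (Nat.le_self_pow (show 8*K ≠ 0 by omega) _).trans hcon
    have := Nat.le_findGreatest (P := fun z => z^(8*K) ≤ N) h1 hcon
    omega
  have hz6 : 6 ≤ z := by omega
  have h3N : 3*N ≤ z^(16*K) := by
    have h1 : (z+1)^(8*K) ≤ (2*z)^(8*K) := Nat.pow_le_pow_left (by omega) _
    have h2 : 3 * 2^(8*K) ≤ z^(8*K) := by
      calc 3*2^(8*K) ≤ 3^(8*K)*2^(8*K) := Nat.mul_le_mul_right _ (Nat.le_self_pow (by omega) 3)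
        _ = 6^(8*K) := by rw [← mul_pow]; norm_num
        _ ≤ _ := Nat.pow_le_pow_left hz6 _
    calc 3*N ≤ 3*(2*z)^(8*K) := by omega
      _ = (3*2^(8*K))*z^(8*K) := by rw [mul_pow]; ring
      _ ≤ z^(8*K)*z^(8*K) := Nat.mul_le_mul_right _ h2
      _ = z^(16*K) := by rw [← pow_add]; congr 1; ring
  have hNpos : (0:ℝ) < N := by exact_mod_cast (show 0 < N by omega)
  have hzpos : (0:ℝ) < z := by exact_mod_cast (show 0 < z by omega)
  have hlogN : Real.log N ≤ 16*K*Real.log z := by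
    have : Real.log N ≤ Real.log ((z^(16*K):ℕ):ℝ) := Real.log_le_log hNpos (by exact_mod_cast (show N ≤ z^(16*K) by omega))
    rw [Nat.cast_pow, Real.log_pow] at this
    push_cast at this
    exact this
  have hlogz : Real.log z ≤ Real.log N := Real.log_le_log hzpos (by
    exact_mod_cast (Nat.le_self_pow (show 8*K ≠ 0 by omega) z).trans hzN)
  have hlz1 := (log_R_bound z 0 (by omega)).2
  have hLbig : Wk k * (2*k+2)/η ≤ Real.log N := by
    rw [Real.le_log_iff_exp_le hNpos]
    exact hN1.trans (by exact_mod_cast (show N1 ≤ N by omega))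
  obtain ⟨L, hL⟩ : ∃ L, L = Real.log N := ⟨_, rfl⟩
  rw [← hL] at hLbig hlogN hlogz
  rw [div_le_iff₀ hη] at hLbig
  obtain ⟨G, hG⟩ : ∃ G, G = ⌊η * L / Wk k⌋₊ := ⟨_, rfl⟩
  have hL0 : 0 < L := by linarith
  have hG1 : (G:ℝ) ≤ η * L / Wk k := by rw [hG]; exact Nat.floor_le (by positivity)
  have hG2 : η * L / Wk k < G + 1 := by rw [hG]; exact Nat.lt_floor_add_one _
  have hbig : (2*k+2:ℝ) ≤ η * L / Wk k := by
    rw [le_div_iff₀ (by linarith)]; linarith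
  have hWG : ((Wk k * G : ℕ):ℝ) ≤ η * L := by
    rw [le_div_iff₀ (by linarith)] at hG1
    push_cast
    linarith
  have hηL : η * L ≤ L := by nlinarith
  refine ⟨G, by rw [← hL]; exact hWG, ?_⟩
  have hWGz : Wk k * G ≤ z := by
    have : ((Wk k * G : ℕ):ℝ) ≤ z := (hWG.trans hηL).trans (hlogN.trans (hz1 z (by omega)))
    exact_mod_cast this
  have h2k : 2*k ≤ G := by
    have : (2*k:ℝ) < G := by linarith
    exact_mod_cast this.le
  have hGK : (G:ℝ) ≤ 16*K*Real.log z := by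
    refine le_trans ?_ ((hWG.trans hηL).trans hlogN)
    exact_mod_cast Nat.le_mul_of_pos_left G (Wk_pos k)
  refine le_trans ?_ (hz z (by omega) N hzN h3N G h2k hGK hWGz)
  have hr : η/(2*Wk k) ≤ G/Real.log z := by
    rw [div_le_div_iff₀ (by positivity) (by linarith)]
    have e1 : η * L / Wk k ≤ 2 * G := by
      have : (1:ℝ) ≤ G := by exact_mod_cast (show 1 ≤ G by omega)
      linarith
    rw [div_le_iff₀ (by linarith)] at e1
    have : η * Real.log z ≤ η * L := mul_le_mul_of_nonneg_left hlogz hη.le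
    linarith
  have hp := pow_le_pow_left₀ (by positivity) hr k
  calc c/(2*Wk k)^k * η^k * N = c * N * (η/(2*Wk k))^k := by rw [div_pow]; ring
    _ ≤ _ := mul_le_mul_of_nonneg_left hp (by positivity)

lemma nth_of_three {W G n : ℕ} (hW : 1 ≤ W) (h3 : 3 ≤ (pset W G n).card) :
    n + 1 ≤ nthPrime (Nat.count Nat.Prime (n+1)) ∧ nthPrime (Nat.count Nat.Prime (n+1) + 2) ≤ n + W*G := by
  constructor
  · exact (Nat.count_le_iff_le_nth Nat.infinite_setOfPred_prime).1 le_rfl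
  · have h1 : Nat.count Nat.Prime (n+1) + 2 < Nat.count Nat.Prime (n + W*G+1) := by
      have hcc : ∀ m, Nat.count Nat.Prime m = ((Finset.range m).filter Nat.Prime).card := by
        intro m
        rw [Nat.count_eq_card_filter_range]
      rw [hcc, hcc]
      have h4 : ((pset W G n).image (fun g => n + W*g)).card = (pset W G n).card := by
        apply Finset.card_image_of_injective
        intro a b hab
        have : W*a = W*b := by simpa using hab
        exact Nat.eq_of_mul_eq_mul_left hW this
      have hdis : Disjoint ((Finset.range (n+1)).filter Nat.Prime) ((pset W G n).image (fun g => n + W*g)) := by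
        rw [Finset.disjoint_left]
        intro x hx hx'
        rw [Finset.mem_filter, Finset.mem_range] at hx
        obtain ⟨g, hg, rfl⟩ := Finset.mem_image.1 hx'
        have hg1 := (Finset.mem_Icc.1 (Finset.mem_filter.1 hg).1).1
        have : 1 ≤ W*g := Nat.mul_pos hW hg1
        omega
      have hsub : ((Finset.range (n+1)).filter Nat.Prime) ∪ ((pset W G n).image (fun g => n + W*g)) ⊆ (Finset.range (n+W*G+1)).filter Nat.Prime := by
        intro x hx
        rw [Finset.mem_filter, Finset.mem_range]
        rcases Finset.mem_union.1 hx with hx | hx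
        · rw [Finset.mem_filter, Finset.mem_range] at hx
          exact ⟨by omega, hx.2⟩
        · obtain ⟨g, hg, rfl⟩ := Finset.mem_image.1 hx
          have hg' := Finset.mem_filter.1 hg
          have := Nat.mul_le_mul_left W (Finset.mem_Icc.1 hg'.1).2
          exact ⟨by omega, hg'.2⟩
      have := Finset.card_le_card hsub
      rw [Finset.card_union_of_disjoint hdis, h4] at this
      omega
    have := Nat.nth_lt_of_lt_count h1
    unfold nthPrime
    omega

lemma S_le_gap {N W G : ℕ} (hW : 1 ≤ W) (H : ℝ) (hH : ((W*G:ℕ):ℝ) ≤ H) :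
    ((Finset.Ioc N (2*N)).filter (fun n => 3 ≤ (pset W G n).card)).card ≤ W*G * (gapCount2 N H + 1) := by
  classical
  obtain ⟨S, hS⟩ : ∃ S, S = (Finset.Ioc N (2*N)).filter (fun n => 3 ≤ (pset W G n).card) := ⟨_, rfl⟩
  rw [← hS, ← Finset.card_filter_add_card_filter_not (s := S) (fun n => n + W*G ≤ 2*N), mul_add, mul_one]
  apply Nat.add_le_add
  · unfold gapCount2
    apply Finset.card_le_mul_card_image_of_maps_to (f := fun n => Nat.count Nat.Prime (n+1))
    · intro n hn
      rw [Finset.mem_filter, hS, Finset.mem_filter, Finset.mem_Ioc] at hn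
      obtain ⟨a1, a2⟩ := nth_of_three hW hn.1.2
      have hmono : StrictMono nthPrime := Nat.nth_strictMono Nat.infinite_setOfPred_prime
      have a3 := hmono (show Nat.count Nat.Prime (n+1) < Nat.count Nat.Prime (n+1) + 2 by omega)
      have a4 := hmono.le_apply (x := Nat.count Nat.Prime (n+1))
      simp only [Finset.mem_filter, Finset.mem_range]
      refine ⟨by omega, by omega, by omega, ?_⟩
      refine le_trans ?_ hH
      have : nthPrime (Nat.count Nat.Prime (n+1) + 2) ≤ nthPrime (Nat.count Nat.Prime (n+1)) + W*G := by omega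
      have : (nthPrime (Nat.count Nat.Prime (n+1) + 2):ℝ) ≤ nthPrime (Nat.count Nat.Prime (n+1)) + (W*G:ℕ) := by exact_mod_cast this
      linarith
    · intro j _
      have hsub : (S.filter (fun n => n + W*G ≤ 2*N)).filter (fun n => Nat.count Nat.Prime (n+1) = j) ⊆ Finset.Ico (nthPrime j - W*G) (nthPrime j) := by
        intro n hn
        rw [Finset.mem_filter, Finset.mem_filter, hS, Finset.mem_filter] at hn
        obtain ⟨a1, a2⟩ := nth_of_three hW hn.1.1.2
        have hmono : StrictMono nthPrime := Nat.nth_strictMono Nat.infinite_setOfPred_prime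
        have a3 := hmono (show Nat.count Nat.Prime (n+1) < Nat.count Nat.Prime (n+1) + 2 by omega)
        rw [hn.2] at a1 a2 a3
        rw [Finset.mem_Ico]
        omega
      have := Finset.card_le_card hsub
      rw [Nat.card_Ico] at this
      omega
  · have hsub : S.filter (fun n => ¬ n + W*G ≤ 2*N) ⊆ Finset.Ioc (2*N - W*G) (2*N) := by
      intro n hn
      rw [Finset.mem_filter, hS, Finset.mem_filter, Finset.mem_Ioc] at hn
      rw [Finset.mem_Ioc]
      omega
    have := Finset.card_le_card hsub
    rw [Nat.card_Ioc] at this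
    omega

theorem main_final (hEH : HasLevelOfDistribution 1) :
    ∃ η₀ : ℝ, 0 < η₀ ∧ ∀ η : ℝ, 0 < η → η < η₀ →
      ∀ ε : ℝ, 0 < ε → ∃ N₀ : ℕ, ∀ N : ℕ, N₀ ≤ N →
        (1 - ε) * (Real.exp (5 * η ^ (-2 : ℤ) * Real.log η) * N / Real.log N) ≤
          (gapCount2 N (η * Real.log N) : ℝ) := by
  obtain ⟨k, W, hk, hW, c, hc, hmany⟩ := many_N hEH
  have hkr : (3:ℝ) ≤ k := by exact_mod_cast hk
  refine ⟨min (1/(k+1)) (c/2), by positivity, ?_⟩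
  intro η hη hη0 ε hε
  have hη1 : η < 1/(k+1) := hη0.trans_le (min_le_left _ _)
  have hη2 : η < c/2 := hη0.trans_le (min_le_right _ _)
  rw [lt_div_iff₀ (by positivity)] at hη1
  have hηle : η ≤ 1 := by nlinarith
  obtain ⟨N0, hN0⟩ := hmany η hη hηle
  obtain ⟨E, hE⟩ : ∃ E, E = Real.exp (5 * η ^ (-2 : ℤ) * Real.log η) := ⟨_, rfl⟩
  have hE0 : 0 < E := by rw [hE]; exact Real.exp_pos _
  have hEle : E ≤ c/2*η^k := by
    have h1 : E ≤ η^(k+1) := by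
      have : η^(k+1) = Real.exp ((k+1)*Real.log η) := by
        rw [mul_comm, Real.exp_mul, Real.exp_log hη]
        exact_mod_cast (Real.rpow_natCast η (k+1)).symm
      rw [hE, this]
      apply Real.exp_le_exp.2
      apply mul_le_mul_of_nonpos_right _ (Real.log_nonpos hη.le hηle)
      have h2 : η^(-2:ℤ) = 1/η^2 := by
        rw [zpow_neg, one_div]; norm_cast
      rw [h2, mul_one_div, le_div_iff₀ (by positivity)]
      nlinarith
    refine h1.trans ?_
    rw [pow_succ, mul_comm]
    exact mul_le_mul_of_nonneg_right hη2.le (by positivity)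
  have hlo : ∀ᶠ N : ℕ in Filter.atTop, Real.log N ≤ c/2*η^k * N := by
    have h1 := Real.isLittleO_log_id_atTop.comp_tendsto tendsto_natCast_atTop_atTop
    have h2 := h1.bound (show (0:ℝ) < c/2*η^k by positivity)
    filter_upwards [h2] with z hz
    simp only [Function.comp_apply, id_eq, Real.norm_eq_abs, Nat.abs_cast] at hz
    exact (le_abs_self _).trans hz
  obtain ⟨N1, hN1⟩ := Filter.eventually_atTop.1 hlo
  refine ⟨N0 + N1 + 3, fun N hN => ?_⟩
  rw [← hE]
  obtain ⟨G, hG1, hG2⟩ := hN0 N (by omega)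
  have h1 := hN1 N (by omega)
  obtain ⟨L, hL⟩ : ∃ L, L = Real.log N := ⟨_, rfl⟩
  have hL0 : 0 < L := by rw [hL]; exact Real.log_pos (by exact_mod_cast (show 1 < N by omega))
  have h2 : (((Finset.Ioc N (2*N)).filter (fun n => 3 ≤ (pset W G n).card)).card : ℝ) ≤ ((W*G:ℕ):ℝ) * (gapCount2 N (η * Real.log N) + 1) := by
    exact_mod_cast S_le_gap hW (η * Real.log N) hG1
  rw [← hL] at h1 h2 hG1 ⊢
  obtain ⟨g, hg⟩ : ∃ g : ℝ, g = (gapCount2 N (η * L) : ℝ) := ⟨_, rfl⟩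
  have hg0 : 0 ≤ g := by rw [hg]; positivity
  rw [← hg] at h2 ⊢
  have h3 : c * η^k * N ≤ L * (g+1) := by
    refine (hG2.trans h2).trans (mul_le_mul_of_nonneg_right (hG1.trans ?_) (by linarith))
    nlinarith
  have h4 : E * N ≤ g * L := by
    have := mul_le_mul_of_nonneg_right hEle (show (0:ℝ) ≤ N by positivity)
    linarith
  have h5 : E * N / L ≤ g := by rw [div_le_iff₀ hL0]; exact h4
  have h6 : 0 ≤ E * N / L := by positivity
  nlinarith

/-- **Theorem 5 (GPY IV).** Assuming the Elliott–Halberstam conjecture (level of distribution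
`ϑ = 1`), for sufficiently small fixed `η > 0`, as `N → ∞`,
`#{j : N < p_j ≤ 2N, p_{j+2} - p_j ≤ η log N} ≥ (1-o(1)) e^{c₇ η^{-2} log η} N / log N`
with `c₇ = 5`. -/
theorem small_gaps_pnplus2_EH (hEH : HasLevelOfDistribution 1) :
    ∃ η₀ : ℝ, 0 < η₀ ∧ ∀ η : ℝ, 0 < η → η < η₀ →
      ∀ ε : ℝ, 0 < ε → ∃ N₀ : ℕ, ∀ N : ℕ, N₀ ≤ N →
        (1 - ε) * (Real.exp (5 * η ^ (-2 : ℤ) * Real.log η) * N / Real.log N) ≤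
          (gapCount2 N (η * Real.log N) : ℝ) := by
  exact main_final hEH
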